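/- Let ψ be the (σ,λ)-GFF on V_N. Let η > 0, β > 0 and ρ ∈ (0,λ_1), and set f̃_{N,ρ}^ψ(β) = (1/log N²) log Σ_{v∈A_{N,ρ}^c} e^{βψ_v}, where A_{N,ρ}^c = V_N ∖ A_{N,ρ}. Then there exists c = c(η,β,ρ,σ,λ) > 0 such that for N large enough, P(f̃_{N,ρ}^ψ(β) > (f^ψ(β) − ρ/2) + η) ≤ N^{−c}. -/

import Mathlib

open Filter
open scoped Classical

noncomputable section GFFCommon

/-- Vertices of `ℤ²`. -/
abbrev Vtx : Type := ℤ × ℤ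

/-- Sample space: a real-valued field indexed by the vertices of `ℤ²`. -/
abbrev FieldSp : Type := Vtx → ℝ

/-- The box `V_N = {0,1,…,N}²`. -/
def VN (N : ℕ) : Finset Vtx := Finset.Icc (0, 0) ((N : ℤ), (N : ℤ))

/-- The boundary `∂B` of a finite box `B ⊆ ℤ²`:
vertices of `B` having a (Euclidean distance 1) neighbour outside `B`. -/
def bdry (B : Finset Vtx) : Finset Vtx :=
  B.filter fun v =>
    ¬((v.1 + 1, v.2) ∈ B ∧ (v.1 - 1, v.2) ∈ B ∧ (v.1, v.2 + 1) ∈ B ∧ (v.1, v.2 - 1) ∈ B)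

/-- The interior `B° = B ∖ ∂B`. -/
def intr (B : Finset Vtx) : Finset Vtx := B \ bdry B

/-- The neighbourhood `[v]_λ` of `v` in `V_N`. -/
def nbhd (N : ℕ) (lam : ℝ) (v : Vtx) : Finset Vtx :=
  if lam = 0 then VN N
  else if lam = 1 then {v}
  else (VN N).filter fun w =>
    |(w.1 : ℝ) - (v.1 : ℝ)| ≤ (N : ℝ) ^ ((1 : ℝ) - lam) / 2 ∧
    |(w.2 : ℝ) - (v.2 : ℝ)| ≤ (N : ℝ) ^ ((1 : ℝ) - lam) / 2

/-- The σ-algebra `F_{∂[v]_λ ∪ [v]_λ^c}`, generated by the field variables on the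
boundary of `[v]_λ` and those outside of it. -/
def scaleAlg (N : ℕ) (lam : ℝ) (v : Vtx) : MeasurableSpace FieldSp :=
  ⨆ w ∈ {w : Vtx | w ∈ VN N ∧ w ∉ intr (nbhd N lam v)},
    MeasurableSpace.comap (fun ω : FieldSp => ω w) inferInstance

/-- `G` is the Green function of simple random walk killed on `∂B`, normalized by `π/2`:
it vanishes unless both arguments are in `B°`, and in `B°` it satisfies the
first-step (discrete Poisson equation) characterization
`G(x,y) = (1/4)·Σ_{x'∼x} G(x',y) + (π/2)·1_{x=y}`. -/
def IsGreenFn (B : Finset Vtx) (G : Vtx → Vtx → ℝ) : Prop :=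
  (∀ x y : Vtx, x ∉ intr B ∨ y ∉ intr B → G x y = 0) ∧
  ∀ y ∈ intr B, ∀ x ∈ intr B,
    G x y = (G (x.1 + 1, x.2) y + G (x.1 - 1, x.2) y
        + G (x.1, x.2 + 1) y + G (x.1, x.2 - 1) y) / 4
      + (Real.pi / 2) * (if x = y then 1 else 0)

/-- `P` is the law (on the canonical space `FieldSp`) of the Gaussian free field on `V_N`:
a centered Gaussian field with covariance the Green function `G_{V_N}`. -/
def IsGFF (N : ℕ) (P : MeasureTheory.Measure FieldSp) : Prop :=
  MeasureTheory.IsProbabilityMeasure P ∧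
  ∃ G : Vtx → Vtx → ℝ, IsGreenFn (VN N) G ∧
    ∀ c : Vtx → ℝ,
      P.map (fun ω => ∑ v ∈ VN N, c v * ω v) =
        ProbabilityTheory.gaussianReal 0 (Real.toNNReal (∑ v ∈ VN N, ∑ w ∈ VN N, c v * c w * G v w))

open MeasureTheory in
/-- `φ_v(λ) = E[φ_v | F_{∂[v]_λ ∪ [v]_λ^c}]`. -/
def phiScale (N : ℕ) (P : MeasureTheory.Measure FieldSp) (v : Vtx) (lam : ℝ) : FieldSp → ℝ :=
  P[fun ω : FieldSp => ω v | scaleAlg N lam v]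

/-- Admissible parameters `(σ,λ)`: `σ_1,…,σ_M > 0` and `0 = λ_0 < λ_1 < … < λ_M = 1`. -/
def ScaleParams (M : ℕ) (sigv lamv : ℕ → ℝ) : Prop :=
  1 ≤ M ∧ (∀ i ∈ Finset.Icc 1 M, 0 < sigv i) ∧
  lamv 0 = 0 ∧ lamv M = 1 ∧ ∀ i, i < M → lamv i < lamv (i + 1)

/-- The `(σ,λ)`-GFF: `ψ_v = Σ_{i=1}^M σ_i (φ_v(λ_i) − φ_v(λ_{i−1}))`. -/
def psiFld (N M : ℕ) (sigv lamv : ℕ → ℝ) (P : MeasureTheory.Measure FieldSp) (v : Vtx) : FieldSp → ℝ :=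
  fun ω => ∑ i ∈ Finset.Icc 1 M, sigv i * (phiScale N P v (lamv i) ω - phiScale N P v (lamv (i - 1)) ω)

open MeasureTheory in
/-- `ψ_v(λ) = E[ψ_v | F_{∂[v]_λ ∪ [v]_λ^c}]`. -/
def psiScale (N M : ℕ) (sigv lamv : ℕ → ℝ) (P : MeasureTheory.Measure FieldSp) (v : Vtx) (lam : ℝ) :
    FieldSp → ℝ :=
  P[psiFld N M sigv lamv P v | scaleAlg N lam v]

/-- The increment `ψ_v(λ,λ') = ψ_v(λ') − ψ_v(λ)`. -/
def psiInc (N M : ℕ) (sigv lamv : ℕ → ℝ) (P : MeasureTheory.Measure FieldSp) (v : Vtx) (lam lam' : ℝ) :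
    FieldSp → ℝ :=
  fun ω => psiScale N M sigv lamv P v lam' ω - psiScale N M sigv lamv P v lam ω

/-- The step function `σ(s) = σ_1 1_{{0}}(s) + Σ_{i=1}^M σ_i 1_{(λ_{i−1},λ_i]}(s)`. -/
def stepFn (M : ℕ) (sigv lamv : ℕ → ℝ) (s : ℝ) : ℝ :=
  (if s = 0 then sigv 1 else 0) +
  ∑ i ∈ Finset.Icc 1 M, if lamv (i - 1) < s ∧ s ≤ lamv i then sigv i else 0

/-- `𝒥_f(s) = ∫_0^s f(r) dr`. -/
def Jint (f : ℝ → ℝ) (s : ℝ) : ℝ := ∫ r in (0:ℝ)..s, f r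

/-- `𝒥_f(s₁,s₂) = ∫_{s₁}^{s₂} f(r) dr`. -/
def Jint2 (f : ℝ → ℝ) (s₁ s₂ : ℝ) : ℝ := ∫ r in s₁..s₂, f r

/-- The speed function `𝒥_{σ²}`. -/
def Jsig2 (M : ℕ) (sigv lamv : ℕ → ℝ) (s : ℝ) : ℝ := Jint (fun r => (stepFn M sigv lamv r) ^ 2) s

/-- The normalized speed function `𝒥̄_{σ²} = 𝒥_{σ²}/𝒥_{σ²}(1)`. -/
def JsigBar (M : ℕ) (sigv lamv : ℕ → ℝ) (s : ℝ) : ℝ := Jsig2 M sigv lamv s / Jsig2 M sigv lamv 1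

/-- The concave hull on `[0,1]` of a function `f`, i.e. the pointwise infimum over all
concave functions dominating `f` on `[0,1]`. -/
def concaveHull (f : ℝ → ℝ) (s : ℝ) : ℝ :=
  sInf {y | ∃ g : ℝ → ℝ, ConcaveOn ℝ (Set.Icc (0:ℝ) 1) g ∧
    (∀ t ∈ Set.Icc (0:ℝ) 1, f t ≤ g t) ∧ y = g s}

/-- The effective parameters: jump scales `0 = λ⁰ < … < λ^m = 1`, values
`σ̄_1 > … > σ̄_m > 0`, and the left-continuous non-increasing step function `σ̄`
such that `∫_0^s σ̄²` is the concavification of `𝒥_{σ²}`. -/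
def EffParams (M : ℕ) (sigv lamv : ℕ → ℝ) (m : ℕ) (sigb lamb : ℕ → ℝ) (sigbar : ℝ → ℝ) : Prop :=
  1 ≤ m ∧ m ≤ M ∧ lamb 0 = 0 ∧ lamb m = 1 ∧ (∀ j, j < m → lamb j < lamb (j + 1)) ∧
  (∀ l, 1 ≤ l → l < m → sigb (l + 1) < sigb l) ∧ (∀ l ∈ Finset.Icc 1 m, 0 < sigb l) ∧
  sigbar 0 = sigb 1 ∧
  (∀ l ∈ Finset.Icc 1 m, ∀ s : ℝ, lamb (l - 1) < s → s ≤ lamb l → sigbar s = sigb l) ∧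
  (∀ s : ℝ, 0 < s → s ≤ 1 →
    concaveHull (Jsig2 M sigv lamv) s = ∫ r in (0:ℝ)..s, (sigbar r) ^ 2)

/-- `γ* = 𝒥_{σ²/σ̄}(1)`. -/
def gammaStar (M : ℕ) (sigv lamv : ℕ → ℝ) (sigbar : ℝ → ℝ) : ℝ :=
  ∫ s in (0:ℝ)..1, (stepFn M sigv lamv s) ^ 2 / sigbar s

/-- The critical levels `γ^l = ∫_0^1 σ²(s)/σ̄(s ∧ λ^l) ds`, `γ⁰ = 0`. -/
def gammaL (M : ℕ) (sigv lamv : ℕ → ℝ) (lamb : ℕ → ℝ) (sigbar : ℝ → ℝ) (l : ℕ) : ℝ :=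
  if l = 0 then 0 else ∫ s in (0:ℝ)..1, (stepFn M sigv lamv s) ^ 2 / sigbar (min s (lamb l))

/-- `EntE` is the entropy function `𝓔` of the model. -/
def IsEntropy (M : ℕ) (sigv lamv : ℕ → ℝ) (m : ℕ) (lamb : ℕ → ℝ) (sigbar : ℝ → ℝ)
    (EntE : ℝ → ℝ) : Prop :=
  EntE 0 = 1 ∧
  ∀ l ∈ Finset.Icc 1 m, ∀ γ : ℝ,
    gammaL M sigv lamv lamb sigbar (l - 1) < γ → γ ≤ gammaL M sigv lamv lamb sigbar l →
      EntE γ = (1 - lamb (l - 1)) -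
        (γ - ∫ s in (0:ℝ)..(lamb (l - 1)), (stepFn M sigv lamv s) ^ 2 / sigbar s) ^ 2 /
          Jint2 (fun r => (stepFn M sigv lamv r) ^ 2) (lamb (l - 1)) 1

/-- The limiting free energy of the `REM(σ)` model. -/
def fREM (σ β : ℝ) : ℝ :=
  if (2 / σ) < β then 2 * (β / (2 / σ)) else 1 + (β / (2 / σ)) ^ 2

/-- The index `l_β`. -/
def lbeta (m : ℕ) (sigb : ℕ → ℝ) (β : ℝ) : ℕ :=
  if β ≤ 2 / sigb m then sInf {l : ℕ | 1 ≤ l ∧ β ≤ 2 / sigb l} else m + 1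

/-- The limiting free energy `f^ψ(β)`, written with the `l_β` split. -/
def fpsiLim (m : ℕ) (sigb lamb : ℕ → ℝ) (β : ℝ) : ℝ :=
  (∑ j ∈ Finset.Icc 1 (lbeta m sigb β - 1), (2 * β / (2 / sigb j)) * (lamb j - lamb (j - 1))) +
  ∑ j ∈ Finset.Icc (lbeta m sigb β) m, (1 + β ^ 2 / (2 / sigb j) ^ 2) * (lamb j - lamb (j - 1))

/-- The set `ℬ` of non-critical inverse temperatures. -/
def critSet (m : ℕ) (sigb : ℕ → ℝ) : Set ℝ :=
  {β | 0 < β ∧ ∀ j ∈ Finset.Icc 1 m, β ≠ 2 / sigb j}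

/-- The partition function `Z_N^ψ(β)`. -/
def ZN (N M : ℕ) (sigv lamv : ℕ → ℝ) (P : MeasureTheory.Measure FieldSp) (β : ℝ) (ω : FieldSp) : ℝ :=
  ∑ v ∈ VN N, Real.exp (β * psiFld N M sigv lamv P v ω)

/-- The free energy `f_N^ψ(β)` on `V_N`. -/
def freeEnergy (N M : ℕ) (sigv lamv : ℕ → ℝ) (P : MeasureTheory.Measure FieldSp) (β : ℝ) (ω : FieldSp) : ℝ :=
  (Real.log ((N : ℝ) ^ 2))⁻¹ * Real.log (ZN N M sigv lamv P β ω)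

/-- The set `A_{N,ρ}` of points at distance at least `N^{1−ρ}` from `ℤ² ∖ V_N`. -/
def AN (N : ℕ) (ρ : ℝ) : Finset Vtx :=
  (VN N).filter fun v => ∀ z : Vtx, z ∉ VN N →
    (N : ℝ) ^ ((1 : ℝ) - ρ) ≤ Real.sqrt (((v.1 : ℝ) - (z.1 : ℝ)) ^ 2 + ((v.2 : ℝ) - (z.2 : ℝ)) ^ 2)

/-- The restricted partition function `Z_{N,ρ}^ψ(β)`. -/
def ZNres (N M : ℕ) (sigv lamv : ℕ → ℝ) (P : MeasureTheory.Measure FieldSp) (β ρ : ℝ) (ω : FieldSp) : ℝ :=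
  ∑ v ∈ AN N ρ, Real.exp (β * psiFld N M sigv lamv P v ω)

/-- The free energy `f_{N,ρ}^ψ(β)` on `A_{N,ρ}`. -/
def freeEnergyRes (N M : ℕ) (sigv lamv : ℕ → ℝ) (P : MeasureTheory.Measure FieldSp) (β ρ : ℝ)
    (ω : FieldSp) : ℝ :=
  (Real.log ((N : ℝ) ^ 2))⁻¹ * Real.log (ZNres N M sigv lamv P β ρ ω)

/-- The Gibbs weight `𝒢_{β,N}({v})`. -/
def gibbsW (N M : ℕ) (sigv lamv : ℕ → ℝ) (P : MeasureTheory.Measure FieldSp) (β : ℝ) (v : Vtx)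
    (ω : FieldSp) : ℝ :=
  Real.exp (β * psiFld N M sigv lamv P v ω) / ZN N M sigv lamv P β ω

/-- The restricted Gibbs weight `𝒢_{β,N,ρ}({v})`. -/
def gibbsWres (N M : ℕ) (sigv lamv : ℕ → ℝ) (P : MeasureTheory.Measure FieldSp) (β ρ : ℝ) (v : Vtx)
    (ω : FieldSp) : ℝ :=
  Real.exp (β * psiFld N M sigv lamv P v ω) / ZNres N M sigv lamv P β ρ ω

/-- `E𝒢_{β,N}^{×s}[F]`: the mean over the disorder of the `s`-fold Gibbs average of `F`. -/
def gibbsExp (N M : ℕ) (sigv lamv : ℕ → ℝ) (P : MeasureTheory.Measure FieldSp) (β : ℝ) (s : ℕ)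
    (F : (Fin s → Vtx) → ℝ) : ℝ :=
  ∫ ω, (∑ vv ∈ Fintype.piFinset (fun _ : Fin s => VN N),
    (∏ i, gibbsW N M sigv lamv P β (vv i) ω) * F vv) ∂P

/-- `E𝒢_{β,N,ρ}^{×s}[F]`, with an `ω`-dependent integrand allowed. -/
def gibbsExpRes (N M : ℕ) (sigv lamv : ℕ → ℝ) (P : MeasureTheory.Measure FieldSp) (β ρ : ℝ) (s : ℕ)
    (F : (Fin s → Vtx) → FieldSp → ℝ) : ℝ :=
  ∫ ω, (∑ vv ∈ Fintype.piFinset (fun _ : Fin s => AN N ρ),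
    (∏ i, gibbsWres N M sigv lamv P β ρ (vv i) ω) * F vv ω) ∂P

/-- `E𝒢_{β,N}^{×s}[F]`, with an `ω`-dependent integrand allowed. -/
def gibbsExpW (N M : ℕ) (sigv lamv : ℕ → ℝ) (P : MeasureTheory.Measure FieldSp) (β : ℝ) (s : ℕ)
    (F : (Fin s → Vtx) → FieldSp → ℝ) : ℝ :=
  ∫ ω, (∑ vv ∈ Fintype.piFinset (fun _ : Fin s => VN N),
    (∏ i, gibbsW N M sigv lamv P β (vv i) ω) * F vv ω) ∂P

/-- The covariance `E[ψ_v ψ_{v'}]`. -/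
def psiCov (N M : ℕ) (sigv lamv : ℕ → ℝ) (P : MeasureTheory.Measure FieldSp) (v v' : Vtx) : ℝ :=
  ∫ ω, psiFld N M sigv lamv P v ω * psiFld N M sigv lamv P v' ω ∂P

/-- `C₀` is a constant witnessing the uniform variance upper bound
`max_{v∈V_N} E[ψ_v²] ≤ 𝒥_{σ²}(1) log N + C₀` for `N` large. -/
def IsVarBound (M : ℕ) (sigv lamv : ℕ → ℝ) (P : ℕ → MeasureTheory.Measure FieldSp) (C₀ : ℝ) : Prop :=
  0 < C₀ ∧ ∃ N₀ : ℕ, ∀ N ≥ N₀, ∀ v ∈ VN N,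
    psiCov N M sigv lamv (P N) v v ≤ Jsig2 M sigv lamv 1 * Real.log N + C₀

/-- The overlap `q^N(v,v')`. -/
def overlapQ (N M : ℕ) (sigv lamv : ℕ → ℝ) (P : MeasureTheory.Measure FieldSp) (C₀ : ℝ) (v v' : Vtx) : ℝ :=
  psiCov N M sigv lamv P v v' / (Jsig2 M sigv lamv 1 * Real.log N + C₀)

/-- Convergence in probability to a constant, for a sequence of random variables on a
sequence of probability spaces. -/
def TendstoInProb (P : ℕ → MeasureTheory.Measure FieldSp) (X : ℕ → FieldSp → ℝ) (c : ℝ) : Prop :=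
  ∀ ε : ℝ, 0 < ε → Tendsto (fun N => P N {ω | ε < |X N ω - c|}) atTop (nhds 0)

/-- Convergence in `L^p` to a constant. -/
def TendstoLp (P : ℕ → MeasureTheory.Measure FieldSp) (X : ℕ → FieldSp → ℝ) (p c : ℝ) : Prop :=
  Tendsto (fun N => ∫ ω, |X N ω - c| ^ p ∂(P N)) atTop (nhds 0)

/-- The branching scale `b_N(v,v')`. -/
def bScale (N : ℕ) (v v' : Vtx) : ℝ :=
  sSup {lam : ℝ | lam ∈ Set.Icc (0:ℝ) 1 ∧ ((nbhd N lam v) ∩ (nbhd N lam v')).Nonempty}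

end GFFCommon

noncomputable section GPot

/-- Sum over the four neighbours. -/
def nbS (f : Vtx → ℝ) (x : Vtx) : ℝ :=
  f (x.1 + 1, x.2) + f (x.1 - 1, x.2) + f (x.1, x.2 + 1) + f (x.1, x.2 - 1)

/-- Adjacency. -/
def AdjV (x y : Vtx) : Prop :=
  y = (x.1 + 1, x.2) ∨ y = (x.1 - 1, x.2) ∨ y = (x.1, x.2 + 1) ∨ y = (x.1, x.2 - 1)

/-- `-4Δ`. -/
def Lp (f : Vtx → ℝ) (x : Vtx) : ℝ := 4 * f x - nbS f x

theorem minPrinciple (S : Finset Vtx) (f : Vtx → ℝ)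
    (h1 : ∀ x ∈ S, f x < 0 → 0 ≤ Lp f x)
    (h2 : ∀ x ∈ S, ∀ y, AdjV x y → y ∉ S → 0 ≤ f y) : ∀ x ∈ S, 0 ≤ f x := by
  by_contra hcon
  push Not at hcon
  obtain ⟨x0, hx0, hx0n⟩ := hcon
  obtain ⟨x1, hx1, hmin⟩ := Finset.exists_min_image S f ⟨x0, hx0⟩
  have hm : f x1 < 0 := lt_of_le_of_lt (hmin x0 hx0) hx0n
  obtain ⟨x2, hx2, hmax⟩ := Finset.exists_max_image (S.filter fun x => f x = f x1) (fun x => x.1)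
    ⟨x1, by simp [hx1]⟩
  rw [Finset.mem_filter] at hx2
  obtain ⟨hx2S, hx2e⟩ := hx2
  have hl := h1 x2 hx2S (by rw [hx2e]; exact hm)
  have hge : ∀ y, AdjV x2 y → f x1 ≤ f y := by
    intro y hy
    by_cases hyS : y ∈ S
    · exact hmin y hyS
    · exact hm.le.trans (h2 x2 hx2S y hy hyS)
  have ha := hge (x2.1 + 1, x2.2) (by simp [AdjV])
  have hb := hge (x2.1 - 1, x2.2) (by simp [AdjV])
  have hc := hge (x2.1, x2.2 + 1) (by simp [AdjV])
  have hd := hge (x2.1, x2.2 - 1) (by simp [AdjV])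
  unfold Lp nbS at hl
  have he : f (x2.1 + 1, x2.2) = f x1 := by linarith
  have hS : (x2.1 + 1, x2.2) ∈ S := by
    by_contra hS
    have := h2 x2 hx2S (x2.1 + 1, x2.2) (by simp [AdjV]) hS
    linarith
  have := hmax (x2.1 + 1, x2.2) (by simp [hS, he])
  simp at this

theorem Lp_sub (f g : Vtx → ℝ) (x : Vtx) : Lp (fun y => f y - g y) x = Lp f x - Lp g x := by
  unfold Lp nbS; ring

theorem Lp_add (f g : Vtx → ℝ) (x : Vtx) : Lp (fun y => f y + g y) x = Lp f x + Lp g x := by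
  unfold Lp nbS; ring

theorem Lp_smul (c : ℝ) (g : Vtx → ℝ) (x : Vtx) : Lp (fun y => c * g y) x = c * Lp g x := by
  unfold Lp nbS; ring

theorem Lp_const (c : ℝ) (x : Vtx) : Lp (fun _ => c) x = 0 := by
  unfold Lp nbS; ring

theorem Lp_sum {ι : Type*} (s : Finset ι) (F : ι → Vtx → ℝ) (x : Vtx) :
    Lp (fun y => ∑ i ∈ s, F i y) x = ∑ i ∈ s, Lp (F i) x := by
  unfold Lp nbS
  simp only [Finset.sum_sub_distrib, Finset.sum_add_distrib, Finset.mul_sum]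

theorem Lp_congr {f g : Vtx → ℝ} {x : Vtx} (h0 : f x = g x)
    (h : ∀ y, AdjV x y → f y = g y) : Lp f x = Lp g x := by
  unfold Lp nbS
  rw [h0, h (x.1 + 1, x.2) (by simp [AdjV]), h (x.1 - 1, x.2) (by simp [AdjV]),
    h (x.1, x.2 + 1) (by simp [AdjV]), h (x.1, x.2 - 1) (by simp [AdjV])]

/-- comparison -/
theorem compareLe (S : Finset Vtx) (f g : Vtx → ℝ)
    (h1 : ∀ x ∈ S, Lp f x ≤ Lp g x)
    (h2 : ∀ x ∈ S, ∀ y, AdjV x y → y ∉ S → f y ≤ g y) : ∀ x ∈ S, f x ≤ g x := by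
  intro x hx
  have := minPrinciple S (fun y => g y - f y)
    (fun x hx _ => by rw [Lp_sub]; linarith [h1 x hx])
    (fun x hx y hy hyS => by linarith [h2 x hx y hy hyS]) x hx
  linarith

theorem compareLe' (S : Finset Vtx) (f g : Vtx → ℝ)
    (h1 : ∀ x ∈ S, Lp f x ≤ Lp g x)
    (h2 : ∀ y, y ∉ S → f y ≤ g y) : ∀ x, f x ≤ g x := by
  intro x
  by_cases hx : x ∈ S
  · exact compareLe S f g h1 (fun _ _ y _ hy => h2 y hy) x hx
  · exact h2 x hx

theorem uniqueSol (S : Finset Vtx) (f g : Vtx → ℝ)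
    (h1 : ∀ x ∈ S, Lp f x = Lp g x)
    (h2 : ∀ y, y ∉ S → f y = g y) : f = g := by
  funext x
  exact le_antisymm (compareLe' S f g (fun x hx => (h1 x hx).le) (fun y hy => (h2 y hy).le) x)
    (compareLe' S g f (fun x hx => (h1 x hx).ge) (fun y hy => (h2 y hy).ge) x)

theorem existSol (S : Finset Vtx) (f g : Vtx → ℝ) :
    ∃ u : Vtx → ℝ, (∀ x ∈ S, Lp u x = g x) ∧ ∀ x, x ∉ S → u x = f x := by
  let ext : (S → ℝ) →ₗ[ℝ] (Vtx → ℝ) :=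
    { toFun := fun w x => if h : x ∈ S then w ⟨x, h⟩ else 0
      map_add' := by
        intro a b; funext x; by_cases h : x ∈ S <;> simp [h]
      map_smul' := by
        intro a b; funext x; by_cases h : x ∈ S <;> simp [h] }
  have hextOff : ∀ w x, x ∉ S → ext w x = 0 := by
    intro w x hx; simp [ext, hx]
  have hextOn : ∀ w (x : S), ext w x = w x := by
    intro w x; simp [ext]
  let A : (S → ℝ) →ₗ[ℝ] (S → ℝ) :=
    { toFun := fun w x => Lp (ext w) x
      map_add' := by
        intro a b; funext x
        rw [map_add]; exact Lp_add _ _ _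
      map_smul' := by
        intro a b; funext x
        rw [map_smul]; exact Lp_smul _ _ _ }
  have hinj : Function.Injective A := by
    rw [← LinearMap.ker_eq_bot, LinearMap.ker_eq_bot']
    intro w hw
    have : ext w = fun _ => 0 := by
      apply uniqueSol S
      · intro x hx
        rw [Lp_const]
        exact congrFun hw ⟨x, hx⟩
      · intro y hy; exact hextOff w y hy
    funext x
    rw [← hextOn w x, this]; rfl
  have hsurj : Function.Surjective A := LinearMap.injective_iff_surjective.1 hinj
  let f' : Vtx → ℝ := fun x => if x ∈ S then 0 else f x
  obtain ⟨w, hw⟩ := hsurj (fun x => g x - Lp f' x)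
  refine ⟨fun x => f' x + ext w x, ?_, ?_⟩
  · intro x hx
    rw [Lp_add]
    have := congrFun hw ⟨x, hx⟩
    have h2 : A w ⟨x, hx⟩ = Lp (ext w) x := rfl
    rw [h2] at this
    simp only at this
    linarith
  · intro x hx
    simp only [f', hextOff w x hx, hx]; simp

/-- Harmonic extension. -/
def HS (S : Finset Vtx) (f : Vtx → ℝ) : Vtx → ℝ := Classical.choose (existSol S f (fun _ => 0))

theorem HS_on {S : Finset Vtx} {f : Vtx → ℝ} {x : Vtx} (hx : x ∈ S) : Lp (HS S f) x = 0 :=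
  (Classical.choose_spec (existSol S f (fun _ => 0))).1 x hx

theorem HS_off {S : Finset Vtx} {f : Vtx → ℝ} {x : Vtx} (hx : x ∉ S) : HS S f x = f x :=
  (Classical.choose_spec (existSol S f (fun _ => 0))).2 x hx

theorem HS_unique {S : Finset Vtx} {f u : Vtx → ℝ} (h1 : ∀ x ∈ S, Lp u x = 0)
    (h2 : ∀ x, x ∉ S → u x = f x) : HS S f = u :=
  uniqueSol S _ _ (fun x hx => by rw [HS_on hx, h1 x hx]) (fun y hy => by rw [HS_off hy, h2 y hy])

theorem HS_mono {S : Finset Vtx} {f g : Vtx → ℝ} (h : ∀ x, x ∉ S → f x ≤ g x) (x : Vtx) :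
    HS S f x ≤ HS S g x :=
  compareLe' S _ _ (fun x hx => by rw [HS_on hx, HS_on hx])
    (fun y hy => by rw [HS_off hy, HS_off hy]; exact h y hy) x

theorem HS_le {S : Finset Vtx} {f : Vtx → ℝ} {A : ℝ} (h : ∀ x, x ∉ S → f x ≤ A) (x : Vtx) :
    HS S f x ≤ A :=
  compareLe' S _ (fun _ => A) (fun x hx => by rw [HS_on hx, Lp_const])
    (fun y hy => by rw [HS_off hy]; exact h y hy) x

theorem HS_ge {S : Finset Vtx} {f : Vtx → ℝ} {A : ℝ} (h : ∀ x, x ∉ S → A ≤ f x) (x : Vtx) :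
    A ≤ HS S f x :=
  compareLe' S (fun _ => A) _ (fun x hx => by rw [HS_on hx, Lp_const])
    (fun y hy => by rw [HS_off hy]; exact h y hy) x

theorem HS_sub (S : Finset Vtx) (f g : Vtx → ℝ) :
    HS S (fun x => f x - g x) = fun x => HS S f x - HS S g x :=
  HS_unique (fun x hx => by rw [Lp_sub, HS_on hx, HS_on hx]; ring)
    (fun x hx => by rw [HS_off hx, HS_off hx])

theorem HS_smul (S : Finset Vtx) (c : ℝ) (f : Vtx → ℝ) :
    HS S (fun x => c * f x) = fun x => c * HS S f x :=
  HS_unique (fun x hx => by rw [Lp_smul, HS_on hx]; ring)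
    (fun x hx => by rw [HS_off hx])

theorem HS_sum {ι : Type*} (S : Finset Vtx) (s : Finset ι) (F : ι → Vtx → ℝ) :
    HS S (fun x => ∑ i ∈ s, F i x) = fun x => ∑ i ∈ s, HS S (F i) x :=
  HS_unique (fun x hx => by
      rw [Lp_sum]; exact Finset.sum_eq_zero fun i _ => HS_on hx)
    (fun x hx => Finset.sum_congr rfl fun i _ => HS_off hx)

theorem HS_HS {S S' : Finset Vtx} (h : S' ⊆ S) (f : Vtx → ℝ) : HS S' (HS S f) = HS S f :=
  HS_unique (fun _ hx => HS_on (h hx)) (fun _ _ => rfl)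

/-- Dirichlet Green function of `S`, as function of the first variable. -/
def GS (S : Finset Vtx) (x y : Vtx) : ℝ :=
  Classical.choose (existSol S (fun _ => 0) (fun z => if z = y then 2 * Real.pi else 0)) x

theorem GS_on {S : Finset Vtx} {x : Vtx} (y : Vtx) (hx : x ∈ S) :
    Lp (fun z => GS S z y) x = if x = y then 2 * Real.pi else 0 :=
  (Classical.choose_spec (existSol S (fun _ => 0)
    (fun z => if z = y then 2 * Real.pi else 0))).1 x hx

theorem GS_off {S : Finset Vtx} {x : Vtx} (y : Vtx) (hx : x ∉ S) : GS S x y = 0 :=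
  (Classical.choose_spec (existSol S (fun _ => 0)
    (fun z => if z = y then 2 * Real.pi else 0))).2 x hx

theorem GS_unique {S : Finset Vtx} {y : Vtx} {u : Vtx → ℝ}
    (h1 : ∀ x ∈ S, Lp u x = if x = y then 2 * Real.pi else 0)
    (h2 : ∀ x, x ∉ S → u x = 0) : ∀ x, u x = GS S x y := by
  have : u = fun z => GS S z y := uniqueSol S _ _ (fun x hx => by rw [GS_on y hx, h1 x hx])
    (fun x hx => by rw [h2 x hx, GS_off y hx])
  intro x; rw [this]

theorem GS_nonneg (S : Finset Vtx) (x y : Vtx) : 0 ≤ GS S x y :=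
  compareLe' S (fun _ => 0) (fun z => GS S z y)
    (fun x hx => by rw [Lp_const, GS_on y hx]; split_ifs <;> positivity)
    (fun z hz => by rw [GS_off y hz]) x

theorem GS_mono {S S' : Finset Vtx} (h : S' ⊆ S) (x y : Vtx) : GS S' x y ≤ GS S x y :=
  compareLe' S' (fun z => GS S' z y) (fun z => GS S z y)
    (fun x hx => by rw [GS_on y hx, GS_on y (h hx)])
    (fun z hz => by rw [GS_off y hz]; exact GS_nonneg _ _ _) x

theorem GS_off_right {S : Finset Vtx} {y : Vtx} (x : Vtx) (hy : y ∉ S) : GS S x y = 0 := by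
  have := GS_unique (S := S) (y := y) (u := fun _ => 0)
    (fun x hx => by rw [Lp_const, if_neg]; rintro rfl; exact hy hx) (fun _ _ => rfl) x
  exact this.symm

/-- `G_{S'} = G_S - H_{S'} G_S`. -/
theorem GS_sub_HS {S S' : Finset Vtx} (h : S' ⊆ S) (x y : Vtx) :
    GS S x y - HS S' (fun z => GS S z y) x = GS S' x y :=
  GS_unique (S := S') (y := y) (u := fun x => GS S x y - HS S' (fun z => GS S z y) x)
    (fun x hx => by
      rw [Lp_sub (fun x => GS S x y) (HS S' (fun z => GS S z y)), HS_on hx, GS_on y (h hx), sub_zero])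
    (fun x hx => by simp only [HS_off hx, sub_self]) x

theorem tsum_shift (f g : Vtx → ℝ) (e : Vtx) :
    ∑' x, f x * g (x + e) = ∑' x, f (x - e) * g x := by
  rw [← Equiv.tsum_eq (Equiv.addRight (-e)) (fun x => f x * g (x + e))]
  apply tsum_congr
  intro x
  simp [sub_eq_add_neg]

theorem green_identity (S : Finset Vtx) (f g : Vtx → ℝ) (hf : ∀ x, x ∉ S → f x = 0)
    (hg : ∀ x, x ∉ S → g x = 0) :
    ∑ x ∈ S, f x * Lp g x = ∑ x ∈ S, Lp f x * g x := by
  have key : ∀ e : Vtx, ∑ x ∈ S, f x * g (x + e) = ∑ x ∈ S, f (x - e) * g x := by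
    intro e
    have a1 : ∑' x, f x * g (x + e) = ∑ x ∈ S, f x * g (x + e) :=
      tsum_eq_sum (fun x hx => by simp [hf x hx])
    have a2 : ∑' x, f (x - e) * g x = ∑ x ∈ S, f (x - e) * g x :=
      tsum_eq_sum (fun x hx => by simp [hg x hx])
    rw [← a1, ← a2]
    exact tsum_shift f g e
  have k1 := key (1, 0)
  have k2 := key (-1, 0)
  have k3 := key (0, 1)
  have k4 := key (0, -1)
  have e1 : ∀ (f : Vtx → ℝ) (x : Vtx), f (x + (1, 0)) = f (x.1 + 1, x.2) := by
    intro f x; congr 1; ext <;> simp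
  have e2 : ∀ (f : Vtx → ℝ) (x : Vtx), f (x + (-1, 0)) = f (x.1 - 1, x.2) := by
    intro f x; congr 1; ext <;> simp [sub_eq_add_neg]
  have e3 : ∀ (f : Vtx → ℝ) (x : Vtx), f (x + (0, 1)) = f (x.1, x.2 + 1) := by
    intro f x; congr 1; ext <;> simp
  have e4 : ∀ (f : Vtx → ℝ) (x : Vtx), f (x + (0, -1)) = f (x.1, x.2 - 1) := by
    intro f x; congr 1; ext <;> simp [sub_eq_add_neg]
  have d1 : ∀ (f : Vtx → ℝ) (x : Vtx), f (x - (1, 0)) = f (x.1 - 1, x.2) := by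
    intro f x; congr 1; ext <;> simp
  have d2 : ∀ (f : Vtx → ℝ) (x : Vtx), f (x - (-1, 0)) = f (x.1 + 1, x.2) := by
    intro f x; congr 1; ext <;> simp
  have d3 : ∀ (f : Vtx → ℝ) (x : Vtx), f (x - (0, 1)) = f (x.1, x.2 - 1) := by
    intro f x; congr 1; ext <;> simp
  have d4 : ∀ (f : Vtx → ℝ) (x : Vtx), f (x - (0, -1)) = f (x.1, x.2 + 1) := by
    intro f x; congr 1; ext <;> simp
  simp only [e1, d1] at k1
  simp only [e2, d2] at k2
  simp only [e3, d3] at k3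
  simp only [e4, d4] at k4
  have l1 : ∑ x ∈ S, f x * Lp g x = ∑ x ∈ S, 4 * (f x * g x)
      - (∑ x ∈ S, f x * g (x.1 + 1, x.2) + ∑ x ∈ S, f x * g (x.1 - 1, x.2)
        + ∑ x ∈ S, f x * g (x.1, x.2 + 1) + ∑ x ∈ S, f x * g (x.1, x.2 - 1)) := by
    rw [← Finset.sum_add_distrib, ← Finset.sum_add_distrib, ← Finset.sum_add_distrib,
      ← Finset.sum_sub_distrib]
    apply Finset.sum_congr rfl; intro x _; unfold Lp nbS; ring
  have l2 : ∑ x ∈ S, Lp f x * g x = ∑ x ∈ S, 4 * (f x * g x)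
      - (∑ x ∈ S, f (x.1 - 1, x.2) * g x + ∑ x ∈ S, f (x.1 + 1, x.2) * g x
        + ∑ x ∈ S, f (x.1, x.2 - 1) * g x + ∑ x ∈ S, f (x.1, x.2 + 1) * g x) := by
    rw [← Finset.sum_add_distrib, ← Finset.sum_add_distrib, ← Finset.sum_add_distrib,
      ← Finset.sum_sub_distrib]
    apply Finset.sum_congr rfl; intro x _; unfold Lp nbS; ring
  rw [l1, l2, k1, k2, k3, k4]

theorem GS_symm (S : Finset Vtx) (x y : Vtx) : GS S x y = GS S y x := by
  by_cases hx : x ∈ S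
  swap
  · rw [GS_off y hx, GS_off_right y hx]
  by_cases hy : y ∈ S
  swap
  · rw [GS_off x hy, GS_off_right x hy]
  have := green_identity S (fun z => GS S z y) (fun z => GS S z x) (fun z hz => GS_off y hz)
    (fun z hz => GS_off x hz)
  have l : ∑ z ∈ S, GS S z y * Lp (fun z => GS S z x) z = GS S x y * (2 * Real.pi) := by
    rw [Finset.sum_eq_single x]
    · rw [GS_on x hx, if_pos rfl]
    · intro b hb hbx; rw [GS_on x hb, if_neg hbx, mul_zero]
    · intro h; exact absurd hx h
  have r : ∑ z ∈ S, Lp (fun z => GS S z y) z * GS S z x = (2 * Real.pi) * GS S y x := by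
    rw [Finset.sum_eq_single y]
    · rw [GS_on y hy, if_pos rfl]
    · intro b hb hbx; rw [GS_on y hb, if_neg hbx, zero_mul]
    · intro h; exact absurd hy h
  rw [l, r, mul_comm] at this
  exact mul_left_cancel₀ (by positivity) this

theorem green_eq {B : Finset Vtx} {G : Vtx → Vtx → ℝ} (h : IsGreenFn B G) (x y : Vtx) :
    G x y = GS (intr B) x y := by
  by_cases hy : y ∈ intr B
  · apply GS_unique (u := fun x => G x y)
    · intro x hx
      have := h.2 y hy x hx
      unfold Lp nbS
      split_ifs with hxy
      · rw [if_pos hxy] at this; linarith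
      · rw [if_neg hxy] at this; linarith
    · intro x hx; exact h.1 x y (Or.inl hx)
  · rw [h.1 x y (Or.inr hy), GS_off_right x hy]

end GPot

noncomputable section GGrad

/-- Box of radius `r`. -/
def Bx (v : Vtx) (r : ℤ) : Finset Vtx := Finset.Icc (v.1 - r, v.2 - r) (v.1 + r, v.2 + r)

theorem mem_Bx {v x : Vtx} {r : ℤ} :
    x ∈ Bx v r ↔ (v.1 - r ≤ x.1 ∧ x.1 ≤ v.1 + r) ∧ (v.2 - r ≤ x.2 ∧ x.2 ≤ v.2 + r) := by
  unfold Bx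
  rw [Finset.mem_Icc, Prod.le_def, Prod.le_def]
  simp only
  tauto

theorem AdjV_bound {x y : Vtx} (h : AdjV x y) :
    (x.1 - 1 ≤ y.1 ∧ y.1 ≤ x.1 + 1) ∧ (x.2 - 1 ≤ y.2 ∧ y.2 ≤ x.2 + 1) := by
  rcases h with h | h | h | h <;> subst h <;> simp only <;> omega

theorem grad_one_side (f : Vtx → ℝ) (x0 : Vtx) (r : ℤ) (hr : 1 ≤ r) (A : ℝ) (hA : 0 ≤ A)
    (hharm : ∀ x ∈ Bx x0 r, Lp f x = 0) (hb : ∀ x ∈ Bx x0 (r + 1), |f x| ≤ A) :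
    f (x0.1 + 1, x0.2) - f x0 ≤ 2 * A / r := by
  have hrR : (1 : ℝ) ≤ r := by exact_mod_cast hr
  let R : Vtx → Vtx := fun y => (2 * x0.1 + 1 - y.1, y.2)
  let d : Vtx → ℝ := fun y => f y - f (R y)
  let b : Vtx → ℝ := fun y => (((y.2 - x0.2 : ℤ) : ℝ) ^ 2 +
    2 * r * (((y.1 - x0.1 : ℤ) : ℝ) - 1 / 2) - (((y.1 - x0.1 : ℤ) : ℝ) - 1 / 2) ^ 2 + 1 / 4) / r ^ 2
  let g0 : Vtx → ℝ := fun y => 2 * A * b y - d y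
  let g : Vtx → ℝ := fun y => if x0.1 + 1 ≤ y.1 then g0 y else 0
  let S : Finset Vtx := Finset.Icc (x0.1 + 1, x0.2 - r) (x0.1 + r, x0.2 + r)
  have hS : ∀ y, y ∈ S ↔ (x0.1 + 1 ≤ y.1 ∧ y.1 ≤ x0.1 + r) ∧ (x0.2 - r ≤ y.2 ∧ y.2 ≤ x0.2 + r) := by
    intro y
    simp only [S, Finset.mem_Icc, Prod.le_def]; tauto
  have hbL : ∀ y, Lp b y = 0 := by
    intro y
    have hr0 : (r : ℝ) ^ 2 ≠ 0 := by positivity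
    simp only [Lp, nbS, b]
    field_simp
    push_cast
    ring
  have hdL : ∀ y ∈ S, Lp d y = 0 := by
    intro y hy
    rw [hS] at hy
    have h1 := hharm y (by rw [mem_Bx]; omega)
    have h2 := hharm (R y) (by rw [mem_Bx]; simp only [R]; omega)
    have e1 : R (y.1 + 1, y.2) = ((R y).1 - 1, (R y).2) := by
      simp only [R]; ext <;> simp; ring
    have e2 : R (y.1 - 1, y.2) = ((R y).1 + 1, (R y).2) := by
      simp only [R]; ext <;> simp; ring
    have e3 : R (y.1, y.2 + 1) = ((R y).1, (R y).2 + 1) := by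
      simp only [R]
    have e4 : R (y.1, y.2 - 1) = ((R y).1, (R y).2 - 1) := by
      simp only [R]
    simp only [Lp, nbS] at h1 h2
    simp only [Lp, nbS, d]
    rw [e1, e2, e3, e4]
    linarith
  have hg0L : ∀ y ∈ S, Lp g0 y = 0 := by
    intro y hy
    have : Lp g0 y = Lp (fun z => 2 * A * b z) y - Lp d y := Lp_sub _ _ _
    rw [this, Lp_smul, hbL, hdL y hy]; ring
  have hd : ∀ y, x0.1 + 1 ≤ y.1 → y.1 ≤ x0.1 + r + 1 → x0.2 - r - 1 ≤ y.2 → y.2 ≤ x0.2 + r + 1 →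
      d y ≤ 2 * A := by
    intro y h1 h2 h3 h4
    have a1 := hb y (by rw [mem_Bx]; omega)
    have a2 := hb (R y) (by rw [mem_Bx]; simp only [R]; omega)
    rw [abs_le] at a1 a2
    simp only [d]; linarith
  have main := minPrinciple S g ?_ ?_ (x0.1 + 1, x0.2) (by rw [hS]; simp only; omega)
  · simp only [g, le_refl, if_true] at main
    simp only [g0, d, b, R] at main
    have e : ((2 * x0.1 + 1 - (x0.1 + 1), x0.2) : Vtx) = x0 := by ext <;> simp; ring
    rw [e] at main
    push_cast at main
    have e2 : (((x0.2 : ℝ) - x0.2) ^ 2 + 2 * r * ((x0.1 : ℝ) + 1 - x0.1 - 1 / 2)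
      - ((x0.1 : ℝ) + 1 - x0.1 - 1 / 2) ^ 2 + 1 / 4) / (r : ℝ) ^ 2 = 1 / r := by
      field_simp; ring
    rw [e2] at main
    have : 2 * A * (1 / (r : ℝ)) = 2 * A / r := by ring
    linarith
  · intro y hy hneg
    have hyS := (hS y).1 hy
    have hL := hg0L y hy
    have c1 : g y = g0 y := if_pos hyS.1.1
    have c2 : g (y.1 + 1, y.2) = g0 (y.1 + 1, y.2) := if_pos (by simp only; omega)
    have c3 : g (y.1, y.2 + 1) = g0 (y.1, y.2 + 1) := if_pos (by simp only; omega)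
    have c4 : g (y.1, y.2 - 1) = g0 (y.1, y.2 - 1) := if_pos (by simp only; omega)
    simp only [Lp, nbS] at hL ⊢
    rw [c1, c2, c3, c4]
    rw [c1] at hneg
    by_cases hy1 : x0.1 + 2 ≤ y.1
    · have c5 : g (y.1 - 1, y.2) = g0 (y.1 - 1, y.2) := if_pos (by simp only; omega)
      rw [c5]; linarith
    · have c5 : g (y.1 - 1, y.2) = 0 := if_neg (by simp only; omega)
      rw [c5]
      have hy1' : y.1 = x0.1 + 1 := by omega
      have : g0 (y.1 - 1, y.2) + g0 y = 2 * A * (b (y.1 - 1, y.2) + b y) := by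
        simp only [g0, d]
        have e1 : R (y.1 - 1, y.2) = y := by
          simp only [R]; ext <;> simp [hy1']; ring
        have e2 : R y = (y.1 - 1, y.2) := by
          simp only [R]; ext <;> simp [hy1']; ring
        rw [e1, e2]; ring
      have hbb : 0 ≤ b (y.1 - 1, y.2) + b y := by
        simp only [b]
        rw [hy1', ← add_div]
        push_cast
        apply div_nonneg _ (by positivity)
        nlinarith [sq_nonneg ((y.2 : ℝ) - x0.2)]
      have := mul_nonneg (mul_nonneg zero_le_two hA) hbb
      linarith
  · intro y hy z hz hzS
    have hyS := (hS y).1 hy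
    have hb' := AdjV_bound hz
    by_cases hz1 : x0.1 + 1 ≤ z.1
    · have : g z = g0 z := if_pos hz1
      rw [this]
      have h1 := hd z hz1 (by omega) (by omega) (by omega)
      have h2 : 1 ≤ b z := by
        simp only [b]
        rw [le_div_iff₀ (by positivity), one_mul]
        have t1 : (1 : ℝ) ≤ ((z.1 - x0.1 : ℤ) : ℝ) := by exact_mod_cast (by omega : 1 ≤ z.1 - x0.1)
        have t2 : ((z.1 - x0.1 : ℤ) : ℝ) ≤ r + 1 := by
          exact_mod_cast (by omega : z.1 - x0.1 ≤ r + 1)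
        by_cases hz2 : z.1 = x0.1 + r + 1
        · have : ((z.1 - x0.1 : ℤ) : ℝ) = r + 1 := by
            exact_mod_cast (by omega : z.1 - x0.1 = r + 1)
          rw [this]
          nlinarith [sq_nonneg (((z.2 - x0.2 : ℤ) : ℝ))]
        · have hs : (r : ℝ) + 1 ≤ |((z.2 - x0.2 : ℤ) : ℝ)| := by
            rw [hS] at hzS
            have : r + 1 ≤ |z.2 - x0.2| := by
              rw [le_abs]; omega
            exact_mod_cast this
          have hs2 : ((r : ℝ) + 1) ^ 2 ≤ ((z.2 - x0.2 : ℤ) : ℝ) ^ 2 := by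
            rw [← sq_abs (((z.2 - x0.2 : ℤ) : ℝ))]
            exact pow_le_pow_left₀ (by linarith) hs 2
          nlinarith
      simp only [g0]
      nlinarith
    · have : g z = 0 := if_neg hz1
      rw [this]

theorem grad_abs (f : Vtx → ℝ) (x0 : Vtx) (r : ℤ) (hr : 1 ≤ r) (A : ℝ) (hA : 0 ≤ A)
    (hharm : ∀ x ∈ Bx x0 r, Lp f x = 0) (hb : ∀ x ∈ Bx x0 (r + 1), |f x| ≤ A) :
    |f (x0.1 + 1, x0.2) - f x0| ≤ 2 * A / r := by
  rw [abs_le]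
  constructor
  · have := grad_one_side (fun x => -1 * f x) x0 r hr A hA
      (fun x hx => by rw [Lp_smul, hharm x hx]; ring)
      (fun x hx => by simpa using hb x hx)
    linarith
  · exact grad_one_side f x0 r hr A hA hharm hb

theorem Lp_swap (f : Vtx → ℝ) (x : Vtx) : Lp (fun y => f (y.2, y.1)) x = Lp f (x.2, x.1) := by
  unfold Lp nbS; simp only; ring

theorem grad_abs2 (f : Vtx → ℝ) (x0 : Vtx) (r : ℤ) (hr : 1 ≤ r) (A : ℝ) (hA : 0 ≤ A)
    (hharm : ∀ x ∈ Bx x0 r, Lp f x = 0) (hb : ∀ x ∈ Bx x0 (r + 1), |f x| ≤ A) :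
    |f (x0.1, x0.2 + 1) - f x0| ≤ 2 * A / r := by
  have := grad_abs (fun y => f (y.2, y.1)) (x0.2, x0.1) r hr A hA
    (fun x hx => by
      rw [Lp_swap]; apply hharm; rw [mem_Bx] at hx ⊢; simp only at hx ⊢; tauto)
    (fun x hx => by apply hb; rw [mem_Bx] at hx ⊢; simp only at hx ⊢; tauto)
  simpa using this

theorem int_lip (g : ℤ → ℝ) (D : ℝ) (a b : ℤ) (hab : a ≤ b)
    (h : ∀ k, a ≤ k → k < b → |g (k + 1) - g k| ≤ D) : |g b - g a| ≤ D * ((b - a : ℤ) : ℝ) := by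
  induction b, hab using Int.leInduction with
  | base => simp
  | succ n hn ih =>
    have h1 := ih (fun k hk hk' => h k hk (by omega))
    have h2 := h n hn (by omega)
    have : g (n + 1) - g a = (g (n + 1) - g n) + (g n - g a) := by ring
    rw [this]
    refine (abs_add_le _ _).trans ?_
    push_cast at h1 ⊢
    nlinarith

theorem int_lip' (g : ℤ → ℝ) (D : ℝ) (a b s : ℤ) (hD : 0 ≤ D) (hab : |b - a| ≤ s)
    (h : ∀ k, a - s ≤ k → k < a + s → |g (k + 1) - g k| ≤ D) : |g b - g a| ≤ D * s := by
  rw [abs_le] at hab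
  rcases le_total a b with hle | hle
  · refine (int_lip g D a b hle (fun k h1 h2 => h k (by omega) (by omega))).trans ?_
    apply mul_le_mul_of_nonneg_left _ hD
    exact_mod_cast (by omega)
  · rw [abs_sub_comm]
    refine (int_lip g D b a hle (fun k h1 h2 => h k (by omega) (by omega))).trans ?_
    apply mul_le_mul_of_nonneg_left _ hD
    exact_mod_cast (by omega)

/-- Lipschitz estimate for harmonic functions. -/
theorem harm_lip (f : Vtx → ℝ) (v u : Vtx) (r s : ℤ) (hr : 1 ≤ r) (hs : 0 ≤ s) (A : ℝ) (hA : 0 ≤ A)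
    (hharm : ∀ x ∈ Bx v (r + s), Lp f x = 0) (hb : ∀ x ∈ Bx v (r + s + 1), |f x| ≤ A)
    (hu : u ∈ Bx v s) :
    |f u - f v| ≤ 4 * A * s / r := by
  have hrR : (1 : ℝ) ≤ r := by exact_mod_cast hr
  rw [mem_Bx] at hu
  have hD : 0 ≤ 2 * A / r := by positivity
  have h1 := int_lip' (fun k => f (k, v.2)) (2 * A / r) v.1 u.1 s hD (by rw [abs_le]; omega)
    (fun k hk hk' => by
      have := grad_abs f (k, v.2) r hr A hA
        (fun x hx => hharm x (by rw [mem_Bx] at hx ⊢; simp only at hx; omega))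
        (fun x hx => hb x (by rw [mem_Bx] at hx ⊢; simp only at hx; omega))
      simpa using this)
  have h2 := int_lip' (fun k => f (u.1, k)) (2 * A / r) v.2 u.2 s hD (by rw [abs_le]; omega)
    (fun k hk hk' => by
      have := grad_abs2 f (u.1, k) r hr A hA
        (fun x hx => hharm x (by rw [mem_Bx] at hx ⊢; simp only at hx; omega))
        (fun x hx => hb x (by rw [mem_Bx] at hx ⊢; simp only at hx; omega))
      simpa using this)
  have e : f u - f v = (f (u.1, u.2) - f (u.1, v.2)) + (f (u.1, v.2) - f (v.1, v.2)) := by ring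
  rw [e]
  refine (abs_add_le _ _).trans ?_
  have : 4 * A * s / r = 2 * A / r * s + 2 * A / r * s := by ring
  rw [this]
  exact add_le_add h2 h1

/-- Boundary barrier on the left side. -/
theorem bdry_barrier (f : Vtx → ℝ) (T : Finset Vtx) (v : Vtx) (a r : ℤ) (hr : 1 ≤ r) (A : ℝ)
    (hA : 0 ≤ A)
    (hharm : ∀ x ∈ T, Lp f x = 0)
    (hle : ∀ x, f x ≤ A)
    (hT : ∀ x ∈ T, a < x.1)
    (hz : ∀ x, a ≤ x.1 → x.1 ≤ a + r → v.2 - r ≤ x.2 → x.2 ≤ v.2 + r → x ∉ T → f x ≤ 0)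
    (hv1 : a ≤ v.1) : f v ≤ 2 * A * ((v.1 - a : ℤ) : ℝ) / r := by
  have hrR : (1 : ℝ) ≤ r := by exact_mod_cast hr
  have hv1R : (0 : ℝ) ≤ ((v.1 - a : ℤ) : ℝ) := by exact_mod_cast (by omega)
  by_cases hv2 : a + r ≤ v.1
  · refine (hle v).trans ?_
    rw [le_div_iff₀ (by positivity)]
    have : (r : ℝ) ≤ ((v.1 - a : ℤ) : ℝ) := by exact_mod_cast (by omega)
    nlinarith
  push Not at hv2
  let b : Vtx → ℝ := fun y => (((y.2 - v.2 : ℤ) : ℝ) ^ 2 +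
    2 * r * (((y.1 - a : ℤ) : ℝ)) - (((y.1 - a : ℤ) : ℝ)) ^ 2) / r ^ 2
  have hbL : ∀ y, Lp b y = 0 := by
    intro y
    have hr0 : (r : ℝ) ^ 2 ≠ 0 := by positivity
    simp only [Lp, nbS, b]
    field_simp
    push_cast
    ring
  have hbn : ∀ y : Vtx, a ≤ y.1 → y.1 ≤ a + r → 0 ≤ b y := by
    intro y h1 h2
    simp only [b]
    apply div_nonneg _ (by positivity)
    have t1 : (0 : ℝ) ≤ ((y.1 - a : ℤ) : ℝ) := by exact_mod_cast (by omega : 0 ≤ y.1 - a)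
    have t2 : ((y.1 - a : ℤ) : ℝ) ≤ r := by exact_mod_cast (by omega : y.1 - a ≤ r)
    nlinarith [sq_nonneg (((y.2 - v.2 : ℤ) : ℝ))]
  by_cases hvT : v ∈ T
  swap
  · refine (hz v hv1 (by omega) (by omega) (by omega) hvT).trans ?_
    positivity
  let S := T.filter fun y => y.1 < a + r ∧ v.2 - r < y.2 ∧ y.2 < v.2 + r
  have key := compareLe S f (fun y => A * b y)
    (fun x hx => by
      rw [Lp_smul, hbL, hharm x (Finset.mem_filter.1 hx).1]; simp)
    (fun x hx y hxy hy => by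
      have hx' := Finset.mem_filter.1 hx
      have hxT := hT x hx'.1
      have hb' := AdjV_bound hxy
      have hyn := hbn y (by omega) (by omega)
      by_cases hyT : y ∈ T
      · refine (hle y).trans ?_
        have h1 : 1 ≤ b y := by
          simp only [b]
          rw [le_div_iff₀ (by positivity), one_mul]
          have t1 : (0 : ℝ) ≤ ((y.1 - a : ℤ) : ℝ) := by exact_mod_cast (by omega : 0 ≤ y.1 - a)
          have t2 : ((y.1 - a : ℤ) : ℝ) ≤ r := by exact_mod_cast (by omega : y.1 - a ≤ r)
          have hy' : ¬ (y.1 < a + r ∧ v.2 - r < y.2 ∧ y.2 < v.2 + r) := fun h =>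
            hy (Finset.mem_filter.2 ⟨hyT, h⟩)
          by_cases hy1 : y.1 < a + r
          · have : r ≤ |y.2 - v.2| := by rw [le_abs]; omega
            have hs : (r : ℝ) ≤ |((y.2 - v.2 : ℤ) : ℝ)| := by exact_mod_cast this
            have hs2 : (r : ℝ) ^ 2 ≤ ((y.2 - v.2 : ℤ) : ℝ) ^ 2 := by
              rw [← sq_abs (((y.2 - v.2 : ℤ) : ℝ))]
              exact pow_le_pow_left₀ (by linarith) hs 2
            nlinarith
          · have : ((y.1 - a : ℤ) : ℝ) = r := by exact_mod_cast (by omega : y.1 - a = r)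
            rw [this]
            nlinarith [sq_nonneg (((y.2 - v.2 : ℤ) : ℝ))]
        nlinarith
      · refine (hz y (by omega) (by omega) (by omega) (by omega) hyT).trans ?_
        positivity)
    v (Finset.mem_filter.2 ⟨hvT, by omega⟩)
  refine key.trans ?_
  have : 2 * A * ((v.1 - a : ℤ) : ℝ) / r - A * b v = A * (((v.1 - a : ℤ) : ℝ) ^ 2) / r ^ 2 := by
    simp only [b, sub_self, Int.cast_zero]
    field_simp; ring
  have h2 : 0 ≤ A * (((v.1 - a : ℤ) : ℝ) ^ 2) / r ^ 2 := by positivity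
  linarith

theorem near_left (N : ℤ) (f : Vtx → ℝ) (c u : Vtx) (k s D : ℤ) (A : ℝ) (hA : 0 ≤ A)
    (hharm : ∀ x, 0 < x.1 → x.1 < N → 0 < x.2 → x.2 < N → x ∈ Bx c k → Lp f x = 0)
    (hzero : ∀ x, ¬ (0 < x.1 ∧ x.1 < N ∧ 0 < x.2 ∧ x.2 < N) → f x = 0)
    (hb : ∀ x, |f x| ≤ A) (hs : 0 ≤ s) (hsk : s < k) (hu : u ∈ Bx c s)
    (hc0 : 0 ≤ c.1) (hck : c.1 ≤ k) (hu0 : 0 ≤ u.1) (huD : u.1 ≤ D) :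
    |f u| ≤ 2 * A * D / ((k - s : ℤ) : ℝ) := by
  let T : Finset Vtx := (Bx c k).filter fun x => 0 < x.1 ∧ x.1 < N ∧ 0 < x.2 ∧ x.2 < N
  rw [mem_Bx] at hu
  have hks : (1 : ℝ) ≤ ((k - s : ℤ) : ℝ) := by exact_mod_cast (by omega)
  have gen : ∀ g : Vtx → ℝ, (∀ x ∈ T, Lp g x = 0) → (∀ x, g x ≤ A) →
      (∀ x, ¬ (0 < x.1 ∧ x.1 < N ∧ 0 < x.2 ∧ x.2 < N) → g x = 0) →
      g u ≤ 2 * A * D / ((k - s : ℤ) : ℝ) := by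
    intro g h1 h2 h3
    have := bdry_barrier g T u 0 (k - s) (by omega) A hA h1 h2
      (fun x hx => (Finset.mem_filter.1 hx).2.1)
      (fun x a1 a2 a3 a4 hxT => by
        apply le_of_eq
        apply h3
        intro h
        apply hxT
        refine Finset.mem_filter.2 ⟨?_, h⟩
        rw [mem_Bx]
        omega)
      hu0
    refine this.trans ?_
    apply div_le_div_of_nonneg_right _ (by linarith)
    apply mul_le_mul_of_nonneg_left _ (by positivity)
    exact_mod_cast (by omega)
  have hT : ∀ x ∈ T, Lp f x = 0 := by
    intro x hx
    have := Finset.mem_filter.1 hx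
    exact hharm x this.2.1 this.2.2.1 this.2.2.2.1 this.2.2.2.2 this.1
  rw [abs_le]
  constructor
  · have := gen (fun x => -1 * f x) (fun x hx => by rw [Lp_smul, hT x hx]; ring)
      (fun x => by have := (abs_le.1 (hb x)).1; linarith) (fun x hx => by rw [hzero x hx]; ring)
    linarith
  · exact gen f hT (fun x => (abs_le.1 (hb x)).2) hzero

theorem Lp_refl (N : ℤ) (f : Vtx → ℝ) (x : Vtx) :
    Lp (fun y => f (N - y.1, y.2)) x = Lp f (N - x.1, x.2) := by
  unfold Lp nbS
  simp only
  rw [show N - (x.1 + 1) = N - x.1 - 1 by ring, show N - (x.1 - 1) = N - x.1 + 1 by ring]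
  ring

theorem near_right (N : ℤ) (f : Vtx → ℝ) (c u : Vtx) (k s D : ℤ) (A : ℝ) (hA : 0 ≤ A)
    (hharm : ∀ x, 0 < x.1 → x.1 < N → 0 < x.2 → x.2 < N → x ∈ Bx c k → Lp f x = 0)
    (hzero : ∀ x, ¬ (0 < x.1 ∧ x.1 < N ∧ 0 < x.2 ∧ x.2 < N) → f x = 0)
    (hb : ∀ x, |f x| ≤ A) (hs : 0 ≤ s) (hsk : s < k) (hu : u ∈ Bx c s)
    (hc0 : 0 ≤ N - c.1) (hck : N - c.1 ≤ k) (hu0 : 0 ≤ N - u.1) (huD : N - u.1 ≤ D) :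
    |f u| ≤ 2 * A * D / ((k - s : ℤ) : ℝ) := by
  have := near_left N (fun y => f (N - y.1, y.2)) (N - c.1, c.2) (N - u.1, u.2) k s D A hA
    (fun x h1 h2 h3 h4 h5 => by
      rw [Lp_refl]
      apply hharm <;> simp only [mem_Bx] at * <;> omega)
    (fun x hx => by apply hzero; simp only; omega)
    (fun x => hb _) hs hsk (by simp only [mem_Bx] at *; omega) hc0 hck hu0 huD
  simpa using this

/-- Regularity of harmonic functions with zero boundary values on the big box. -/
theorem reg_lemma (N : ℤ) (f : Vtx → ℝ) (c u : Vtx) (k r s : ℤ) (A : ℝ) (hA : 0 ≤ A)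
    (hharm : ∀ x, 0 < x.1 → x.1 < N → 0 < x.2 → x.2 < N → x ∈ Bx c k → Lp f x = 0)
    (hzero : ∀ x, ¬ (0 < x.1 ∧ x.1 < N ∧ 0 < x.2 ∧ x.2 < N) → f x = 0)
    (hb : ∀ x, |f x| ≤ A) (hs : 0 ≤ s) (hr : 1 ≤ r) (hsk : r + 2 * s ≤ k) (hu : u ∈ Bx c s)
    (hc : (0 ≤ c.1 ∧ c.1 ≤ N) ∧ (0 ≤ c.2 ∧ c.2 ≤ N))
    (hu' : (0 ≤ u.1 ∧ u.1 ≤ N) ∧ (0 ≤ u.2 ∧ u.2 ≤ N)) :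
    |f u - f c| ≤ 4 * A * s / r + 4 * A * ((r + 2 * s : ℤ) : ℝ) / ((k - s : ℤ) : ℝ) := by
  have hrR : (1 : ℝ) ≤ r := by exact_mod_cast hr
  have hsR : (0 : ℝ) ≤ s := by exact_mod_cast hs
  have hks : (1 : ℝ) ≤ ((k - s : ℤ) : ℝ) := by exact_mod_cast (by omega)
  have hrs : (0 : ℝ) ≤ ((r + 2 * s : ℤ) : ℝ) := by exact_mod_cast (by omega)
  have p1 : 0 ≤ 4 * A * s / r := by positivity
  have p2 : 0 ≤ 4 * A * ((r + 2 * s : ℤ) : ℝ) / ((k - s : ℤ) : ℝ) := by positivity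
  by_cases hint : (0 < c.1 - (r + s) ∧ c.1 + (r + s) < N) ∧ (0 < c.2 - (r + s) ∧ c.2 + (r + s) < N)
  · have := harm_lip f c u r s hr hs A hA
      (fun x hx => by
        have hx' := mem_Bx.1 hx
        exact hharm x (by omega) (by omega) (by omega) (by omega) (by rw [mem_Bx]; omega))
      (fun x _ => hb x) hu
    linarith
  · have hcs : c ∈ Bx c s := by rw [mem_Bx]; omega
    have hu2 := mem_Bx.1 hu
    suffices h : |f u| ≤ 2 * A * ((r + 2 * s : ℤ) : ℝ) / ((k - s : ℤ) : ℝ) ∧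
        |f c| ≤ 2 * A * ((r + 2 * s : ℤ) : ℝ) / ((k - s : ℤ) : ℝ) by
      have h1 := abs_sub (f u) (f c)
      have e : 4 * A * ((r + 2 * s : ℤ) : ℝ) / ((k - s : ℤ) : ℝ)
        = 2 * A * ((r + 2 * s : ℤ) : ℝ) / ((k - s : ℤ) : ℝ)
          + 2 * A * ((r + 2 * s : ℤ) : ℝ) / ((k - s : ℤ) : ℝ) := by ring
      linarith [h.1, h.2]
    have hswh : ∀ x, 0 < x.1 → x.1 < N → 0 < x.2 → x.2 < N → x ∈ Bx (c.2, c.1) k →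
        Lp (fun y => f (y.2, y.1)) x = 0 := by
      intro x h1 h2 h3 h4 h5
      rw [Lp_swap]
      apply hharm <;> simp only [mem_Bx] at * <;> omega
    have hswz : ∀ x : Vtx, ¬ (0 < x.1 ∧ x.1 < N ∧ 0 < x.2 ∧ x.2 < N) → f (x.2, x.1) = 0 := by
      intro x hx
      apply hzero; simp only; omega
    have hswu : (u.2, u.1) ∈ Bx (c.2, c.1) s := by simp only [mem_Bx]; omega
    have hswc : (c.2, c.1) ∈ Bx (c.2, c.1) s := by simp only [mem_Bx]; omega
    by_cases h1 : c.1 ≤ r + s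
    · exact ⟨near_left N f c u k s (r + 2 * s) A hA hharm hzero hb hs (by omega) hu (by omega)
        (by omega) (by omega) (by omega), near_left N f c c k s (r + 2 * s) A hA hharm hzero hb hs
        (by omega) hcs (by omega) (by omega) (by omega) (by omega)⟩
    by_cases h2 : N - c.1 ≤ r + s
    · exact ⟨near_right N f c u k s (r + 2 * s) A hA hharm hzero hb hs (by omega) hu (by omega)
        (by omega) (by omega) (by omega), near_right N f c c k s (r + 2 * s) A hA hharm hzero hb hs
        (by omega) hcs (by omega) (by omega) (by omega) (by omega)⟩
    by_cases h3 : c.2 ≤ r + s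
    · exact ⟨near_left N (fun y => f (y.2, y.1)) (c.2, c.1) (u.2, u.1) k s (r + 2 * s) A hA hswh hswz
        (fun x => hb _) hs (by omega) hswu (by simp only; omega)
        (by simp only; omega) (by simp only; omega) (by simp only; omega),
        near_left N (fun y => f (y.2, y.1)) (c.2, c.1) (c.2, c.1) k s (r + 2 * s) A hA hswh hswz
        (fun x => hb _) hs (by omega) hswc (by simp only; omega)
        (by simp only; omega) (by simp only; omega) (by simp only; omega)⟩
    · exact ⟨near_right N (fun y => f (y.2, y.1)) (c.2, c.1) (u.2, u.1) k s (r + 2 * s) A hA hswh hswz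
        (fun x => hb _) hs (by omega) hswu (by simp only; omega)
        (by simp only; omega) (by simp only; omega) (by simp only; omega),
        near_right N (fun y => f (y.2, y.1)) (c.2, c.1) (c.2, c.1) k s (r + 2 * s) A hA hswh hswz
        (fun x => hb _) hs (by omega) hswc (by simp only; omega)
        (by simp only; omega) (by simp only; omega) (by simp only; omega)⟩

end GGrad

noncomputable section GGreen

/-- squared radius plus one half -/
def q2 (v x : Vtx) : ℝ := ((x.1 - v.1 : ℤ) : ℝ) ^ 2 + ((x.2 - v.2 : ℤ) : ℝ) ^ 2 + 1 / 2

theorem q2_pos (v x : Vtx) : 0 < q2 v x := by unfold q2; positivity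

/-- superharmonic comparison function -/
def hl (v x : Vtx) : ℝ := -(1 / 2) * Real.log (q2 v x)

theorem Lp_hl (v x : Vtx) : Lp (hl v) x = (1 / 2) * (Real.log
    ((q2 v (x.1 + 1, x.2) * q2 v (x.1 - 1, x.2)) * (q2 v (x.1, x.2 + 1) * q2 v (x.1, x.2 - 1)))
    - Real.log (q2 v x ^ 4)) := by
  have h1 := (q2_pos v (x.1 + 1, x.2)).ne'
  have h2 := (q2_pos v (x.1 - 1, x.2)).ne'
  have h3 := (q2_pos v (x.1, x.2 + 1)).ne'
  have h4 := (q2_pos v (x.1, x.2 - 1)).ne'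
  rw [Real.log_mul (mul_ne_zero h1 h2) (mul_ne_zero h3 h4), Real.log_mul h1 h2, Real.log_mul h3 h4,
    Real.log_pow]
  unfold Lp nbS hl
  push_cast
  ring

theorem Lp_hl_nonneg (v x : Vtx) : 0 ≤ Lp (hl v) x := by
  rw [Lp_hl]
  have : Real.log (q2 v x ^ 4) ≤ Real.log
    ((q2 v (x.1 + 1, x.2) * q2 v (x.1 - 1, x.2)) * (q2 v (x.1, x.2 + 1) * q2 v (x.1, x.2 - 1))) := by
    apply Real.log_le_log (pow_pos (q2_pos v x) 4)
    unfold q2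
    push_cast
    have e1 : (x.1 : ℝ) + 1 - v.1 = (x.1 - v.1) + 1 := by ring
    have e2 : (x.1 : ℝ) - 1 - v.1 = (x.1 - v.1) - 1 := by ring
    have e3 : (x.2 : ℝ) + 1 - v.2 = (x.2 - v.2) + 1 := by ring
    have e4 : (x.2 : ℝ) - 1 - v.2 = (x.2 - v.2) - 1 := by ring
    rw [e1, e2, e3, e4]
    generalize ((x.1 : ℝ) - v.1) = a
    generalize ((x.2 : ℝ) - v.2) = b
    nlinarith [sq_nonneg (a * b), sq_nonneg a, sq_nonneg b]
  linarith

theorem Lp_hl_center (v : Vtx) : 2 ≤ Lp (hl v) v := by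
  rw [Lp_hl]
  have e : ((q2 v (v.1 + 1, v.2) * q2 v (v.1 - 1, v.2)) * (q2 v (v.1, v.2 + 1) * q2 v (v.1, v.2 - 1)))
     = (3 / 2) ^ 4 := by
    unfold q2; push_cast; ring
  have e2 : q2 v v = 1 / 2 := by unfold q2; push_cast; ring
  rw [e, e2, ← Real.log_div (by norm_num) (by norm_num), show ((3 / 2 : ℝ) ^ 4 / (1 / 2) ^ 4) = 3 ^ 4 by norm_num,
    Real.log_pow]
  have : 1 ≤ Real.log 3 := by
    rw [Real.le_log_iff_exp_le (by norm_num)]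
    exact Real.exp_one_lt_d9.le.trans (by norm_num)
  push_cast; linarith

theorem q2_le {v x : Vtx} {K : ℤ} (hK : 1 ≤ K) (h : x ∈ Bx v K) : q2 v x ≤ (5 / 2) * (K : ℝ) ^ 2 := by
  rw [mem_Bx] at h
  have h1 : ((x.1 - v.1 : ℤ) : ℝ) ^ 2 ≤ (K : ℝ) ^ 2 := by
    apply sq_le_sq'
    · exact_mod_cast (by omega)
    · exact_mod_cast (by omega)
  have h2 : ((x.2 - v.2 : ℤ) : ℝ) ^ 2 ≤ (K : ℝ) ^ 2 := by
    apply sq_le_sq'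
    · exact_mod_cast (by omega)
    · exact_mod_cast (by omega)
  have hK' : (1 : ℝ) ≤ K := by exact_mod_cast hK
  unfold q2
  nlinarith

theorem le_q2 {v x : Vtx} {K : ℤ} (hK : 1 ≤ K) (h : x ∉ Bx v K) : (K : ℝ) ^ 2 ≤ q2 v x := by
  rw [mem_Bx] at h
  have hK' : (1 : ℝ) ≤ K := by exact_mod_cast hK
  have : K ≤ |x.1 - v.1| ∨ K ≤ |x.2 - v.2| := by
    by_contra hc
    push Not at hc
    rw [abs_lt, abs_lt] at hc
    omega
  unfold q2
  rcases this with h | h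
  · have : (K : ℝ) ^ 2 ≤ ((x.1 - v.1 : ℤ) : ℝ) ^ 2 := by
      rw [sq_le_sq, abs_of_pos (by linarith)]; exact_mod_cast h
    nlinarith [sq_nonneg ((x.2 - v.2 : ℤ) : ℝ)]
  · have : (K : ℝ) ^ 2 ≤ ((x.2 - v.2 : ℤ) : ℝ) ^ 2 := by
      rw [sq_le_sq, abs_of_pos (by linarith)]; exact_mod_cast h
    nlinarith [sq_nonneg ((x.1 - v.1 : ℤ) : ℝ)]

theorem hl_ge {v x : Vtx} {K : ℤ} (hK : 1 ≤ K) (h : x ∈ Bx v K) :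
    -(1 / 2) * Real.log ((5 / 2) * (K : ℝ) ^ 2) ≤ hl v x := by
  have := Real.log_le_log (q2_pos v x) (q2_le hK h)
  unfold hl; linarith

theorem hl_le {v x : Vtx} {K : ℤ} (hK : 1 ≤ K) (h : x ∉ Bx v K) :
    hl v x ≤ - Real.log K := by
  have hK' : (1 : ℝ) ≤ K := by exact_mod_cast hK
  have := Real.log_le_log (by positivity) (le_q2 hK h)
  rw [Real.log_pow] at this
  push_cast at this
  unfold hl; linarith

theorem hl_le' (v x : Vtx) : hl v x ≤ 1 / 2 := by
  have h1 : (1 / 2 : ℝ) ≤ q2 v x := by unfold q2; nlinarith [sq_nonneg ((x.1 - v.1 : ℤ) : ℝ), sq_nonneg ((x.2 - v.2 : ℤ) : ℝ)]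
  have := Real.log_le_log (by norm_num) h1
  have h2 : Real.log (1 / 2) = - Real.log 2 := by rw [one_div, Real.log_inv]
  have h3 := Real.log_two_lt_d9
  unfold hl; linarith

theorem log_five_halves_sq {K : ℝ} (hK : 1 ≤ K) : (1 / 2) * Real.log ((5 / 2) * K ^ 2) ≤ 1 / 2 + Real.log K := by
  rw [Real.log_mul (by norm_num) (by positivity), Real.log_pow]
  have : Real.log (5 / 2) ≤ 1 := by
    rw [Real.log_le_iff_le_exp (by norm_num)]
    exact le_trans (by norm_num) Real.exp_one_gt_d9.le
  push_cast; linarith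

theorem GS_crude (S : Finset Vtx) (v : Vtx) (K : ℤ) (hK : 1 ≤ K) (hS : S ⊆ Bx v K) (x y : Vtx) :
    GS S x y ≤ 12 + 4 * Real.log K := by
  have hK' : (1 : ℝ) ≤ K := by exact_mod_cast hK
  have hlog : 0 ≤ Real.log K := Real.log_nonneg hK'
  by_cases hx : x ∈ S
  swap
  · rw [GS_off y hx]; positivity
  by_cases hy : y ∈ S
  swap
  · rw [GS_off_right x hy]; positivity
  have hpi := Real.pi_pos
  have key := compareLe S (fun z => GS S z y)
    (fun z => Real.pi * (hl y z - -(1 / 2) * Real.log ((5 / 2) * ((3 * K : ℤ) : ℝ) ^ 2)))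
    (fun z hz => by
      rw [GS_on y hz, Lp_smul, Lp_sub, Lp_const, sub_zero]
      split_ifs with h
      · subst h; nlinarith [Lp_hl_center z]
      · exact mul_nonneg hpi.le (Lp_hl_nonneg _ _))
    (fun z hz w hw hwS => by
      rw [GS_off y hwS]
      apply mul_nonneg hpi.le
      have : w ∈ Bx y (3 * K) := by
        have h1 := mem_Bx.1 (hS hz)
        have h2 := mem_Bx.1 (hS hy)
        have h3 := AdjV_bound hw
        rw [mem_Bx]; omega
      have := hl_ge (by omega) this
      linarith) x hx
  refine key.trans ?_
  have h1 := log_five_halves_sq (K := ((3 * K : ℤ) : ℝ)) (by push_cast; linarith)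
  have h2 : Real.log ((3 * K : ℤ) : ℝ) = Real.log 3 + Real.log K := by
    push_cast; rw [Real.log_mul (by norm_num) (by positivity)]
  have h4 : Real.log 3 ≤ 2 := by
    have := Real.log_le_sub_one_of_pos (show (0 : ℝ) < 3 by norm_num); linarith
  have h3 := hl_le' y x
  have h5 : hl y x - -(1 / 2) * Real.log ((5 / 2) * ((3 * K : ℤ) : ℝ) ^ 2) ≤ 3 + Real.log K := by linarith
  have h6 := Real.pi_lt_four
  have h7 : 0 ≤ 3 + Real.log K := by linarith
  nlinarith

theorem tele1 (g : ℤ → ℝ) (a : ℤ) (n : ℕ) :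
    ∑ x ∈ Finset.Icc a (a + n), (2 * g x - g (x + 1) - g (x - 1)) =
      g (a + n) - g (a + n + 1) + (g a - g (a - 1)) := by
  induction n with
  | zero => simp; ring
  | succ n ih =>
    have : Finset.Icc a (a + (n + 1 : ℕ)) = insert (a + n + 1) (Finset.Icc a (a + n)) := by
      ext x; simp only [Finset.mem_Icc, Finset.mem_insert]; push_cast; omega
    rw [this, Finset.sum_insert (by simp), ih]
    push_cast
    rw [show a + (n : ℤ) + 1 - 1 = a + n by ring, show a + ((n : ℤ) + 1) = a + n + 1 by ring]
    ring

theorem even_sum (e : ℤ → ℝ) (he : ∀ k, e (-k) = e k) (n : ℕ) :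
    ∑ k ∈ Finset.Icc (-(n : ℤ)) n, e k = e 0 + 2 * ∑ k ∈ Finset.range n, e (k + 1) := by
  induction n with
  | zero => simp
  | succ n ih =>
    have : Finset.Icc (-((n + 1 : ℕ) : ℤ)) (n + 1 : ℕ) =
        insert ((n : ℤ) + 1) (insert (-((n : ℤ) + 1)) (Finset.Icc (-(n : ℤ)) n)) := by
      ext x; simp only [Finset.mem_Icc, Finset.mem_insert]; push_cast; omega
    rw [this, Finset.sum_insert (by simp only [Finset.mem_insert, Finset.mem_Icc]; omega),
      Finset.sum_insert (by simp only [Finset.mem_Icc]; omega), ih, Finset.sum_range_succ, he]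
    ring

theorem mass_eq (r : ℕ) :
    ∑ x ∈ Bx 0 r, Lp (hl 0) x = 4 * ∑ k ∈ Finset.Icc (-(r : ℤ)) r, (hl 0 ((r : ℤ), k) - hl 0 ((r : ℤ) + 1, k)) := by
  have hB : Bx 0 r = Finset.Icc (-(r : ℤ)) r ×ˢ Finset.Icc (-(r : ℤ)) r := by
    ext x; rw [mem_Bx]; simp [Finset.mem_product]
  have e1 : ∀ x : Vtx, Lp (hl 0) x = (2 * hl 0 (x.1, x.2) - hl 0 (x.1 + 1, x.2) - hl 0 (x.1 - 1, x.2))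
      + (2 * hl 0 (x.1, x.2) - hl 0 (x.1, x.2 + 1) - hl 0 (x.1, x.2 - 1)) := by
    intro x; unfold Lp nbS; ring
  have hsw : ∀ a b : ℤ, hl 0 (a, b) = hl 0 (b, a) := by
    intro a b; unfold hl q2; simp only; rw [add_comm (((a - (0 : Vtx).1 : ℤ) : ℝ) ^ 2)]; rfl
  have hng : ∀ a b : ℤ, hl 0 (-a, b) = hl 0 (a, b) := by
    intro a b; unfold hl q2; simp
  have t1 : ∀ g : ℤ → ℝ, ∑ x ∈ Finset.Icc (-(r : ℤ)) r, (2 * g x - g (x + 1) - g (x - 1)) =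
      g r - g (r + 1) + (g (-r) - g (-(r + 1))) := by
    intro g
    have := tele1 g (-(r : ℤ)) (2 * r)
    rw [show (-(r : ℤ) + (2 * r : ℕ)) = r by push_cast; ring,
      show (-(r : ℤ) - 1) = -((r : ℤ) + 1) by ring] at this
    exact this
  rw [Finset.sum_congr rfl (fun x _ => e1 x), Finset.sum_add_distrib, hB]
  have s1 : ∑ x ∈ Finset.Icc (-(r : ℤ)) r ×ˢ Finset.Icc (-(r : ℤ)) r,
      (2 * hl 0 (x.1, x.2) - hl 0 (x.1 + 1, x.2) - hl 0 (x.1 - 1, x.2)) =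
      2 * ∑ k ∈ Finset.Icc (-(r : ℤ)) r, (hl 0 ((r : ℤ), k) - hl 0 ((r : ℤ) + 1, k)) := by
    rw [Finset.sum_product_right, Finset.mul_sum]
    apply Finset.sum_congr rfl
    intro k _
    rw [t1 (fun x => hl 0 (x, k))]
    simp only [hng]; ring
  have s2 : ∑ x ∈ Finset.Icc (-(r : ℤ)) r ×ˢ Finset.Icc (-(r : ℤ)) r,
      (2 * hl 0 (x.1, x.2) - hl 0 (x.1, x.2 + 1) - hl 0 (x.1, x.2 - 1)) =
      2 * ∑ k ∈ Finset.Icc (-(r : ℤ)) r, (hl 0 ((r : ℤ), k) - hl 0 ((r : ℤ) + 1, k)) := by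
    rw [Finset.sum_product, Finset.mul_sum]
    apply Finset.sum_congr rfl
    intro k _
    rw [t1 (fun x => hl 0 (k, x))]
    simp only [fun a => hsw k a, hng]; ring
  rw [s1, s2]; ring

theorem arctan_step (k R : ℝ) (hk : 0 ≤ k) (hR : 0 < R) :
    Real.arctan ((k + 1) / R) - Real.arctan (k / R) ≤ R / (R ^ 2 + k ^ 2) := by
  have h := Convex.image_sub_le_mul_sub_of_deriv_le (D := Set.Ici (k / R)) (convex_Ici _) (f := Real.arctan)
    Real.continuous_arctan.continuousOn (Real.differentiable_arctan.differentiableOn)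
    (C := 1 / (1 + (k / R) ^ 2)) (by
      intro x hx
      rw [interior_Ici, Set.mem_Ioi] at hx
      rw [Real.deriv_arctan]
      have : 0 ≤ k / R := by positivity
      apply one_div_le_one_div_of_le (by positivity)
      nlinarith) (k / R) (by simp) ((k + 1) / R) (by
        rw [Set.mem_Ici]; gcongr; linarith) (by gcongr; linarith)
  refine h.trans (le_of_eq ?_)
  field_simp
  ring

theorem flux_ge (r k : ℕ) :
    ((r : ℝ) + 1 / 2) / (r + 2) * (Real.arctan (((k : ℝ) + 1) / (r + 2)) - Real.arctan ((k : ℝ) / (r + 2)))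
      ≤ hl 0 ((r : ℤ), (k : ℤ)) - hl 0 ((r : ℤ) + 1, (k : ℤ)) := by
  have hr0 : (0 : ℝ) ≤ r := Nat.cast_nonneg r
  have hk0 : (0 : ℝ) ≤ k := Nat.cast_nonneg k
  have h1 := arctan_step k (r + 2) hk0 (by positivity)
  have h2 : ((r : ℝ) + 1 / 2) / ((r + 2) ^ 2 + k ^ 2) ≤ hl 0 ((r : ℤ), (k : ℤ)) - hl 0 ((r : ℤ) + 1, (k : ℤ)) := by
    unfold hl
    have eA : q2 0 ((r : ℤ) + 1, (k : ℤ)) = (r + 1) ^ 2 + k ^ 2 + 1 / 2 := by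
      unfold q2; push_cast; simp
    have eB : q2 0 ((r : ℤ), (k : ℤ)) = r ^ 2 + k ^ 2 + 1 / 2 := by
      unfold q2; push_cast; simp
    rw [eA, eB]
    set A : ℝ := (r + 1) ^ 2 + k ^ 2 + 1 / 2 with hA
    set B : ℝ := r ^ 2 + k ^ 2 + 1 / 2 with hB
    have hAp : 0 < A := by positivity
    have hBp : 0 < B := by positivity
    have h3 : Real.log (B / A) ≤ B / A - 1 := Real.log_le_sub_one_of_pos (by positivity)
    rw [Real.log_div hBp.ne' hAp.ne'] at h3
    have h4 : ((r : ℝ) + 1 / 2) / ((r + 2) ^ 2 + k ^ 2) ≤ (r + 1 / 2) / A := by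
      apply div_le_div_of_nonneg_left (by positivity) hAp
      rw [hA]; nlinarith
    have h5 : (r + 1 / 2) / A = (1 - B / A) / 2 := by
      field_simp
      rw [hA, hB]; ring
    linarith
  refine le_trans ?_ h2
  calc _ ≤ ((r : ℝ) + 1 / 2) / (r + 2) * ((r + 2) / ((r + 2) ^ 2 + k ^ 2)) := by
        apply mul_le_mul_of_nonneg_left h1 (by positivity)
    _ = _ := by field_simp

theorem mass_ge (r : ℕ) : 4 * (((r : ℝ) + 1 / 2) / (r + 2) *
      (2 * Real.arctan (((r : ℝ) + 1) / (r + 2)) - Real.arctan (1 / ((r : ℝ) + 2)))) ≤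
      ∑ x ∈ Bx 0 r, Lp (hl 0) x := by
  rw [mass_eq, even_sum]
  swap
  · intro k; unfold hl q2; simp
  have h0 := flux_ge r 0
  have hs : ∑ k ∈ Finset.range r, (((r : ℝ) + 1 / 2) / (r + 2) * (Real.arctan ((((k + 1 : ℕ) : ℝ) + 1) / (r + 2)) - Real.arctan (((k + 1 : ℕ) : ℝ) / (r + 2))))
     ≤ ∑ k ∈ Finset.range r, (hl 0 ((r : ℤ), (k : ℤ) + 1) - hl 0 ((r : ℤ) + 1, (k : ℤ) + 1)) := by
    apply Finset.sum_le_sum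
    intro k _
    exact_mod_cast flux_ge r (k + 1)
  rw [← Finset.mul_sum] at hs
  have ht := Finset.sum_range_sub (fun k : ℕ => Real.arctan (((k : ℝ) + 1) / (r + 2))) r
  push_cast at hs ht h0
  simp only [zero_div, Real.arctan_zero, zero_add, sub_zero] at h0 ht
  rw [ht] at hs
  linarith

theorem mass_large (ε : ℝ) (hε : 0 < ε) : ∃ r : ℕ, 1 ≤ r ∧ 2 * Real.pi * (1 - ε) ≤ ∑ x ∈ Bx 0 r, Lp (hl 0) x := by
  have ht : Tendsto (fun r : ℕ => (r : ℝ)) atTop atTop := tendsto_natCast_atTop_atTop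
  have h0 : Tendsto (fun r : ℕ => 1 / ((r : ℝ) + 2)) atTop (nhds 0) := by
    apply Tendsto.div_atTop tendsto_const_nhds
    exact tendsto_atTop_add_const_right _ _ ht
  have e1 : Tendsto (fun r : ℕ => ((r : ℝ) + 1 / 2) / (r + 2)) atTop (nhds 1) := by
    have : (fun r : ℕ => ((r : ℝ) + 1 / 2) / (r + 2)) = fun r : ℕ => 1 - (3 / 2) * (1 / ((r : ℝ) + 2)) := by
      funext r
      have : (r : ℝ) + 2 ≠ 0 := by positivity
      field_simp; ring
    rw [this]
    simpa using tendsto_const_nhds.sub (h0.const_mul (3 / 2))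
  have e2 : Tendsto (fun r : ℕ => ((r : ℝ) + 1) / (r + 2)) atTop (nhds 1) := by
    have : (fun r : ℕ => ((r : ℝ) + 1) / (r + 2)) = fun r : ℕ => 1 - (1 / ((r : ℝ) + 2)) := by
      funext r
      have : (r : ℝ) + 2 ≠ 0 := by positivity
      field_simp; ring
    rw [this]
    simpa using tendsto_const_nhds.sub h0
  have e3 := (Real.continuous_arctan.tendsto 1).comp e2
  have e4 := (Real.continuous_arctan.tendsto 0).comp h0
  have lim := ((e1.mul ((e3.const_mul 2).sub e4)).const_mul 4)
  rw [Real.arctan_one, Real.arctan_zero] at lim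
  have hlt : 2 * Real.pi * (1 - ε) < 4 * (1 * (2 * (Real.pi / 4) - 0)) := by
    nlinarith [Real.pi_pos]
  obtain ⟨r, hr1, hr⟩ := ((eventually_ge_atTop 1).and (lim.eventually_const_lt hlt)).exists
  exact ⟨r, hr1, hr.le.trans (mass_ge r)⟩

end GGreen

noncomputable section GGreen2

theorem hl_shift (v x : Vtx) : hl v (x + v) = hl 0 x := by
  unfold hl q2; simp

theorem mass_shift (v : Vtx) (r : ℤ) : ∑ x ∈ Bx v r, Lp (hl v) x = ∑ x ∈ Bx 0 r, Lp (hl 0) x := by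
  refine Finset.sum_nbij' (fun x => x - v) (fun x => x + v) ?_ ?_ ?_ ?_ ?_
  · intro x hx; rw [mem_Bx] at hx ⊢; simp only [Prod.fst_sub, Prod.snd_sub, Prod.fst_zero, Prod.snd_zero]; omega
  · intro x hx; rw [mem_Bx] at hx ⊢; simp only [Prod.fst_add, Prod.snd_add, Prod.fst_zero, Prod.snd_zero] at hx ⊢; omega
  · intro x _; simp
  · intro x _; simp
  · intro x _
    have h := fun y => (hl_shift v y).symm
    unfold Lp nbS
    rw [h, h, h, h, h]
    simp only [Prod.fst_sub, Prod.snd_sub, sub_add_cancel]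
    have e1 : ((x.1 - v.1 + 1, x.2 - v.2) : Vtx) + v = (x.1 + 1, x.2) := by
      apply Prod.ext <;> simp <;> ring
    have e2 : ((x.1 - v.1 - 1, x.2 - v.2) : Vtx) + v = (x.1 - 1, x.2) := by
      apply Prod.ext <;> simp <;> ring
    have e3 : ((x.1 - v.1, x.2 - v.2 + 1) : Vtx) + v = (x.1, x.2 + 1) := by
      apply Prod.ext <;> simp <;> ring
    have e4 : ((x.1 - v.1, x.2 - v.2 - 1) : Vtx) + v = (x.1, x.2 - 1) := by
      apply Prod.ext <;> simp <;> ring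
    rw [e1, e2, e3, e4]

theorem ev_rpow_log (δ A B : ℝ) (hδ : 0 < δ) (hA : 0 ≤ A) :
    ∀ᶠ N : ℕ in atTop, A * Real.log N + B ≤ (N : ℝ) ^ δ := by
  have h1 : Tendsto (fun x : ℝ => x ^ δ) atTop atTop := tendsto_rpow_atTop hδ
  have h2 := (isLittleO_log_rpow_atTop hδ).def (show 0 < 1 / (2 * (A + 1)) by positivity)
  have h3 := h1.eventually_ge_atTop (2 * B)
  have := (h2.and (h3.and (eventually_ge_atTop 1)))
  filter_upwards [tendsto_natCast_atTop_atTop.eventually this] with N hN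
  obtain ⟨ha, hb, hc⟩ := hN
  rw [Real.norm_of_nonneg (Real.log_nonneg hc), Real.norm_of_nonneg (by positivity)] at ha
  have hx : (0 : ℝ) ≤ (N : ℝ) ^ δ := by positivity
  have : A * Real.log N ≤ (N : ℝ) ^ δ / 2 := by
    calc A * Real.log N ≤ A * (1 / (2 * (A + 1)) * (N : ℝ) ^ δ) := mul_le_mul_of_nonneg_left ha hA
      _ = (A / (A + 1)) * ((N : ℝ) ^ δ / 2) := by field_simp
      _ ≤ 1 * ((N : ℝ) ^ δ / 2) := by
        apply mul_le_mul_of_nonneg_right _ (by positivity)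
        rw [div_le_one (by positivity)]; linarith
      _ = _ := one_mul _
  linarith

theorem ev_log (B : ℝ) : ∀ᶠ N : ℕ in atTop, B ≤ Real.log N :=
  (Real.tendsto_log_atTop.comp tendsto_natCast_atTop_atTop).eventually_ge_atTop B

theorem greenLog (ε δ : ℝ) (hε : 0 < ε) (hδ : 0 < δ) :
    ∀ᶠ N : ℕ in atTop, ∀ (S : Finset Vtx) (v w : Vtx) (K k : ℤ), S ⊆ Bx v K → K ≤ N →
      (N : ℝ) ^ δ ≤ k → k ≤ K → w ∉ Bx v k → GS S w v ≤ Real.log K - Real.log k + ε * Real.log N := by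
  set ε' := min (1 / 2) (ε / 4) with hε'
  have hε'0 : 0 < ε' := by positivity
  have hε'1 : ε' ≤ 1 / 2 := min_le_left _ _
  have hε'2 : ε' ≤ ε / 4 := min_le_right _ _
  obtain ⟨r, hr1, hmass⟩ := mass_large ε' hε'0
  have hr1' : (1 : ℝ) ≤ r := by exact_mod_cast hr1
  filter_upwards [ev_rpow_log δ (16 * r) (49 * r + 1) hδ (by positivity), ev_log (10 / ε), ev_log 0,
    eventually_ge_atTop 1] with N h1 h2 h2' hN1 S v w K k hS hKN hk hkK hw
  have hN1' : (1 : ℝ) ≤ N := by exact_mod_cast hN1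
  have hk1 : (49 * r + 1 : ℝ) ≤ k := by nlinarith
  have hkr : (r : ℤ) + 1 ≤ k := by
    have : ((r : ℝ) + 1) ≤ k := by linarith
    exact_mod_cast this
  have hK1 : 1 ≤ K := by omega
  have hK1' : (1 : ℝ) ≤ K := by exact_mod_cast hK1
  have hk1' : (1 : ℝ) ≤ k := by linarith
  have hkK' : (k : ℝ) ≤ K := by exact_mod_cast hkK
  have hKN' : (K : ℝ) ≤ N := by exact_mod_cast hKN
  have hD0 : 0 ≤ Real.log K - Real.log k := by
    have := Real.log_le_log (by linarith) hkK'
    linarith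
  have hDL : Real.log K - Real.log k ≤ Real.log N := by
    have := Real.log_le_log (by linarith) hKN'
    have := Real.log_nonneg hk1'
    linarith
  have hLK : Real.log K ≤ Real.log N := Real.log_le_log (by linarith) hKN'
  have hLK0 : 0 ≤ Real.log K := Real.log_nonneg hK1'
  have hpi := Real.pi_pos
  refine (GS_mono hS w v).trans ?_
  set B := Bx v K with hB
  by_cases hwB : w ∈ B
  swap
  · rw [GS_off v hwB]; positivity
  -- U
  have hU := compareLe B (fun x => ∑ y ∈ Bx v r, (Lp (hl v) y / (2 * Real.pi)) * GS B x y)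
    (fun x => hl v x - -(1 / 2) * Real.log ((5 / 2) * ((K + 1 : ℤ) : ℝ) ^ 2))
    (fun x hx => by
      rw [Lp_sub, Lp_const, sub_zero, Lp_sum]
      have : ∀ y ∈ Bx v r, Lp (fun x => (Lp (hl v) y / (2 * Real.pi)) * GS B x y) x
          = if x = y then Lp (hl v) x else 0 := by
        intro y hy
        rw [Lp_smul, GS_on y hx]
        split_ifs with h
        · subst h; field_simp
        · simp
      rw [Finset.sum_congr rfl this, Finset.sum_ite_eq]
      split_ifs
      · exact le_rfl
      · exact Lp_hl_nonneg _ _)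
    (fun x hx y hy hyB => by
      rw [Finset.sum_eq_zero (fun z _ => by rw [GS_off z hyB, mul_zero])]
      have h3 := mem_Bx.1 hx
      have h4 := AdjV_bound hy
      have : y ∈ Bx v (K + 1) := by rw [mem_Bx]; omega
      have := hl_ge (by omega) this
      linarith) w hwB
  set E : ℝ := 4 * (12 + 4 * Real.log K) * r / ((k - r : ℤ) : ℝ) with hE
  have hE1 : E ≤ 1 := by
    rw [hE, div_le_one (by exact_mod_cast (by omega))]
    push_cast
    nlinarith
  have hlip : ∀ y ∈ Bx v r, GS B w v - E ≤ GS B w y := by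
    intro y hy
    rw [GS_symm B w v, GS_symm B w y]
    have := harm_lip (fun z => GS B z w) v y (k - r) r (by omega) (by omega) (12 + 4 * Real.log K)
      (by positivity) (fun x hx => by
        rw [sub_add_cancel] at hx
        have hxB : x ∈ B := by
          rw [hB]
          rw [mem_Bx] at hx ⊢; omega
        rw [GS_on w hxB, if_neg]
        rintro rfl; exact hw hx)
      (fun x hx => by
        rw [abs_of_nonneg (GS_nonneg _ _ _)]
        exact GS_crude B v K hK1 (by rw [hB]) x w) hy
    rw [abs_le] at this
    have h5 := this.1
    rw [show (((r : ℤ) : ℝ)) = (r : ℝ) by simp] at h5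

    linarith
  have hup : hl v w - -(1 / 2) * Real.log ((5 / 2) * ((K + 1 : ℤ) : ℝ) ^ 2) ≤ Real.log K - Real.log k + 2 := by
    have h3 := hl_le (by omega) hw
    have h4 := log_five_halves_sq (K := ((K + 1 : ℤ) : ℝ)) (by push_cast; linarith)
    have h5 : Real.log ((K + 1 : ℤ) : ℝ) ≤ Real.log 2 + Real.log K := by
      rw [← Real.log_mul (by norm_num) (by positivity)]
      apply Real.log_le_log
      · push_cast; linarith
      · push_cast; linarith
    have := Real.log_two_lt_d9
    linarith
  have h6 : GS B w v - E ≤ (Real.log K - Real.log k + 2) * (1 + 2 * ε') := by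
    by_cases hneg : GS B w v - E ≤ 0
    · exact hneg.trans (by positivity)
    push Not at hneg
    have hlow : (1 - ε') * (GS B w v - E) ≤ ∑ y ∈ Bx v r, (Lp (hl v) y / (2 * Real.pi)) * GS B w y := by
      calc (1 - ε') * (GS B w v - E) ≤ (∑ y ∈ Bx v r, (Lp (hl v) y / (2 * Real.pi))) * (GS B w v - E) := by
            apply mul_le_mul_of_nonneg_right _ hneg.le
            rw [← Finset.sum_div, mass_shift, le_div_iff₀ (by positivity)]
            linarith
        _ ≤ _ := by
            rw [Finset.sum_mul]
            apply Finset.sum_le_sum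
            intro y hy
            apply mul_le_mul_of_nonneg_left (hlip y hy)
            have := Lp_hl_nonneg v y
            positivity
    have h7 : (1 - ε') * (GS B w v - E) ≤ Real.log K - Real.log k + 2 := hlow.trans (hU.trans hup)
    have h8 : (1 + 2 * ε') * ((1 - ε') * (GS B w v - E)) ≤ (1 + 2 * ε') * (Real.log K - Real.log k + 2) :=
      mul_le_mul_of_nonneg_left h7 (by positivity)
    have h9 : 1 ≤ (1 + 2 * ε') * (1 - ε') := by nlinarith
    nlinarith
  have h10 : 10 ≤ Real.log N * ε := by rwa [div_le_iff₀ hε] at h2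
  have : (Real.log K - Real.log k) * ε' ≤ Real.log N * (ε / 4) :=
    mul_le_mul hDL hε'2 hε'0.le h2'
  nlinarith

/-! neighbourhood interior -/
theorem mem_VN {N : ℕ} {x : Vtx} : x ∈ VN N ↔ (0 ≤ x.1 ∧ x.1 ≤ N) ∧ (0 ≤ x.2 ∧ x.2 ≤ N) := by
  unfold VN
  rw [Finset.mem_Icc, Prod.le_def, Prod.le_def]; simp only; tauto

theorem mem_intr {B : Finset Vtx} {x : Vtx} : x ∈ intr B ↔ x ∈ B ∧ (x.1 + 1, x.2) ∈ B ∧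
    (x.1 - 1, x.2) ∈ B ∧ (x.1, x.2 + 1) ∈ B ∧ (x.1, x.2 - 1) ∈ B := by
  unfold intr bdry; rw [Finset.mem_sdiff, Finset.mem_filter]; tauto

theorem intr_mono {B B' : Finset Vtx} (h : B ⊆ B') : intr B ⊆ intr B' := by
  intro x hx
  rw [mem_intr] at hx ⊢
  exact ⟨h hx.1, h hx.2.1, h hx.2.2.1, h hx.2.2.2.1, h hx.2.2.2.2⟩

theorem mem_intr_VN {N : ℕ} {x : Vtx} : x ∈ intr (VN N) ↔ 0 < x.1 ∧ x.1 < N ∧ 0 < x.2 ∧ x.2 < N := by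
  rw [mem_intr, mem_VN, mem_VN, mem_VN, mem_VN, mem_VN]; simp only; omega

theorem nbhd_sub_VN (N : ℕ) (lam : ℝ) (v : Vtx) (hv : v ∈ VN N) : nbhd N lam v ⊆ VN N := by
  unfold nbhd
  split_ifs
  · exact subset_rfl
  · simpa using hv
  · exact Finset.filter_subset _ _

theorem nbhd_anti (N : ℕ) (hN : 1 ≤ N) (a b : ℝ) (v : Vtx) (hv : v ∈ VN N) (ha : 0 ≤ a) (hab : a ≤ b) (hb : b ≤ 1) :
    nbhd N b v ⊆ nbhd N a v := by
  have hN' : (1 : ℝ) ≤ N := by exact_mod_cast hN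
  rcases eq_or_lt_of_le hab with rfl | hlt
  · exact subset_rfl
  by_cases h0 : a = 0
  · rw [show nbhd N a v = VN N by simp [nbhd, h0]]; exact nbhd_sub_VN N b v hv
  have h1 : a ≠ 1 := by intro h; linarith
  have hb0 : b ≠ 0 := by intro h; linarith
  have ea : nbhd N a v = (VN N).filter fun w =>
    |(w.1 : ℝ) - (v.1 : ℝ)| ≤ (N : ℝ) ^ ((1 : ℝ) - a) / 2 ∧
    |(w.2 : ℝ) - (v.2 : ℝ)| ≤ (N : ℝ) ^ ((1 : ℝ) - a) / 2 := by simp [nbhd, h0, h1]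
  intro x hx
  rw [ea, Finset.mem_filter]
  refine ⟨nbhd_sub_VN N b v hv hx, ?_⟩
  by_cases hb1 : b = 1
  · have : x = v := by simpa [nbhd, hb1] using hx
    subst this
    simp; positivity
  · have : x ∈ (VN N).filter fun w =>
      |(w.1 : ℝ) - (v.1 : ℝ)| ≤ (N : ℝ) ^ ((1 : ℝ) - b) / 2 ∧
      |(w.2 : ℝ) - (v.2 : ℝ)| ≤ (N : ℝ) ^ ((1 : ℝ) - b) / 2 := by simpa [nbhd, hb0, hb1] using hx
    rw [Finset.mem_filter] at this
    have hp : (N : ℝ) ^ ((1 : ℝ) - b) ≤ (N : ℝ) ^ ((1 : ℝ) - a) :=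
      Real.rpow_le_rpow_of_exponent_le hN' (by linarith)
    exact ⟨this.2.1.trans (by linarith), this.2.2.trans (by linarith)⟩

/-- interior of the neighbourhood -/
def SN (N : ℕ) (lam : ℝ) (v : Vtx) : Finset Vtx := intr (nbhd N lam v)

theorem SN_anti {N : ℕ} (hN : 1 ≤ N) {a b : ℝ} {v : Vtx} (hv : v ∈ VN N) (ha : 0 ≤ a) (hab : a ≤ b) (hb : b ≤ 1) :
    SN N b v ⊆ SN N a v := intr_mono (nbhd_anti N hN a b v hv ha hab hb)

theorem SN_zero (N : ℕ) (v : Vtx) : SN N 0 v = intr (VN N) := by simp [SN, nbhd]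

theorem SN_one (N : ℕ) (v : Vtx) : SN N 1 v = ∅ := by
  rw [Finset.eq_empty_iff_forall_notMem]
  intro x hx
  rw [SN, mem_intr] at hx
  simp only [nbhd, one_ne_zero, if_false, if_true, Finset.mem_singleton] at hx
  obtain ⟨h1, h2, -⟩ := hx
  rw [← h1, Prod.ext_iff] at h2
  simp at h2

/-- upper containment: `SN ⊆ Bx v ⌊N^{1-λ}⌋` -/
theorem SN_sub_Bx {N : ℕ} (hN : 1 ≤ N) {a : ℝ} {v : Vtx} (hv : v ∈ VN N) (ha : 0 ≤ a) (ha1 : a < 1) :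
    SN N a v ⊆ Bx v ⌊(N : ℝ) ^ (1 - a)⌋ := by
  intro x hx
  rw [SN, mem_intr] at hx
  by_cases h0 : a = 0
  · subst h0
    have h1 := mem_VN.1 (nbhd_sub_VN N 0 v hv hx.1)
    have h2 := mem_VN.1 hv
    rw [mem_Bx]
    simp only [sub_zero, Real.rpow_one, Int.floor_natCast]
    omega
  · have h1 : a ≠ 1 := ha1.ne
    have h2 := hx.1
    simp only [nbhd, h0, h1, if_false, Finset.mem_filter] at h2
    obtain ⟨-, h3, h4⟩ := h2
    have hp : 0 ≤ (N : ℝ) ^ (1 - a) := by positivity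
    have h5 : |x.1 - v.1| ≤ ⌊(N : ℝ) ^ (1 - a)⌋ := by
      rw [Int.le_floor]; push_cast; linarith
    have h6 : |x.2 - v.2| ≤ ⌊(N : ℝ) ^ (1 - a)⌋ := by
      rw [Int.le_floor]; push_cast; linarith
    rw [abs_le] at h5 h6
    rw [mem_Bx]; omega

/-- lower containment -/
theorem Bx_sub_SN {N : ℕ} {a : ℝ} {v : Vtx} (ha : 0 ≤ a) (ha1 : a < 1) (k : ℤ)
    (hk : (k : ℝ) + 1 ≤ (N : ℝ) ^ (1 - a) / 2) {x : Vtx} (hx : x ∈ Bx v k) (hxN : x ∈ intr (VN N)) :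
    x ∈ SN N a v := by
  by_cases h0 : a = 0
  · subst h0; rwa [SN_zero]
  have h1 : a ≠ 1 := ha1.ne
  rw [mem_intr] at hxN
  rw [SN, mem_intr]
  rw [mem_Bx] at hx
  have key : ∀ y : Vtx, y ∈ VN N → |y.1 - v.1| ≤ k + 1 → |y.2 - v.2| ≤ k + 1 → y ∈ nbhd N a v := by
    intro y hy h3 h4
    simp only [nbhd, h0, h1, if_false, Finset.mem_filter]
    refine ⟨hy, ?_, ?_⟩
    · have : (|y.1 - v.1| : ℝ) ≤ k + 1 := by exact_mod_cast h3
      linarith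
    · have : (|y.2 - v.2| : ℝ) ≤ k + 1 := by exact_mod_cast h4
      linarith
  refine ⟨key _ hxN.1 ?_ ?_, key _ hxN.2.1 ?_ ?_, key _ hxN.2.2.1 ?_ ?_, key _ hxN.2.2.2.1 ?_ ?_,
    key _ hxN.2.2.2.2 ?_ ?_⟩ <;> rw [abs_le] <;> (try simp only) <;> omega

end GGreen2

noncomputable section GVar

theorem ev_rpow (δ B : ℝ) (hδ : 0 < δ) : ∀ᶠ N : ℕ in atTop, B ≤ (N : ℝ) ^ δ := by
  filter_upwards [ev_rpow_log δ 0 B hδ le_rfl] with N hN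
  linarith

theorem SN_sub_intr {N : ℕ} {a : ℝ} {v : Vtx} (hv : v ∈ VN N) : SN N a v ⊆ intr (VN N) :=
  intr_mono (nbhd_sub_VN N a v hv)

theorem genVar (a b ε : ℝ) (ha : 0 ≤ a) (hab : a ≤ b) (hb : b < 1) (hε : 0 < ε) :
    ∀ᶠ N : ℕ in atTop, ∀ v ∈ VN N, ∀ T : Finset Vtx,
      (∀ x ∈ intr (VN N), x ∈ Bx v ⌊(N : ℝ) ^ (1 - b) / 32⌋ → x ∈ T) →
      HS T (fun z => GS (SN N a v) z v) v ≤ (b - a + ε) * Real.log N := by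
  filter_upwards [greenLog (ε / 2) ((1 - b) / 2) (by positivity) (by linarith),
    ev_rpow ((1 - b) / 2) 64 (by linarith), ev_log (10 / ε), eventually_ge_atTop 1] with
    N hG h1 h2 hN1 v hv T hT
  have hN1' : (1 : ℝ) ≤ N := by exact_mod_cast hN1
  have hN0 : (0 : ℝ) < N := by linarith
  have hL : 0 ≤ Real.log N := Real.log_nonneg hN1'
  have hsq : (N : ℝ) ^ (1 - b) = (N : ℝ) ^ ((1 - b) / 2) * (N : ℝ) ^ ((1 - b) / 2) := by
    rw [← Real.rpow_add hN0]; congr 1; ring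
  set t := (N : ℝ) ^ ((1 - b) / 2) with ht
  set k : ℤ := ⌊(N : ℝ) ^ (1 - b) / 32⌋ with hk
  set K : ℤ := ⌊(N : ℝ) ^ (1 - a)⌋ with hK
  have hk1 : (N : ℝ) ^ (1 - b) / 32 - 1 < k := Int.sub_one_lt_floor _
  have hk2 : (k : ℝ) ≤ (N : ℝ) ^ (1 - b) / 32 := Int.floor_le _
  have hK2 : (K : ℝ) ≤ (N : ℝ) ^ (1 - a) := Int.floor_le _
  have hmono : (N : ℝ) ^ (1 - b) ≤ (N : ℝ) ^ (1 - a) := Real.rpow_le_rpow_of_exponent_le hN1' (by linarith)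
  have hp : 0 < (N : ℝ) ^ (1 - b) := Real.rpow_pos_of_pos hN0 _
  have hkt : t ≤ k := by nlinarith
  have hkK : k ≤ K := by
    apply Int.floor_le_floor; linarith
  have hk64 : (N : ℝ) ^ (1 - b) / 64 ≤ k := by nlinarith
  have hKN : K ≤ N := by
    have : (K : ℝ) ≤ N := hK2.trans (by
      calc (N : ℝ) ^ (1 - a) ≤ (N : ℝ) ^ (1 : ℝ) := Real.rpow_le_rpow_of_exponent_le hN1' (by linarith)
        _ = N := Real.rpow_one _)
    exact_mod_cast this
  apply HS_le
  intro x hx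
  by_cases hxS : x ∈ SN N a v
  swap
  · rw [GS_off v hxS]; exact mul_nonneg (by linarith) hL
  have hxk : x ∉ Bx v k := fun hc => hx (hT x (SN_sub_intr hv hxS) hc)
  have := hG (SN N a v) v x K k (SN_sub_Bx hN1 hv ha (by linarith)) hKN hkt hkK hxk
  have hkpos : (0 : ℝ) < k := by linarith
  have hKpos : (0 : ℝ) < K := lt_of_lt_of_le hkpos (by exact_mod_cast hkK)
  have l1 : Real.log K ≤ (1 - a) * Real.log N := by
    rw [← Real.log_rpow hN0]; exact Real.log_le_log hKpos hK2
  have l2 : (1 - b) * Real.log N - Real.log 64 ≤ Real.log k := by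
    rw [← Real.log_rpow hN0, ← Real.log_div hp.ne' (by norm_num)]
    exact Real.log_le_log (by positivity) hk64
  have l3 : Real.log 64 ≤ 5 := by
    rw [show (64 : ℝ) = 2 ^ 6 by norm_num, Real.log_pow]
    have := Real.log_two_lt_d9
    push_cast; linarith
  have l4 : 10 ≤ Real.log N * ε := by rwa [div_le_iff₀ hε] at h2
  nlinarith

theorem varL (a b ε : ℝ) (ha : 0 ≤ a) (hab : a ≤ b) (hb : b ≤ 1) (ha1 : a < 1) (hε : 0 < ε) :
    ∀ᶠ N : ℕ in atTop, ∀ v ∈ VN N,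
      HS (SN N b v) (fun z => GS (SN N a v) z v) v ≤ (b - a + ε) * Real.log N := by
  rcases eq_or_lt_of_le hb with rfl | hb1
  · set b' := max a (1 - ε / 16) with hb'
    have hb'1 : b' < 1 := max_lt ha1 (by linarith)
    have hab' : a ≤ b' := le_max_left _ _
    have hb'2 : 1 - ε / 16 ≤ b' := le_max_right _ _
    filter_upwards [genVar a b' (ε / 4) ha hab' hb'1 (by positivity), ev_log (48 / ε),
      ev_rpow (1 - b') 64 (by linarith), eventually_ge_atTop 1]
      with N h1 h2 h3 hN1 v hv
    have hN1' : (1 : ℝ) ≤ N := by exact_mod_cast hN1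
    have hN0 : (0 : ℝ) < N := by linarith
    have hL : 0 ≤ Real.log N := Real.log_nonneg hN1'
    rw [SN_one, HS_off (by simp)]
    have hsub : SN N b' v ⊆ SN N a v := SN_anti hN1 hv ha hab' hb'1.le
    have e := GS_sub_HS hsub v v
    have h4 := h1 v hv (SN N b' v) (fun x hx hxB => Bx_sub_SN (ha.trans hab') hb'1 _ (by
      have := Int.floor_le ((N : ℝ) ^ (1 - b') / 32)
      linarith) hxB hx)
    have hK1 : (1 : ℤ) ≤ ⌊(N : ℝ) ^ (1 - b')⌋ := by
      rw [Int.le_floor]; push_cast; linarith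
    have h5 := GS_crude (SN N b' v) v ⌊(N : ℝ) ^ (1 - b')⌋ hK1
      (SN_sub_Bx hN1 hv (ha.trans hab') hb'1) v v
    have h6 : Real.log (⌊(N : ℝ) ^ (1 - b')⌋ : ℤ) ≤ (1 - b') * Real.log N := by
      rw [← Real.log_rpow hN0]; exact Real.log_le_log (by exact_mod_cast hK1) (Int.floor_le _)
    have l4 : 48 ≤ Real.log N * ε := by rwa [div_le_iff₀ hε] at h2
    nlinarith
  · filter_upwards [genVar a b ε ha hab hb1 hε, ev_rpow (1 - b) 64 (by linarith)] with N h1 h3 v hv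
    exact h1 v hv (SN N b v) (fun x hx hxB => Bx_sub_SN (ha.trans hab) hb1 _ (by
      have := Int.floor_le ((N : ℝ) ^ (1 - b) / 32)
      linarith) hxB hx)

theorem intr_sub_Bx (N : ℕ) : intr (VN N) ⊆ Bx 0 N := by
  intro x hx
  rw [mem_intr_VN] at hx
  rw [mem_Bx]; simp only [Prod.fst_zero, Prod.snd_zero]; omega

theorem crudeN : ∀ᶠ N : ℕ in atTop, ∀ x y, GS (intr (VN N)) x y ≤ 16 * Real.log N := by
  filter_upwards [ev_log 1, eventually_ge_atTop 1] with N h hN x y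
  have := GS_crude (intr (VN N)) 0 N (by exact_mod_cast hN) (intr_sub_Bx N) x y
  rw [show (((N : ℤ)) : ℝ) = (N : ℝ) by simp] at this
  linarith

end GVar

noncomputable section GBil

open MeasureTheory ProbabilityTheory

/-- Green function on the full box -/
def GN (N : ℕ) (x y : Vtx) : ℝ := GS (intr (VN N)) x y

/-- covariance form -/
def bil (N : ℕ) (c d : Vtx → ℝ) : ℝ := ∑ v ∈ VN N, ∑ w ∈ VN N, c v * d w * GN N v w

/-- linear functional of the field -/
def Lin (N : ℕ) (c : Vtx → ℝ) (ω : FieldSp) : ℝ := ∑ v ∈ VN N, c v * ω v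

/-- harmonic measure coefficients -/
def pc (S : Finset Vtx) (x w : Vtx) : ℝ := HS S (fun z => if z = w then 1 else 0) x

theorem intr_sub_VN (N : ℕ) : intr (VN N) ⊆ VN N := by
  intro x hx; rw [mem_intr] at hx; exact hx.1

theorem GN_symm (N : ℕ) (x y : Vtx) : GN N x y = GN N y x := GS_symm _ _ _

theorem GN_off {N : ℕ} {x : Vtx} (y : Vtx) (hx : x ∉ VN N) : GN N x y = 0 :=
  GS_off y (fun h => hx (intr_sub_VN N h))

theorem bil_symm (N : ℕ) (c d : Vtx → ℝ) : bil N c d = bil N d c := by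
  unfold bil
  rw [Finset.sum_comm]
  apply Finset.sum_congr rfl; intro v _
  apply Finset.sum_congr rfl; intro w _
  rw [GN_symm]; ring

theorem bil_sub_left (N : ℕ) (c c' d : Vtx → ℝ) : bil N (fun v => c v - c' v) d = bil N c d - bil N c' d := by
  unfold bil; simp only [sub_mul, Finset.sum_sub_distrib]

theorem bil_add_left (N : ℕ) (c c' d : Vtx → ℝ) : bil N (fun v => c v + c' v) d = bil N c d + bil N c' d := by
  unfold bil; simp only [add_mul, Finset.sum_add_distrib]

theorem bil_smul_left (N : ℕ) (a : ℝ) (c d : Vtx → ℝ) : bil N (fun v => a * c v) d = a * bil N c d := by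
  unfold bil; simp only [Finset.mul_sum, mul_assoc]

theorem bil_sum_left {ι : Type*} (N : ℕ) (s : Finset ι) (c : ι → Vtx → ℝ) (d : Vtx → ℝ) :
    bil N (fun v => ∑ i ∈ s, c i v) d = ∑ i ∈ s, bil N (c i) d := by
  induction s using Finset.induction_on with
  | empty => simp [bil]
  | insert a s ha ih =>
    simp only [Finset.sum_insert ha]
    rw [bil_add_left, ih]

theorem bil_sub_right (N : ℕ) (c c' d : Vtx → ℝ) : bil N d (fun v => c v - c' v) = bil N d c - bil N d c' := by
  rw [bil_symm, bil_sub_left, bil_symm N c, bil_symm N c']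

theorem bil_add_right (N : ℕ) (c c' d : Vtx → ℝ) : bil N d (fun v => c v + c' v) = bil N d c + bil N d c' := by
  rw [bil_symm, bil_add_left, bil_symm N c, bil_symm N c']

theorem bil_smul_right (N : ℕ) (a : ℝ) (c d : Vtx → ℝ) : bil N d (fun v => a * c v) = a * bil N d c := by
  rw [bil_symm, bil_smul_left, bil_symm]

theorem bil_sum_right {ι : Type*} (N : ℕ) (s : Finset ι) (c : ι → Vtx → ℝ) (d : Vtx → ℝ) :
    bil N d (fun v => ∑ i ∈ s, c i v) = ∑ i ∈ s, bil N d (c i) := by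
  rw [bil_symm, bil_sum_left]; exact Finset.sum_congr rfl fun i _ => bil_symm _ _ _

theorem HS_pc (N : ℕ) (S : Finset Vtx) (f : Vtx → ℝ) (hf : ∀ z, z ∉ VN N → f z = 0) (x : Vtx) :
    HS S f x = ∑ w ∈ VN N, pc S x w * f w := by
  have : f = fun z => ∑ w ∈ VN N, f w * (if z = w then 1 else 0) := by
    funext z
    simp only [mul_ite, mul_one, mul_zero, Finset.sum_ite_eq]
    split_ifs with h
    · rfl
    · exact hf z h
  conv_lhs => rw [this]
  rw [HS_sum S (VN N) (fun w z => f w * (if z = w then 1 else 0))]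
  apply Finset.sum_congr rfl
  intro w _
  rw [HS_smul]; unfold pc; ring

theorem bil_pc_left (N : ℕ) (S : Finset Vtx) (x : Vtx) (d : Vtx → ℝ) :
    bil N (pc S x) d = ∑ w ∈ VN N, d w * HS S (fun z => GN N z w) x := by
  unfold bil
  rw [Finset.sum_comm]
  apply Finset.sum_congr rfl
  intro w _
  rw [HS_pc N S (fun z => GN N z w) (fun z hz => GN_off w hz), Finset.mul_sum]
  apply Finset.sum_congr rfl
  intro v _; ring

/-- covariance of harmonic averages -/
def QN (N : ℕ) (T : Finset Vtx) (x y : Vtx) : ℝ := HS T (fun w => GN N w x) y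

theorem HS_congr {S : Finset Vtx} {f g : Vtx → ℝ} (h : ∀ x, x ∉ S → f x = g x) : HS S f = HS S g :=
  HS_unique (fun _ hx => HS_on hx) (fun x hx => by rw [HS_off hx, h x hx])

theorem bil_pc_pc (N : ℕ) (S' S : Finset Vtx) (hSS : S' ⊆ S) (hS : S ⊆ intr (VN N)) (x y : Vtx) :
    bil N (pc S' x) (pc S y) = QN N S x y := by
  rw [bil_pc_left, ← HS_pc N S (fun w => HS S' (fun z => GN N z w) x)]
  · unfold QN
    refine congrFun (HS_congr ?_) y
    intro w hw
    rw [HS_unique (u := fun z => GN N z w) _ (fun _ _ => rfl), GN_symm]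
    intro z hz
    unfold GN
    rw [GS_on w (hS (hSS hz)), if_neg]
    rintro rfl; exact hw (hSS hz)
  · intro w hw
    have : (fun z => GN N z w) = fun z => 0 := by
      funext z; rw [GN_symm, GN_off z hw]
    rw [this, HS_unique (u := fun _ => 0) (fun _ _ => Lp_const _ _) (fun _ _ => rfl)]

theorem QN_symm (N : ℕ) (T : Finset Vtx) (hT : T ⊆ intr (VN N)) (x y : Vtx) : QN N T x y = QN N T y x := by
  rw [← bil_pc_pc N T T subset_rfl hT, bil_symm, bil_pc_pc N T T subset_rfl hT]

theorem QN_diff (N : ℕ) (S' S : Finset Vtx) (hSS : S' ⊆ S) (hS : S ⊆ intr (VN N)) (v : Vtx) :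
    QN N S' v v - QN N S v v = HS S' (fun z => GS S z v) v := by
  unfold QN
  have e : (fun z => GS S z v) = fun z => GN N z v - HS S (fun w => GN N w v) z := by
    funext z; rw [← GS_sub_HS hS]; rfl
  rw [e, HS_sub, HS_HS hSS]

theorem QN_zero (N : ℕ) (v y : Vtx) : QN N (intr (VN N)) v y = 0 := by
  unfold QN
  rw [HS_unique (u := fun _ => 0) (fun _ _ => Lp_const _ _)]
  intro x hx; unfold GN; rw [GS_off v hx]

/-- variance of difference of two nested averages -/
theorem bil_nested (N : ℕ) (S' S : Finset Vtx) (hSS : S' ⊆ S) (hS : S ⊆ intr (VN N)) (v : Vtx) :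
    bil N (fun w => pc S' v w - pc S v w) (fun w => pc S' v w - pc S v w) = HS S' (fun z => GS S z v) v := by
  rw [bil_sub_left, bil_sub_right, bil_sub_right, bil_pc_pc N S' S' subset_rfl (hSS.trans hS),
    bil_pc_pc N S' S hSS hS, bil_symm N (pc S v), bil_pc_pc N S' S hSS hS, bil_pc_pc N S S subset_rfl hS,
    ← QN_diff N S' S hSS hS]
  ring

theorem Lin_sub (N : ℕ) (c d : Vtx → ℝ) (ω : FieldSp) : Lin N (fun v => c v - d v) ω = Lin N c ω - Lin N d ω := by
  unfold Lin; simp only [sub_mul, Finset.sum_sub_distrib]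

theorem Lin_smul (N : ℕ) (a : ℝ) (c : Vtx → ℝ) (ω : FieldSp) : Lin N (fun v => a * c v) ω = a * Lin N c ω := by
  unfold Lin; rw [Finset.mul_sum]; exact Finset.sum_congr rfl fun _ _ => by ring

theorem Lin_add (N : ℕ) (c d : Vtx → ℝ) (ω : FieldSp) : Lin N (fun v => c v + d v) ω = Lin N c ω + Lin N d ω := by
  unfold Lin; simp only [add_mul, Finset.sum_add_distrib]

theorem Lin_sum {ι : Type*} (N : ℕ) (s : Finset ι) (c : ι → Vtx → ℝ) (ω : FieldSp) :
    Lin N (fun v => ∑ i ∈ s, c i v) ω = ∑ i ∈ s, Lin N (c i) ω := by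
  unfold Lin; simp only [Finset.sum_mul]; rw [Finset.sum_comm]

theorem Lin_meas (N : ℕ) (c : Vtx → ℝ) : Measurable (Lin N c) := by
  unfold Lin
  exact Finset.measurable_sum _ (fun v _ => (measurable_pi_apply v).const_mul _)

theorem Lin_law {N : ℕ} {P : Measure FieldSp} (h : IsGFF N P) (c : Vtx → ℝ) :
    P.map (Lin N c) = gaussianReal 0 (Real.toNNReal (bil N c c)) := by
  obtain ⟨_, G, hG, h2⟩ := h
  have e : ∀ v w, G v w = GN N v w := green_eq hG
  have := h2 c
  simp only [e] at this
  exact this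

theorem Lin_exp {N : ℕ} {P : Measure FieldSp} (h : IsGFF N P) (c : Vtx → ℝ) :
    ∫⁻ ω, ENNReal.ofReal (Real.exp (Lin N c ω)) ∂P = ENNReal.ofReal (Real.exp ((Real.toNNReal (bil N c c) : ℝ) / 2)) := by
  have h1 := Lin_law h c
  have h2 : ∫⁻ ω, ENNReal.ofReal (Real.exp (Lin N c ω)) ∂P =
      ∫⁻ x, ENNReal.ofReal (Real.exp x) ∂(gaussianReal 0 (Real.toNNReal (bil N c c))) := by
    rw [← h1, lintegral_map (by fun_prop) (Lin_meas N c)]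
  rw [h2]
  have h3 : Integrable (fun x : ℝ => Real.exp x) (gaussianReal 0 (Real.toNNReal (bil N c c))) := by
    simpa using integrable_exp_mul_gaussianReal (μ := 0) (v := Real.toNNReal (bil N c c)) 1
  rw [← ofReal_integral_eq_lintegral_ofReal h3 (ae_of_all _ fun x => (Real.exp_pos x).le)]
  have h4 := congrFun (mgf_fun_id_gaussianReal (μ := 0) (v := Real.toNNReal (bil N c c))) 1
  unfold mgf at h4
  simp only [one_mul] at h4
  rw [h4]; norm_num

/-- Chernoff -/
theorem Lin_chernoff {N : ℕ} {P : Measure FieldSp} (h : IsGFF N P) (c : Vtx → ℝ) (V s B : ℝ)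
    (hV : bil N c c ≤ V) (hV0 : 0 ≤ V) (hB : 0 < B) :
    P {ω | s < Lin N c ω} ≤ ENNReal.ofReal (Real.exp (B ^ 2 * V / 2 - B * s)) := by
  have h1 := Lin_exp h (fun v => B * c v)
  have hsub : {ω | s < Lin N c ω} ⊆ {ω | ENNReal.ofReal (Real.exp (B * s)) ≤ ENNReal.ofReal (Real.exp (Lin N (fun v => B * c v) ω))} := by
    intro ω hω
    simp only [Set.mem_setOf_eq] at hω ⊢
    apply ENNReal.ofReal_le_ofReal
    apply Real.exp_le_exp.2
    rw [Lin_smul]; nlinarith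
  refine (measure_mono hsub).trans ?_
  have hm : Measurable (fun ω => ENNReal.ofReal (Real.exp (Lin N (fun v => B * c v) ω))) :=
    ENNReal.measurable_ofReal.comp (Real.measurable_exp.comp (Lin_meas N _))
  refine (meas_ge_le_lintegral_div hm.aemeasurable (by simp [Real.exp_pos]) (by simp)).trans ?_
  rw [h1, ← ENNReal.ofReal_div_of_pos (Real.exp_pos _), ← Real.exp_sub]
  apply ENNReal.ofReal_le_ofReal
  apply Real.exp_le_exp.2
  have : ((Real.toNNReal (bil N (fun v => B * c v) (fun v => B * c v)) : ℝ)) ≤ B ^ 2 * V := by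
    rw [bil_smul_left, bil_smul_right, Real.coe_toNNReal']
    apply max_le _ (by positivity)
    nlinarith [mul_le_mul_of_nonneg_left hV (sq_nonneg B)]
  linarith

theorem gauss_restrict {N : ℕ} {P : Measure FieldSp} (h : IsGFF N P) :
    HasGaussianLaw (fun (ω : FieldSp) (v : VN N) => ω v) P := by
  constructor
  apply isGaussian_of_map_eq_gaussianReal
  intro L
  let c : Vtx → ℝ := fun v => if hv : v ∈ VN N then L (Pi.single ⟨v, hv⟩ 1) else 0
  refine ⟨0, Real.toNNReal (bil N c c), ?_⟩
  rw [Measure.map_map (by fun_prop) (by fun_prop), ← Lin_law h c]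
  congr 1
  funext ω
  simp only [Function.comp]
  unfold Lin
  rw [← Finset.sum_coe_sort (VN N)]
  have : (fun v : VN N => ω v) = ∑ v : VN N, ω v • Pi.single (M := fun _ => ℝ) v (1 : ℝ) := by
    funext w
    simp [Finset.sum_apply, Pi.single_apply]
  rw [this, map_sum]
  apply Finset.sum_congr rfl
  intro v _
  rw [map_smul]
  simp only [c, v.2, dif_pos, smul_eq_mul]
  ring

end GBil

noncomputable section GCond

open MeasureTheory ProbabilityTheory

theorem Lin_gauss {N : ℕ} {P : Measure FieldSp} (h : IsGFF N P) (c : Vtx → ℝ) :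
    HasGaussianLaw (Lin N c) P := by
  constructor; rw [Lin_law h]; infer_instance

theorem Lin_int {N : ℕ} {P : Measure FieldSp} (h : IsGFF N P) (c : Vtx → ℝ) : ∫ ω, Lin N c ω ∂P = 0 := by
  have : ∫ x, x ∂(P.map (Lin N c)) = ∫ ω, Lin N c ω ∂P :=
    integral_map (Lin_meas N c).aemeasurable (by fun_prop)
  rw [← this, Lin_law h, integral_id_gaussianReal]

theorem Lin_var {N : ℕ} {P : Measure FieldSp} (h : IsGFF N P) (c : Vtx → ℝ) :
    Var[Lin N c; P] = Real.toNNReal (bil N c c) := by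
  have h1 : Var[id; P.map (Lin N c)] = Var[Lin N c; P] := by
    rw [variance_map (by fun_prop) (Lin_meas N c).aemeasurable]; rfl
  rw [← h1, Lin_law h, variance_id_gaussianReal]

theorem Lin_cov {N : ℕ} {P : Measure FieldSp} (h : IsGFF N P) (c d : Vtx → ℝ) (hcd : bil N c d = 0) :
    cov[Lin N c, Lin N d; P] = 0 := by
  have := h.1
  have h1 := variance_add (Lin_gauss h c).memLp_two (Lin_gauss h d).memLp_two
  have h2 := variance_sub (Lin_gauss h c).memLp_two (Lin_gauss h d).memLp_two
  have e1 : Lin N c + Lin N d = Lin N (fun v => c v + d v) := by funext ω; rw [Lin_add]; rfl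
  have e2 : Lin N c - Lin N d = Lin N (fun v => c v - d v) := by funext ω; rw [Lin_sub]; rfl
  have e3 : bil N (fun v => c v + d v) (fun v => c v + d v) = bil N (fun v => c v - d v) (fun v => c v - d v) := by
    rw [bil_add_left, bil_add_right, bil_add_right, bil_sub_left, bil_sub_right, bil_sub_right,
      bil_symm N d c, hcd]; ring
  rw [e1, Lin_var h, e3] at h1
  rw [e2, Lin_var h] at h2
  linarith

theorem pc_on {S : Finset Vtx} {x w : Vtx} (hw : w ∈ S) : pc S x w = 0 := by
  unfold pc
  rw [HS_unique (u := fun _ => 0) (fun _ _ => Lp_const _ _)]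
  intro z hz
  rw [if_neg]; rintro rfl; exact hz hw

theorem Lin_delta {N : ℕ} {v : Vtx} (hv : v ∈ VN N) (ω : FieldSp) : Lin N (pc ∅ v) ω = ω v := by
  unfold Lin
  have : ∀ w, pc ∅ v w = if v = w then 1 else 0 := fun w => by unfold pc; rw [HS_off (by simp)]
  simp only [this, ite_mul, one_mul, zero_mul, Finset.sum_ite_eq, hv, if_true]

theorem phiScale_ae {N : ℕ} {P : Measure FieldSp} (h : IsGFF N P) {v : Vtx} (hv : v ∈ VN N) (lam : ℝ) :
    phiScale N P v lam =ᵐ[P] Lin N (pc (SN N lam v) v) := by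
  have hP := h.1
  set S := SN N lam v with hS
  have hSi : S ⊆ intr (VN N) := SN_sub_intr hv
  set d : Vtx → ℝ := fun w => pc ∅ v w - pc S v w with hd
  set m := scaleAlg N lam v with hm
  have hmle : m ≤ MeasurableSpace.pi := by
    rw [hm, scaleAlg]
    apply iSup₂_le
    intro w _
    exact (measurable_pi_apply w).comap_le
  have hmw : ∀ w, w ∈ VN N → w ∉ S → Measurable[m] (fun ω : FieldSp => ω w) := by
    intro w h1 h2
    have : MeasurableSpace.comap (fun ω : FieldSp => ω w) inferInstance ≤ m := by
      rw [hm, scaleAlg]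
      exact le_iSup₂_of_le w ⟨h1, h2⟩ le_rfl
    exact (comap_measurable (fun ω : FieldSp => ω w)).mono this le_rfl
  have hpm : Measurable[m] (Lin N (pc S v)) := by
    unfold Lin
    apply Finset.measurable_sum
    intro w hw
    by_cases hwS : w ∈ S
    · simp only [pc_on hwS, zero_mul]; exact measurable_const
    · exact (hmw w hw hwS).const_mul _
  -- independence
  let κ := {w : Vtx // w ∈ (VN N).filter (fun w => w ∉ S)}
  have hG : HasGaussianLaw (fun ω : FieldSp => ((fun _ : Unit => Lin N d ω), (fun w : κ => ω w.1))) P := by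
    let L : ((VN N) → ℝ) →ₗ[ℝ] ((Unit → ℝ) × (κ → ℝ)) :=
      { toFun := fun y => ((fun _ => ∑ w : VN N, d w * y w), fun w => y ⟨w.1, (Finset.mem_filter.1 w.2).1⟩)
        map_add' := by
          intro x y
          apply Prod.ext
          · funext u; simp [mul_add, Finset.sum_add_distrib]
          · funext w; simp
        map_smul' := by
          intro a y
          apply Prod.ext
          · funext u; simp only [Pi.smul_apply, smul_eq_mul, RingHom.id_apply, Prod.smul_fst, Finset.mul_sum]
            exact Finset.sum_congr rfl fun _ _ => by ring
          · funext w; simp }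
    have := (gauss_restrict h).map_fun (LinearMap.toContinuousLinearMap L)
    refine this.congr (Eventually.of_forall fun ω => ?_)
    symm
    apply Prod.ext
    · funext u
      simp only [L, LinearMap.coe_toContinuousLinearMap', LinearMap.coe_mk, AddHom.coe_mk]
      unfold Lin
      rw [← Finset.sum_coe_sort (VN N)]
    · funext w
      simp only [L, LinearMap.coe_toContinuousLinearMap', LinearMap.coe_mk, AddHom.coe_mk]
  have hind := hG.indepFun_of_covariance_eval (X := fun (_ : Unit) ω => Lin N d ω)
    (Y := fun (w : κ) (ω : FieldSp) => ω w.1) (by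
      intro _ w
      have hw := Finset.mem_filter.1 w.2
      have e : (fun ω : FieldSp => ω w.1) = Lin N (pc ∅ w.1) := by
        funext ω; rw [Lin_delta hw.1]
      rw [e]
      apply Lin_cov h
      have e2 : pc ∅ w.1 = pc S w.1 := by
        funext z; unfold pc; rw [HS_off (by simp), HS_off hw.2]
      rw [hd, bil_sub_left, e2, bil_pc_pc N ∅ S (by simp) hSi, bil_pc_pc N S S subset_rfl hSi, sub_self])
  have hle : m ≤ MeasurableSpace.comap (fun (ω : FieldSp) (w : κ) => ω w.1) inferInstance := by
    rw [hm, scaleAlg]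
    apply iSup₂_le
    intro w hw
    rw [← measurable_iff_comap_le]
    exact (measurable_pi_apply (⟨w, Finset.mem_filter.2 hw⟩ : κ)).comp (comap_measurable (fun (ω : FieldSp) (w : κ) => ω w.1))
  have hind2 : Indep (MeasurableSpace.comap (fun (ω : FieldSp) (_ : Unit) => Lin N d ω) inferInstance) m P :=
    indep_of_indep_of_le_right hind hle
  have hc1 : P[Lin N d | m] =ᵐ[P] fun _ => 0 := by
    have hmeas : Measurable[MeasurableSpace.pi] (fun (ω : FieldSp) (_ : Unit) => Lin N d ω) := by
      exact @measurable_pi_lambda _ _ _ MeasurableSpace.pi _ _ (fun _ => Lin_meas N d)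
    have := condExp_indep_eq (μ := P) (f := Lin N d) (hmeas.comap_le) hmle
      (Measurable.stronglyMeasurable ((measurable_pi_apply ()).comp (comap_measurable (fun (ω : FieldSp) (_ : Unit) => Lin N d ω)))) hind2
    rwa [Lin_int h] at this
  have hc2 : P[Lin N (pc S v) | m] = Lin N (pc S v) :=
    condExp_of_stronglyMeasurable hmle hpm.stronglyMeasurable (Lin_gauss h _).integrable
  have e3 : (fun ω : FieldSp => ω v) = Lin N (pc S v) + Lin N d := by
    funext ω
    rw [hd]
    simp only [Pi.add_apply]
    rw [Lin_sub, Lin_delta hv]; ring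
  unfold phiScale
  rw [e3]
  have h4 := condExp_add (μ := P) (Lin_gauss h (pc S v)).integrable (Lin_gauss h d).integrable m
  rw [hc2] at h4
  filter_upwards [h4, hc1] with ω h5 h6
  rw [h5, Pi.add_apply, h6, add_zero]

end GCond

noncomputable section GReg

open MeasureTheory ProbabilityTheory

/-- Intersection of a mesoscopic box with the interior. -/
def TT (N : ℕ) (lam : ℝ) (c : Vtx) : Finset Vtx :=
  (intr (VN N)).filter fun x => x ∈ Bx c ⌊(N:ℝ)^(1-lam)/8⌋

theorem TT_sub (N : ℕ) (lam : ℝ) (c : Vtx) : TT N lam c ⊆ intr (VN N) := Finset.filter_subset _ _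

theorem bil_swap (N : ℕ) (c d : Vtx → ℝ) :
    bil N (fun w => c w - d w) (fun w => c w - d w) = bil N (fun w => d w - c w) (fun w => d w - c w) := by
  simp only [bil_sub_left, bil_sub_right]; ring

theorem regArith (X Y L ε : ℝ) (s r k : ℤ) (hX : 64 ≤ X) (hY : 128 ≤ Y) (hXY : 1 ≤ X / Y) (hL : 0 ≤ L)
    (hε : 0 < ε) (hYε : 10000 / ε ≤ Y) (hs0 : 0 ≤ s) (hs : (s:ℝ) ≤ X / Y^2) (hr : X / Y ≤ r) (hr' : (r:ℝ) ≤ X / Y + 1)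
    (hk : X / 8 - 1 ≤ (k:ℝ)) :
    1 ≤ r ∧ r + 2 * s ≤ k ∧ 4 * (16 * L) * (s:ℝ) / r + 4 * (16 * L) * ((r + 2 * s : ℤ) : ℝ) / ((k - s : ℤ):ℝ) ≤ ε / 2 * L := by
  have hY0 : 0 < Y := by linarith
  have hX0 : 0 < X := by linarith
  have hs0' : (0:ℝ) ≤ s := by exact_mod_cast hs0
  have h1 : X / Y ≤ X / 128 := div_le_div_of_nonneg_left hX0.le (by norm_num) hY
  have h2 : X / Y^2 = X / Y / Y := by field_simp
  have h3 : X / Y^2 ≤ X / Y / 128 := by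
    rw [h2]; exact div_le_div_of_nonneg_left (by positivity) (by norm_num) hY
  have hr1 : (1:ℝ) ≤ r := by linarith
  refine ⟨by exact_mod_cast hr1, ?_, ?_⟩
  · have : (r:ℝ) + 2 * s ≤ k := by linarith
    exact_mod_cast this
  · push_cast
    have a1 : (s:ℝ) / r ≤ 1 / Y := by
      rw [div_le_div_iff₀ (by linarith) hY0]
      have : (s:ℝ) * Y ≤ X / Y := by
        calc (s:ℝ) * Y ≤ X / Y^2 * Y := by gcongr
          _ = X / Y := by field_simp
      linarith
    have a2 : ((r:ℝ) + 2 * s) / (k - s) ≤ 64 / Y := by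
      have b1 : (r:ℝ) + 2 * s ≤ 4 * (X / Y) := by linarith
      have b2 : X / 16 ≤ (k:ℝ) - s := by linarith
      calc ((r:ℝ) + 2 * s) / (k - s) ≤ (4 * (X / Y)) / (X / 16) := by
            apply div_le_div₀ (by positivity) b1 (by positivity) b2
        _ = 64 / Y := by field_simp; norm_num
    have a3 : 1 / Y ≤ ε / 10000 := by
      rw [div_le_iff₀ hε] at hYε
      rw [div_le_div_iff₀ hY0 (by norm_num)]; linarith
    have a4 : 64 / Y ≤ 64 * (ε / 10000) := by
      rw [show (64:ℝ)/Y = 64 * (1/Y) by ring]; gcongr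
    rw [mul_div_assoc, mul_div_assoc]
    calc _ ≤ 4 * (16 * L) * (ε/10000) + 4 * (16 * L) * (64 * (ε/10000)) := by
          apply add_le_add <;> apply mul_le_mul_of_nonneg_left _ (by positivity) <;> linarith
      _ ≤ ε / 2 * L := by nlinarith [mul_nonneg hε.le hL]

theorem regBil (lam δ ε : ℝ) (h0 : 0 < lam) (hδ : 0 < δ) (hlδ : lam + δ < 1) (hε : 0 < ε) :
    ∀ᶠ N : ℕ in atTop, ∀ c ∈ VN N, ∀ u ∈ VN N, u ∈ Bx c ⌊(N:ℝ)^(1-lam-δ)⌋ →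
      bil N (fun w => pc (TT N lam c) c w - pc (SN N lam c) c w) (fun w => pc (TT N lam c) c w - pc (SN N lam c) c w) ≤ ε * Real.log N ∧
      bil N (fun w => pc (TT N lam c) u w - pc (SN N lam u) u w) (fun w => pc (TT N lam c) u w - pc (SN N lam u) u w) ≤ ε * Real.log N ∧
      bil N (fun w => pc (TT N lam c) c w - pc (TT N lam c) u w) (fun w => pc (TT N lam c) c w - pc (TT N lam c) u w) ≤ ε * Real.log N := by
  filter_upwards [genVar lam lam ε h0.le le_rfl (by linarith) hε, crudeN, ev_rpow (1-lam) 64 (by linarith),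
    ev_rpow (δ/2) 128 (by linarith), ev_rpow (δ/2) (10000/ε) (by linarith), ev_rpow (1-lam-δ/2) 1 (by linarith),
    ev_log 1, eventually_ge_atTop 1] with N hgen hcr hX hY hYε hXY hL hN c hc u hu huc
  have hN0 : (0:ℝ) < N := by exact_mod_cast hN
  set X := (N:ℝ)^(1-lam) with hXd
  set Y := (N:ℝ)^(δ/2) with hYd
  set L := Real.log N
  have eXY : (N:ℝ)^(1-lam-δ/2) = X / Y := Real.rpow_sub hN0 _ _
  have eXY2 : (N:ℝ)^(1-lam-δ) = X / Y^2 := by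
    rw [Real.rpow_sub hN0, hYd, ← Real.rpow_natCast, ← Real.rpow_mul hN0.le]; norm_num [hXd]
  rw [eXY] at hXY
  rw [eXY2] at huc
  have hY0 : 0 < Y := by linarith
  have hX0 : 0 < X := by linarith
  have h1 : X / Y ≤ X / 128 := div_le_div_of_nonneg_left hX0.le (by norm_num) hY
  have h2 : X / Y^2 = X / Y / Y := by field_simp
  have h3 : X / Y^2 ≤ X / Y / 128 := by
    rw [h2]; exact div_le_div_of_nonneg_left (by positivity) (by norm_num) hY
  set s := ⌊X / Y^2⌋ with hs
  have hs1 : (s:ℝ) ≤ X / Y^2 := Int.floor_le _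
  have hs0 : 0 ≤ s := Int.floor_nonneg.2 (by positivity)
  set k := ⌊X / 8⌋ with hk
  have hk1 : (k:ℝ) ≤ X/8 := Int.floor_le _
  have hk2 : X/8 - 1 ≤ (k:ℝ) := by have := Int.lt_floor_add_one (X/8); linarith
  have hk32 : ((⌊X/32⌋:ℤ):ℝ) ≤ X/32 := Int.floor_le _
  have hT : ∀ x, x ∈ TT N lam c ↔ x ∈ intr (VN N) ∧ x ∈ Bx c k := fun x => by simp only [TT, Finset.mem_filter, ← hXd, ← hk]
  have hTS : TT N lam c ⊆ SN N lam c := by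
    intro x hx
    rw [hT] at hx
    exact Bx_sub_SN h0.le (by linarith) k (by rw [← hXd]; linarith) hx.2 hx.1
  have hTSu : TT N lam c ⊆ SN N lam u := by
    intro x hx
    rw [hT] at hx
    refine Bx_sub_SN h0.le (by linarith) (k + s) (by rw [← hXd]; push_cast; linarith) ?_ hx.1
    have h5 := hx.2
    rw [mem_Bx] at h5 huc ⊢
    omega
  have hB1 : ∀ x ∈ intr (VN N), x ∈ Bx c ⌊X/32⌋ → x ∈ TT N lam c := by
    intro x hx hxc
    rw [hT]
    refine ⟨hx, ?_⟩
    have : ⌊X/32⌋ ≤ k := Int.floor_le_floor (by linarith)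
    rw [mem_Bx] at hxc ⊢
    omega
  have hB2 : ∀ x ∈ intr (VN N), x ∈ Bx u ⌊X/32⌋ → x ∈ TT N lam c := by
    intro x hx hxc
    rw [hT]
    refine ⟨hx, ?_⟩
    have : ⌊X/32⌋ + s ≤ k := by
      have : ((⌊X/32⌋:ℤ):ℝ) + s ≤ k := by linarith
      exact_mod_cast this
    rw [mem_Bx] at hxc huc ⊢
    omega
  refine ⟨?_, ?_, ?_⟩
  · rw [bil_nested N _ _ hTS (SN_sub_intr hc)]
    have := hgen c hc _ hB1
    simpa using this
  · rw [bil_nested N _ _ hTSu (SN_sub_intr hu)]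
    have := hgen u hu _ hB2
    simpa using this
  · simp only [bil_sub_left, bil_sub_right]
    simp only [bil_pc_pc N _ _ subset_rfl (TT_sub N lam c)]
    obtain ⟨g1, g2, g3⟩ := regArith X Y L ε s ⌈X/Y⌉ k hX hY hXY (by linarith) hε hYε hs0 hs1 (Int.le_ceil _)
      (Int.ceil_lt_add_one _).le hk2
    have key : ∀ x, |QN N (TT N lam c) x u - QN N (TT N lam c) x c| ≤ ε / 2 * L := by
      intro x
      refine le_trans (reg_lemma N (QN N (TT N lam c) x) c u k ⌈X/Y⌉ s (16 * L) (by linarith) ?_ ?_ ?_ hs0 g1 g2 huc ?_ ?_) g3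
      · intro z a1 a2 a3 a4 hz
        exact HS_on ((hT z).2 ⟨mem_intr_VN.2 ⟨a1, a2, a3, a4⟩, hz⟩)
      · intro z hz
        have hz' : z ∉ intr (VN N) := fun h => hz (mem_intr_VN.1 h)
        unfold QN
        rw [HS_off (fun h => hz' (TT_sub _ _ _ h))]
        exact GS_off _ hz'
      · intro z
        rw [abs_of_nonneg]
        · exact HS_le (fun w _ => hcr w x) z
        · exact HS_ge (fun w _ => GS_nonneg _ w x) z
      · have := mem_VN.1 hc; omega
      · have := mem_VN.1 hu; omega
    have k1 := abs_le.1 (key c)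
    have k2 := abs_le.1 (key u)
    linarith [k1.1, k1.2, k2.1, k2.2]

theorem VN_card (N : ℕ) : (VN N).card = (N+1)^2 := by
  unfold VN
  rw [← Finset.Icc_product_Icc, Finset.card_product]
  simp; ring

theorem regEv (lam δ e : ℝ) (h0 : 0 < lam) (hδ : 0 < δ) (hlδ : lam + δ < 1) (he : 0 < e) :
    ∀ᶠ N : ℕ in atTop, ∀ P : Measure FieldSp, IsGFF N P →
      P {ω | ∃ c ∈ VN N, ∃ u ∈ VN N, u ∈ Bx c ⌊(N:ℝ)^(1-lam-δ)⌋ ∧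
        e * Real.log N < Lin N (pc (SN N lam c) c) ω - Lin N (pc (SN N lam u) u) ω} ≤ ENNReal.ofReal ((N:ℝ)^(-1:ℝ)) := by
  set B : ℝ := 21 / e with hB
  have hB0 : 0 < B := by positivity
  filter_upwards [regBil lam δ (2/B^2) h0 hδ hlδ (by positivity), eventually_ge_atTop 48, ev_log 1] with N hr hN hL P hP
  have hN0 : (48:ℝ) ≤ N := by exact_mod_cast hN
  set L := Real.log N
  set E1 : Vtx × Vtx → Set FieldSp := fun p => {ω | e/3 * L < Lin N (fun w => pc (SN N lam p.1) p.1 w - pc (TT N lam p.1) p.1 w) ω}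
  set E2 : Vtx × Vtx → Set FieldSp := fun p => {ω | e/3 * L < Lin N (fun w => pc (TT N lam p.1) p.1 w - pc (TT N lam p.1) p.2 w) ω}
  set E3 : Vtx × Vtx → Set FieldSp := fun p => {ω | e/3 * L < Lin N (fun w => pc (TT N lam p.1) p.2 w - pc (SN N lam p.2) p.2 w) ω}
  set I := (VN N ×ˢ VN N).filter (fun p : Vtx × Vtx => p.2 ∈ Bx p.1 ⌊(N:ℝ)^(1-lam-δ)⌋) with hI
  have hsub : {ω | ∃ c ∈ VN N, ∃ u ∈ VN N, u ∈ Bx c ⌊(N:ℝ)^(1-lam-δ)⌋ ∧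
        e * L < Lin N (pc (SN N lam c) c) ω - Lin N (pc (SN N lam u) u) ω} ⊆ ⋃ p ∈ I, (E1 p ∪ E2 p ∪ E3 p) := by
    rintro ω ⟨c, hc, u, hu, huc, hlt⟩
    simp only [Set.mem_iUnion]
    refine ⟨(c,u), by rw [hI, Finset.mem_filter]; exact ⟨Finset.mk_mem_product hc hu, huc⟩, ?_⟩
    by_contra hcon
    simp only [E1, E2, E3, Set.mem_union, Set.mem_setOf_eq, not_or, not_lt, Lin_sub] at hcon
    obtain ⟨⟨a1, a2⟩, a3⟩ := hcon
    linarith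
  have hexp : B^2 * (2/B^2*L)/2 - B * (e/3*L) = -6 * L := by
    rw [hB]; field_simp; ring
  have hexp' : ENNReal.ofReal (Real.exp (B^2 * (2/B^2*L)/2 - B * (e/3*L))) = ENNReal.ofReal ((N:ℝ)^(-6:ℝ)) := by
    rw [hexp, Real.rpow_def_of_pos (by linarith)]; congr 2; ring
  have hV : 0 ≤ 2/B^2*L := by positivity
  have hp : ∀ p ∈ I, P (E1 p ∪ E2 p ∪ E3 p) ≤ 3 * ENNReal.ofReal ((N:ℝ)^(-6:ℝ)) := by
    intro p hpI
    rw [hI, Finset.mem_filter, Finset.mem_product] at hpI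
    obtain ⟨b1, b2, b3⟩ := hr p.1 hpI.1.1 p.2 hpI.1.2 hpI.2
    have c1 := Lin_chernoff hP _ _ (e/3*L) B (by rw [bil_swap]; exact b1) hV hB0
    have c3 := Lin_chernoff hP _ _ (e/3*L) B b2 hV hB0
    have c2 := Lin_chernoff hP _ _ (e/3*L) B b3 hV hB0
    rw [hexp'] at c1 c2 c3
    calc P (E1 p ∪ E2 p ∪ E3 p) ≤ P (E1 p) + P (E2 p) + P (E3 p) :=
          (measure_union_le _ _).trans (add_le_add_left (measure_union_le _ _) _)
      _ ≤ _ + _ + _ := add_le_add (add_le_add c1 c2) c3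
      _ = _ := by ring
  calc P _ ≤ P (⋃ p ∈ I, (E1 p ∪ E2 p ∪ E3 p)) := measure_mono hsub
    _ ≤ ∑ p ∈ I, P (E1 p ∪ E2 p ∪ E3 p) := measure_biUnion_finset_le _ _
    _ ≤ I.card • (3 * ENNReal.ofReal ((N:ℝ)^(-6:ℝ))) := Finset.sum_le_card_nsmul _ _ _ hp
    _ ≤ ((N+1)^4 : ℕ) • (3 * ENNReal.ofReal ((N:ℝ)^(-6:ℝ))) := by
        apply nsmul_le_nsmul_left (by positivity)
        refine (Finset.card_filter_le _ _).trans ?_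
        rw [Finset.card_product, VN_card]; apply le_of_eq; ring
    _ = ENNReal.ofReal (((N+1)^4 : ℕ) * (3 * (N:ℝ)^(-6:ℝ))) := by
        rw [nsmul_eq_mul, ENNReal.ofReal_mul (by positivity), ENNReal.ofReal_mul (by positivity), ENNReal.ofReal_natCast]
        norm_num
    _ ≤ ENNReal.ofReal ((N:ℝ)^(-1:ℝ)) := by
        apply ENNReal.ofReal_le_ofReal
        have hNp : (0:ℝ) < N := by linarith
        rw [Real.rpow_neg hNp.le, Real.rpow_neg hNp.le, Real.rpow_one,
          show (6:ℝ) = ((6:ℕ):ℝ) by norm_num, Real.rpow_natCast]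
        push_cast
        rw [← div_eq_mul_inv, mul_div_assoc', inv_eq_one_div, div_le_div_iff₀ (by positivity) hNp]
        have h1 : ((N:ℝ)+1)^4 ≤ (2*N)^4 := by gcongr; linarith
        calc ((N:ℝ)+1)^4*3*N ≤ (2*N)^4*3*N := by gcongr
          _ = 48 * (N:ℝ)^5 := by ring
          _ ≤ N * (N:ℝ)^5 := by gcongr
          _ = 1 * (N:ℝ)^6 := by ring

end GReg

noncomputable section GCount

/-- Coarse-graining representative. -/
def rep (q : ℤ) (v : Vtx) : Vtx := (q * (v.1 / q), q * (v.2 / q))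

theorem rep_one (v : Vtx) : rep 1 v = v := by simp [rep]

theorem rep_bd {q : ℤ} (hq : 1 ≤ q) (x : ℤ) : q * (x / q) ≤ x ∧ x ≤ q * (x / q) + (q - 1) := by
  have h1 := Int.mul_ediv_add_emod x q
  have h2 := Int.emod_nonneg x (by omega : q ≠ 0)
  have h3 := Int.emod_lt_of_pos x (by omega : 0 < q)
  omega

theorem rep_mem {N : ℕ} {q : ℤ} (hq : 1 ≤ q) {v : Vtx} (hv : v ∈ VN N) : rep q v ∈ VN N := by
  rw [mem_VN] at hv ⊢
  have h1 := rep_bd hq v.1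
  have h2 := rep_bd hq v.2
  have h3 : 0 ≤ q * (v.1 / q) := mul_nonneg (by omega) (Int.ediv_nonneg hv.1.1 (by omega))
  have h4 : 0 ≤ q * (v.2 / q) := mul_nonneg (by omega) (Int.ediv_nonneg hv.2.1 (by omega))
  simp only [rep]
  omega

theorem rep_Bx {q : ℤ} (hq : 1 ≤ q) (v : Vtx) {k : ℤ} (hk : q - 1 ≤ k) : rep q v ∈ Bx v k := by
  rw [mem_Bx]
  have h1 := rep_bd hq v.1
  have h2 := rep_bd hq v.2
  simp only [rep]
  omega

theorem not_AN {N : ℕ} {ρ : ℝ} {v : Vtx} (hv : v ∈ VN N \ AN N ρ) :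
    ((v.1:ℝ) < (N:ℝ)^(1-ρ) ∨ (N:ℝ) - (N:ℝ)^(1-ρ) < v.1) ∨ ((v.2:ℝ) < (N:ℝ)^(1-ρ) ∨ (N:ℝ) - (N:ℝ)^(1-ρ) < v.2) := by
  rw [Finset.mem_sdiff] at hv
  obtain ⟨hv1, hv2⟩ := hv
  unfold AN at hv2
  rw [Finset.mem_filter] at hv2
  push Not at hv2
  obtain ⟨z, hz, hlt⟩ := hv2 hv1
  rw [mem_VN] at hz
  set X := (N:ℝ)^(1-ρ)
  have a1 : |(v.1:ℝ) - z.1| < X := lt_of_le_of_lt (Real.abs_le_sqrt (by nlinarith [sq_nonneg ((v.2:ℝ)-z.2)])) hlt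
  have a2 : |(v.2:ℝ) - z.2| < X := lt_of_le_of_lt (Real.abs_le_sqrt (by nlinarith [sq_nonneg ((v.1:ℝ)-z.1)])) hlt
  rw [abs_lt] at a1 a2
  by_cases h1 : z.1 < 0
  · have : (z.1:ℝ) < 0 := by exact_mod_cast h1
    left; left; linarith
  by_cases h2 : (N:ℤ) < z.1
  · have : (N:ℝ) < z.1 := by exact_mod_cast h2
    left; right; linarith
  by_cases h3 : z.2 < 0
  · have : (z.2:ℝ) < 0 := by exact_mod_cast h3
    right; left; linarith
  by_cases h4 : (N:ℤ) < z.2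
  · have : (N:ℝ) < z.2 := by exact_mod_cast h4
    right; right; linarith
  exfalso; apply hz; omega

theorem zero_bd {N : ℕ} {ρ : ℝ} (h : 1 < (N:ℝ)^(1-ρ)) : ((0,0):Vtx) ∈ VN N \ AN N ρ := by
  rw [Finset.mem_sdiff]
  refine ⟨by rw [mem_VN]; simp, ?_⟩
  unfold AN
  rw [Finset.mem_filter]
  rintro ⟨_, h2⟩
  have := h2 (-1, 0) (by rw [mem_VN]; simp)
  norm_num at this
  linarith

theorem card_Icc_le {a b : ℤ} {A : ℝ} (h : (b:ℝ) - a + 1 ≤ A) (hA : 0 ≤ A) : ((Finset.Icc a b).card : ℝ) ≤ A := by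
  rw [Int.card_Icc]
  rcases le_total (b + 1 - a) 0 with h1 | h1
  · rw [Int.toNat_of_nonpos h1]; simpa using hA
  · have : (((b + 1 - a).toNat : ℤ) : ℝ) = ((b + 1 - a : ℤ) : ℝ) := by rw [Int.toNat_of_nonneg h1]
    rw [Int.cast_natCast] at this
    rw [this]; push_cast; linarith

theorem countQ {N : ℕ} {ρ : ℝ} {q : ℤ} (hq : 1 ≤ q) (hqX : (q:ℝ) ≤ (N:ℝ)^(1-ρ)) (hqN : (q:ℝ) ≤ N) :
    (((VN N \ AN N ρ).image (rep q)).card : ℝ) ≤ 24 * ((N:ℝ)^(1-ρ) * N / (q:ℝ)^2) := by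
  set X := (N:ℝ)^(1-ρ) with hX
  have hq0 : (0:ℝ) < q := by exact_mod_cast (by omega : (0:ℤ) < q)
  set F := Finset.Icc (0:ℤ) ⌊(N:ℝ)/q⌋
  set I1 := Finset.Icc (0:ℤ) ⌊X/q⌋
  set I2 := Finset.Icc ⌊((N:ℝ)-X)/q⌋ ⌊(N:ℝ)/q⌋
  have hfl : ∀ {x : ℤ} {y : ℝ}, (x:ℝ) ≤ y → x / q ≤ ⌊y / q⌋ := by
    intro x y hxy
    rw [Int.le_floor]
    have h1 := (rep_bd hq x).1
    have h2 : (q:ℝ) * ((x/q : ℤ):ℝ) ≤ x := by exact_mod_cast h1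
    rw [le_div_iff₀ hq0]; linarith
  have hfl2 : ∀ {x : ℤ} {y : ℝ}, y ≤ (x:ℝ) → ⌊y / q⌋ ≤ x / q := by
    intro x y hxy
    have h1 := (rep_bd hq x).2
    have h2 : (x:ℝ) ≤ (q:ℝ) * ((x/q : ℤ):ℝ) + (q - 1) := by exact_mod_cast h1
    rw [← Int.lt_add_one_iff, Int.floor_lt]
    rw [div_lt_iff₀ hq0]; push_cast; nlinarith
  have hsub : (VN N \ AN N ρ).image (rep q) ⊆ (((I1 ∪ I2) ×ˢ F) ∪ (F ×ˢ (I1 ∪ I2))).image (fun p : ℤ × ℤ => ((q * p.1, q * p.2) : Vtx)) := by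
    intro w hw
    rw [Finset.mem_image] at hw ⊢
    obtain ⟨v, hv, rfl⟩ := hw
    refine ⟨(v.1/q, v.2/q), ?_, rfl⟩
    have hb := not_AN hv
    have hv' := mem_VN.1 (Finset.mem_sdiff.1 hv).1
    have e1 : 0 ≤ v.1 / q := Int.ediv_nonneg hv'.1.1 (by omega)
    have e2 : 0 ≤ v.2 / q := Int.ediv_nonneg hv'.2.1 (by omega)
    have e3 : v.1 / q ≤ ⌊(N:ℝ)/q⌋ := hfl (by exact_mod_cast hv'.1.2)
    have e4 : v.2 / q ≤ ⌊(N:ℝ)/q⌋ := hfl (by exact_mod_cast hv'.2.2)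
    simp only [Finset.mem_union, Finset.mem_product, I1, I2, F, Finset.mem_Icc]
    rcases hb with (h | h) | (h | h)
    · left; exact ⟨Or.inl ⟨e1, hfl h.le⟩, e2, e4⟩
    · left; exact ⟨Or.inr ⟨hfl2 h.le, e3⟩, e2, e4⟩
    · right; exact ⟨⟨e1, e3⟩, Or.inl ⟨e2, hfl h.le⟩⟩
    · right; exact ⟨⟨e1, e3⟩, Or.inr ⟨hfl2 h.le, e4⟩⟩
  have x1 : 1 ≤ X / q := by rw [le_div_iff₀ hq0]; linarith
  have x2 : 1 ≤ (N:ℝ) / q := by rw [le_div_iff₀ hq0]; linarith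
  have cF : (F.card : ℝ) ≤ 2 * (N/q) := card_Icc_le (by have := Int.floor_le ((N:ℝ)/q); push_cast; linarith) (by linarith)
  have cI1 : (I1.card : ℝ) ≤ 2 * (X/q) := card_Icc_le (by have := Int.floor_le (X/q); push_cast; linarith) (by linarith)
  have cI2 : (I2.card : ℝ) ≤ 3 * (X/q) := card_Icc_le (by
    have := Int.floor_le ((N:ℝ)/q)
    have h2 := Int.lt_floor_add_one (((N:ℝ)-X)/q)
    rw [sub_div] at h2
    rw [sub_div]; linarith) (by linarith)
  have c1 : (((I1 ∪ I2).card : ℕ) : ℝ) ≤ 6 * (X/q) := by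
    have : (((I1 ∪ I2).card : ℕ) : ℝ) ≤ I1.card + I2.card := by exact_mod_cast Finset.card_union_le _ _
    linarith
  calc (((VN N \ AN N ρ).image (rep q)).card : ℝ)
      ≤ ((((I1 ∪ I2) ×ˢ F) ∪ (F ×ˢ (I1 ∪ I2))).card : ℝ) := by
        exact_mod_cast (Finset.card_le_card hsub).trans Finset.card_image_le
    _ ≤ (((I1 ∪ I2) ×ˢ F).card : ℝ) + ((F ×ˢ (I1 ∪ I2)).card : ℝ) := by exact_mod_cast Finset.card_union_le _ _
    _ = 2 * (((I1 ∪ I2).card : ℝ) * F.card) := by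
        rw [Finset.card_product, Finset.card_product]; push_cast; ring
    _ ≤ 2 * (6 * (X/q) * (2 * (N/q))) := by gcongr
    _ = 24 * (X * N / (q:ℝ)^2) := by field_simp; ring

/-- Mesh size. -/
def qq (N : ℕ) (lam δ : ℝ) : ℤ := ⌈(N:ℝ)^(1-lam-δ)⌉

theorem qq_ge {N : ℕ} (hN : 1 ≤ N) (lam δ : ℝ) : 1 ≤ qq N lam δ := by
  have hN0 : (0:ℝ) < N := by exact_mod_cast hN
  exact Int.one_le_ceil_iff.2 (Real.rpow_pos_of_pos hN0 _)

theorem qq_one {N : ℕ} (hN : 1 ≤ N) {δ : ℝ} (hδ : 0 ≤ δ) : qq N 1 δ = 1 := by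
  apply le_antisymm _ (qq_ge hN _ _)
  unfold qq
  rw [Int.ceil_le]
  push_cast
  exact Real.rpow_le_one_of_one_le_of_nonpos (by exact_mod_cast hN) (by linarith)

theorem countLem (ρ lam δ : ℝ) (hρ : 0 < ρ) (hρl : ρ < lam) (hl : lam ≤ 1) (hδ : 0 < δ) :
    ∀ᶠ N : ℕ in atTop, (((VN N \ AN N ρ).image (rep (qq N lam δ))).card : ℝ) ≤ 24 * (N:ℝ)^(2*lam+2*δ-ρ) := by
  filter_upwards [ev_rpow (lam - ρ + δ) 2 (by linarith), ev_rpow (1-ρ) 2 (by linarith), eventually_ge_atTop 1] with N h1 h2 hN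
  have hN1 : (1:ℝ) ≤ N := by exact_mod_cast hN
  have hN0 : (0:ℝ) < N := by linarith
  have hy : 0 < (N:ℝ)^(1-lam-δ) := Real.rpow_pos_of_pos hN0 _
  have hq := qq_ge hN lam δ
  have hqge : (N:ℝ)^(1-lam-δ) ≤ qq N lam δ := Int.le_ceil _
  have hXN : (N:ℝ)^(1-ρ) ≤ N := by
    conv_rhs => rw [← Real.rpow_one (N:ℝ)]
    exact Real.rpow_le_rpow_of_exponent_le hN1 (by linarith)
  have hqX : (qq N lam δ : ℝ) ≤ (N:ℝ)^(1-ρ) := by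
    rcases le_total ((N:ℝ)^(1-lam-δ)) 1 with h | h
    · have : qq N lam δ ≤ 1 := by unfold qq; rw [Int.ceil_le]; exact_mod_cast h
      have : (qq N lam δ : ℝ) ≤ 1 := by exact_mod_cast this
      linarith
    · have := (Int.ceil_lt_add_one ((N:ℝ)^(1-lam-δ))).le
      have e : (N:ℝ)^(1-ρ) = (N:ℝ)^(1-lam-δ) * (N:ℝ)^(lam-ρ+δ) := by
        rw [← Real.rpow_add hN0]; congr 1; ring
      unfold qq
      rw [e]; nlinarith
  refine (countQ hq hqX (hqX.trans hXN)).trans ?_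
  apply mul_le_mul_of_nonneg_left _ (by norm_num)
  calc (N:ℝ)^(1-ρ) * N / (qq N lam δ:ℝ)^2 ≤ (N:ℝ)^(1-ρ) * N / ((N:ℝ)^(1-lam-δ))^2 := by gcongr
    _ = (N:ℝ)^(2*lam+2*δ-ρ) := by
      rw [div_eq_iff (by positivity), ← Real.rpow_natCast, ← Real.rpow_mul hN0.le, ← Real.rpow_add hN0]
      conv_lhs => rw [← Real.rpow_add_one hN0.ne']
      congr 1; push_cast; ring

end GCount

noncomputable section GDet

open MeasureTheory

theorem knot_mono {n : ℕ} {κ : ℕ → ℝ} (hinc : ∀ i, i < n → κ i < κ (i+1)) {i j : ℕ} (hij : i ≤ j) (hj : j ≤ n) :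
    κ i ≤ κ j := by
  induction j, hij using Nat.le_induction with
  | base => exact le_rfl
  | succ j hij ih => exact (ih (by omega)).trans (hinc j (by omega)).le

theorem knot_lt {n : ℕ} {κ : ℕ → ℝ} (hinc : ∀ i, i < n → κ i < κ (i+1)) {i j : ℕ} (hij : i < j) (hj : j ≤ n) :
    κ i < κ j := (hinc i (by omega)).trans_le (knot_mono hinc hij hj)

theorem knot_find {n : ℕ} {κ : ℕ → ℝ} {s : ℝ} (h0 : κ 0 < s) (h1 : s ≤ κ n) :
    ∃ i, i < n ∧ κ i < s ∧ s ≤ κ (i+1) := by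
  induction n with
  | zero => linarith
  | succ n ih =>
    rcases le_or_gt s (κ n) with h | h
    · obtain ⟨i, a, b⟩ := ih h; exact ⟨i, by omega, b⟩
    · exact ⟨n, by omega, h, h1⟩

theorem stepInt {n : ℕ} {κ c : ℕ → ℝ} {f : ℝ → ℝ} (h0 : κ 0 = 0) (hinc : ∀ i, i < n → κ i < κ (i+1))
    (hf : ∀ i ∈ Finset.Icc 1 n, ∀ s, κ (i-1) < s → s ≤ κ i → f s = c i) :
    ∀ i, i < n → ∀ s, κ i ≤ s → s ≤ κ (i+1) → IntervalIntegrable f volume 0 s ∧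
      ∫ r in (0:ℝ)..s, f r = ∑ j ∈ Finset.Icc 1 i, c j * (κ j - κ (j-1)) + c (i+1) * (s - κ i) := by
  have blk : ∀ i, i < n → ∀ s, κ i ≤ s → s ≤ κ (i+1) → IntervalIntegrable f volume (κ i) s ∧
      ∫ r in (κ i)..s, f r = c (i+1) * (s - κ i) := by
    intro i hi s h1 h2
    have e : Set.EqOn f (fun _ => c (i+1)) (Set.uIoc (κ i) s) := by
      intro t ht
      rw [Set.uIoc_of_le h1] at ht
      exact hf (i+1) (by simp; omega) t (by simpa using ht.1) (ht.2.trans h2)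
    constructor
    · exact (intervalIntegrable_congr e).2 intervalIntegrable_const
    · rw [intervalIntegral.integral_congr_ae (ae_of_all _ fun x hx => e hx), intervalIntegral.integral_const, smul_eq_mul, mul_comm]
  intro i
  induction i with
  | zero =>
    intro hi s h1 h2
    have := blk 0 hi s h1 h2
    rw [h0] at this
    simpa [h0] using this
  | succ i ih =>
    intro hi s h1 h2
    obtain ⟨a1, a2⟩ := ih (by omega) (κ (i+1)) (hinc i (by omega)).le le_rfl
    obtain ⟨b1, b2⟩ := blk (i+1) hi s h1 h2
    refine ⟨a1.trans b1, ?_⟩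
    rw [← intervalIntegral.integral_add_adjacent_intervals a1 b1, a2, b2, Finset.sum_Icc_succ_top (by omega)]
    simp

theorem hull_ge {f : ℝ → ℝ} {C : ℝ} (hC : ∀ t ∈ Set.Icc (0:ℝ) 1, f t ≤ C) {s : ℝ} (hs : s ∈ Set.Icc (0:ℝ) 1) :
    f s ≤ concaveHull f s := by
  apply le_csInf
  · exact ⟨C, fun _ => C, concaveOn_const _ (convex_Icc 0 1), hC, rfl⟩
  · rintro y ⟨g, _, h2, rfl⟩; exact h2 s hs

theorem hull_le {f g : ℝ → ℝ} (hg : ConcaveOn ℝ (Set.Icc (0:ℝ) 1) g) (hfg : ∀ t ∈ Set.Icc (0:ℝ) 1, f t ≤ g t)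
    {s : ℝ} (hs : s ∈ Set.Icc (0:ℝ) 1) : concaveHull f s ≤ g s := by
  apply csInf_le
  · refine ⟨f s, ?_⟩; rintro y ⟨g, _, h2, rfl⟩; exact h2 s hs
  · exact ⟨g, hg, hfg, rfl⟩

theorem stepFn_val {M : ℕ} {sigv lamv : ℕ → ℝ} (hp : ScaleParams M sigv lamv) {i : ℕ} (hi : i ∈ Finset.Icc 1 M) {s : ℝ}
    (h1 : lamv (i-1) < s) (h2 : s ≤ lamv i) : stepFn M sigv lamv s = sigv i := by
  obtain ⟨hM, -, l0, l1, hinc⟩ := hp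
  rw [Finset.mem_Icc] at hi
  have hs : 0 < s := by
    have := knot_mono hinc (Nat.zero_le (i-1)) (by omega)
    linarith
  unfold stepFn
  rw [if_neg hs.ne', zero_add, Finset.sum_eq_single i]
  · rw [if_pos ⟨h1, h2⟩]
  · intro j hj hji
    rw [Finset.mem_Icc] at hj
    rw [if_neg]
    rintro ⟨a, b⟩
    rcases lt_or_gt_of_ne hji with h | h
    · have := knot_mono hinc (show j ≤ i - 1 by omega) (by omega); linarith
    · have := knot_mono hinc (show i ≤ j - 1 by omega) (by omega); linarith
  · intro h; exact absurd (Finset.mem_Icc.2 hi) h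

theorem J_blk {M : ℕ} {sigv lamv : ℕ → ℝ} (hp : ScaleParams M sigv lamv) : ∀ i, i < M → ∀ s, lamv i ≤ s → s ≤ lamv (i+1) →
    IntervalIntegrable (fun r => (stepFn M sigv lamv r)^2) volume 0 s ∧
      Jsig2 M sigv lamv s = ∑ j ∈ Finset.Icc 1 i, sigv j ^ 2 * (lamv j - lamv (j-1)) + sigv (i+1)^2 * (s - lamv i) := by
  have := stepInt (c := fun i => sigv i ^ 2) (f := fun r => (stepFn M sigv lamv r)^2) hp.2.2.1 hp.2.2.2.2
    (fun i hi s h1 h2 => by simp only [stepFn_val hp hi h1 h2])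
  exact this

end GDet

noncomputable section GKink

open MeasureTheory

theorem kinkEq {J : ℝ → ℝ} {x a b C : ℝ} (hC : ∀ t ∈ Set.Icc (0:ℝ) 1, J t ≤ C) (hx0 : 0 < x) (hx1 : x < 1) (hab : b < a)
    (hcont : ContinuousOn J (Set.Icc 0 1))
    (h1 : ∀ s, x ≤ s → s ≤ 1 → J s ≤ concaveHull J x + b * (s - x))
    (h2 : ∀ s, 0 ≤ s → s ≤ x → J s ≤ concaveHull J x + a * (s - x)) : J x = concaveHull J x := by
  have hxI : x ∈ Set.Icc (0:ℝ) 1 := ⟨hx0.le, hx1.le⟩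
  apply le_antisymm (hull_ge hC hxI)
  by_contra hlt
  push Not at hlt
  set hx := concaveHull J x
  set k := (a+b)/2 with hk
  have hc : ContinuousWithinAt (fun s => J s - k * (s - x)) (Set.Icc 0 1) x := by
    apply ContinuousWithinAt.sub (hcont x hxI); fun_prop
  have := hc.eventually_lt_const (u := (J x + hx)/2) (by simp; linarith)
  rw [Filter.Eventually, Metric.mem_nhdsWithin_iff] at this
  obtain ⟨r, hr, hball⟩ := this
  have hd : 0 < (a-b)/2 := by linarith
  set ε := min ((hx - J x)/2) ((a-b)/2*r) with hε
  have hε0 : 0 < ε := lt_min (by linarith) (by positivity)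
  have e1 : ε ≤ (hx - J x)/2 := min_le_left _ _
  have e2 : ε ≤ (a-b)/2*r := min_le_right _ _
  have key : hx ≤ hx - ε + k * (x - x) := by
    refine hull_le (g := fun s => hx - ε + k * (s - x)) ?_ ?_ hxI
    · refine ⟨convex_Icc 0 1, ?_⟩
      intro y _ z _ p q _ _ hpq
      simp only [smul_eq_mul]
      apply le_of_eq
      have : p = 1 - q := by linarith
      rw [this]; ring
    · intro s hs
      rcases lt_or_ge |s - x| r with h | h
      · have := hball ⟨by rw [Metric.mem_ball, Real.dist_eq]; exact h, hs⟩
        have h3 : J s - k * (s - x) < (J x + hx)/2 := this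
        linarith
      · rcases le_total x s with h4 | h4
        · rw [abs_of_nonneg (by linarith)] at h
          have := h1 s h4 hs.2
          rw [hk]; nlinarith
        · rw [abs_of_nonpos (by linarith)] at h
          have := h2 s hs.1 h4
          rw [hk]; nlinarith
  simp at key; linarith

theorem kinks {M : ℕ} {sigv lamv : ℕ → ℝ} (hp : ScaleParams M sigv lamv) {m : ℕ} {sigb lamb : ℕ → ℝ} {sigbar : ℝ → ℝ}
    (he : EffParams M sigv lamv m sigb lamb sigbar) :
    ∀ l, l ≤ m → ∃ i, i ≤ M ∧ lamv i = lamb l ∧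
      ∑ j ∈ Finset.Icc 1 i, sigv j ^ 2 * (lamv j - lamv (j-1)) = ∑ j ∈ Finset.Icc 1 l, sigb j ^ 2 * (lamb j - lamb (j-1)) := by
  have hp' := hp
  obtain ⟨hM, hσ, l0, l1, hinc⟩ := hp
  obtain ⟨hm1, hmM, b0, b1, binc, bdec, bpos, bz, bval, bhull⟩ := he
  have hJ := J_blk hp'
  have hHb := stepInt (c := fun i => sigb i ^ 2) (f := fun r => (sigbar r)^2) b0 binc
    (fun i hi s h1 h2 => by simp only [bval i hi s h1 h2])
  set J := Jsig2 M sigv lamv with hJd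
  -- values at knots
  have hJknot : ∀ i, i ≤ M → J (lamv i) = ∑ j ∈ Finset.Icc 1 i, sigv j ^ 2 * (lamv j - lamv (j-1)) := by
    intro i hi
    rcases Nat.lt_or_ge i M with h | h
    · rw [(hJ i h (lamv i) le_rfl (hinc i h).le).2]; ring
    · obtain ⟨i, rfl⟩ : ∃ j, i = j + 1 := ⟨i - 1, by omega⟩
      rw [(hJ i (by omega) (lamv (i+1)) (hinc i (by omega)).le le_rfl).2, Finset.sum_Icc_succ_top (by omega)]; simp
  have hHknot : ∀ l, 1 ≤ l → l ≤ m → concaveHull J (lamb l) = ∑ j ∈ Finset.Icc 1 l, sigb j ^ 2 * (lamb j - lamb (j-1)) := by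
    intro l h1 h2
    obtain ⟨l, rfl⟩ : ∃ j, l = j + 1 := ⟨l - 1, by omega⟩
    have p0 : 0 < lamb (l+1) := by rw [← b0]; exact knot_lt binc (by omega) h2
    have p1 : lamb (l+1) ≤ 1 := by rw [← b1]; exact knot_mono binc h2 le_rfl
    rw [bhull _ p0 p1, (hHb l (by omega) (lamb (l+1)) (binc l (by omega)).le le_rfl).2, Finset.sum_Icc_succ_top (by omega)]; simp
  -- integrability, monotonicity, continuity
  have hint : IntervalIntegrable (fun r => (stepFn M sigv lamv r)^2) volume 0 1 := by
    obtain ⟨i, rfl⟩ : ∃ j, M = j + 1 := ⟨M - 1, by omega⟩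
    exact (hJ i (by omega) 1 (by rw [← l1]; exact (hinc i (by omega)).le) l1.ge).1
  have hintH : IntervalIntegrable (fun r => (sigbar r)^2) volume 0 1 := by
    obtain ⟨i, rfl⟩ : ∃ j, m = j + 1 := ⟨m - 1, by omega⟩
    exact (hHb i (by omega) 1 (by rw [← b1]; exact (binc i (by omega)).le) b1.ge).1
  have hsubi : ∀ {f : ℝ → ℝ}, IntervalIntegrable f volume 0 1 → ∀ {s t : ℝ}, 0 ≤ s → s ≤ t → t ≤ 1 → IntervalIntegrable f volume s t := by
    intro f hf s t h1 h2 h3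
    apply hf.mono_set
    rw [Set.uIcc_of_le h2, Set.uIcc_of_le zero_le_one]
    exact Set.Icc_subset_Icc h1 h3
  have hJmono : ∀ t ∈ Set.Icc (0:ℝ) 1, J t ≤ J 1 := by
    intro t ht
    have e : J 1 = J t + ∫ r in t..1, (stepFn M sigv lamv r)^2 :=
      (intervalIntegral.integral_add_adjacent_intervals (hsubi hint le_rfl ht.1 ht.2) (hsubi hint ht.1 ht.2 le_rfl)).symm
    have := intervalIntegral.integral_nonneg (μ := volume) (f := fun r => (stepFn M sigv lamv r)^2) ht.2 (fun u _ => sq_nonneg _)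
    linarith
  have hcont : ContinuousOn J (Set.Icc 0 1) := by
    have := intervalIntegral.continuousOn_primitive_interval (μ := volume) (f := fun r => (stepFn M sigv lamv r)^2) (a := 0) (b := 1)
      (by rw [Set.uIcc_of_le zero_le_one]; exact (intervalIntegrable_iff_integrableOn_Icc_of_le zero_le_one).1 hint)
    rwa [Set.uIcc_of_le zero_le_one] at this
  have hJ0 : J 0 = 0 := by simp [hJd, Jsig2, Jint]
  -- J ≤ H
  have hJH : ∀ s, 0 ≤ s → s ≤ 1 → J s ≤ ∫ r in (0:ℝ)..s, (sigbar r)^2 := by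
    intro s h1 h2
    rcases h1.eq_or_lt with rfl | h
    · simp [hJ0]
    · rw [← bhull s h h2]; exact hull_ge hJmono ⟨h1, h2⟩
  have hsm : ∀ i j, 1 ≤ i → i ≤ j → j ≤ m → sigb j ≤ sigb i := by
    intro i j h1 h2 h3
    induction j, h2 using Nat.le_induction with
    | base => exact le_rfl
    | succ j hij ih => exact (bdec j (by omega) (by omega)).le.trans (ih (by omega))
  intro l hl
  rcases Nat.eq_zero_or_pos l with rfl | hl0
  · exact ⟨0, by omega, by rw [l0, b0], by simp⟩
  rcases hl.eq_or_lt with rfl | hlm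
  · refine ⟨M, le_rfl, by rw [l1, b1], ?_⟩
    rw [← hJknot M le_rfl, ← hHknot l hl0 le_rfl, l1, b1]
    apply le_antisymm (hull_ge hJmono ⟨zero_le_one, le_rfl⟩)
    exact hull_le (g := fun _ => J 1) (concaveOn_const _ (convex_Icc 0 1)) hJmono ⟨zero_le_one, le_rfl⟩
  -- interior kink
  set x := lamb l with hx
  have hx0 : 0 < x := by rw [← b0]; exact knot_lt binc hl0 hl
  have hx1 : x < 1 := by rw [← b1]; exact knot_lt binc hlm le_rfl
  have pos : ∀ j, 1 ≤ j → j ≤ m → 0 < sigb j := fun j h1 h2 => bpos j (Finset.mem_Icc.2 ⟨h1, h2⟩)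
  have hR : ∀ s, x ≤ s → s ≤ 1 → J s ≤ concaveHull J x + sigb (l+1) ^ 2 * (s - x) := by
    intro s h1 h2
    refine (hJH s (by linarith) h2).trans ?_
    rw [bhull x hx0 hx1.le, ← intervalIntegral.integral_add_adjacent_intervals (hsubi hintH le_rfl hx0.le hx1.le) (hsubi hintH hx0.le h1 h2)]
    have := intervalIntegral.integral_mono_on_of_le_Ioo (μ := volume) (f := fun r => (sigbar r)^2) (g := fun _ => sigb (l+1)^2) h1
      (hsubi hintH hx0.le h1 h2) intervalIntegrable_const (by
        intro t ht
        obtain ⟨j, j1, j2, j3⟩ := knot_find (n := m) (κ := lamb) (s := t) (by rw [b0]; linarith [ht.1]) (by rw [b1]; linarith [ht.2])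
        rw [bval (j+1) (by simp; omega) t (by simpa using j2) j3]
        have : l < j + 1 := by
          by_contra hcon
          have := knot_mono binc (show j + 1 ≤ l by omega) hl
          linarith [ht.1]
        exact pow_le_pow_left₀ (pos _ (by omega) (by omega)).le (hsm _ _ (by omega) (by omega) (by omega)) 2)
    rw [intervalIntegral.integral_const, smul_eq_mul] at this
    linarith
  have hLf : ∀ s, 0 ≤ s → s ≤ x → J s ≤ concaveHull J x + sigb l ^ 2 * (s - x) := by
    intro s h1 h2
    refine (hJH s h1 (by linarith)).trans ?_
    rw [bhull x hx0 hx1.le, ← intervalIntegral.integral_add_adjacent_intervals (hsubi hintH le_rfl h1 (by linarith)) (hsubi hintH h1 h2 hx1.le)]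
    have := intervalIntegral.integral_mono_on_of_le_Ioo (μ := volume) (g := fun r => (sigbar r)^2) (f := fun _ => sigb l^2) h2
      intervalIntegrable_const (hsubi hintH h1 h2 hx1.le) (by
        intro t ht
        obtain ⟨j, j1, j2, j3⟩ := knot_find (n := m) (κ := lamb) (s := t) (by rw [b0]; linarith [ht.1]) (by rw [b1]; linarith [ht.2])
        rw [bval (j+1) (by simp; omega) t (by simpa using j2) j3]
        have : j + 1 ≤ l := by
          by_contra hcon
          have := knot_mono binc (show l ≤ j by omega) (by omega)
          linarith [ht.2]
        exact pow_le_pow_left₀ (pos _ (by omega) (by omega)).le (hsm _ _ (by omega) (by omega) (by omega)) 2)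
    rw [intervalIntegral.integral_const, smul_eq_mul] at this
    linarith
  have hab : sigb (l+1)^2 < sigb l^2 := pow_lt_pow_left₀ (bdec l hl0 hlm) (pos _ (by omega) (by omega)).le (by norm_num)
  have hJx := kinkEq hJmono hx0 hx1 hab hcont hR hLf
  obtain ⟨i, i1, i2, i3⟩ := knot_find (n := M) (κ := lamv) (s := x) (by rw [l0]; exact hx0) (by rw [l1]; exact hx1.le)
  have hxi : lamv (i+1) = x := by
    by_contra hne
    have i4 : x < lamv (i+1) := lt_of_le_of_ne i3 (Ne.symm hne)
    have li0 : 0 ≤ lamv i := by rw [← l0]; exact knot_mono hinc (by omega) i1.le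
    have li1 : lamv (i+1) ≤ 1 := by rw [← l1]; exact knot_mono hinc (by omega) le_rfl
    have q1 := hLf (lamv i) li0 i2.le
    have q2 := hR (lamv (i+1)) i4.le li1
    rw [(hJ i i1 _ le_rfl (hinc i i1).le).2, ← hJx, (hJ i i1 x i2.le i3).2] at q1
    rw [(hJ i i1 _ (hinc i i1).le le_rfl).2, ← hJx, (hJ i i1 x i2.le i3).2] at q2
    have r1 : sigb l ^2 ≤ sigv (i+1)^2 := by
      have : sigb l ^2 * (x - lamv i) ≤ sigv (i+1)^2 * (x - lamv i) := by linarith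
      exact le_of_mul_le_mul_right this (by linarith)
    have r2 : sigv (i+1)^2 ≤ sigb (l+1)^2 := by
      have : sigv (i+1)^2 * (lamv (i+1) - x) ≤ sigb (l+1)^2 * (lamv (i+1) - x) := by linarith
      exact le_of_mul_le_mul_right this (by linarith)
    linarith
  refine ⟨i+1, by omega, hxi, ?_⟩
  rw [← hJknot (i+1) (by omega), ← hHknot l hl0 hl, hxi, hJx]

end GKink

noncomputable section GTheta

theorem Icc_Ioc (n : ℕ) : Finset.Icc 1 n = Finset.Ioc 0 n := by ext; simp; omega

theorem tele (κ : ℕ → ℝ) {a b : ℕ} (h : a ≤ b) : ∑ j ∈ Finset.Ioc a b, (κ j - κ (j-1)) = κ b - κ a := by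
  induction b, h using Nat.le_induction with
  | base => simp
  | succ b hb ih => rw [Finset.sum_Ioc_succ_top (by omega), ih]; simp

theorem fpsi_eq {m : ℕ} {sigb lamb : ℕ → ℝ} {β : ℝ} (hβ : 0 < β) (hm : 1 ≤ m) (bdec : ∀ l, 1 ≤ l → l < m → sigb (l + 1) < sigb l)
    (bpos : ∀ l ∈ Finset.Icc 1 m, 0 < sigb l) :
    ∑ j ∈ Finset.Icc 1 m, (β^2 * sigb j^2 / max 1 (β * sigb j / 2) / 2 + 2 * max 1 (β * sigb j / 2)) * (lamb j - lamb (j-1)) =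
      2 * fpsiLim m sigb lamb β := by
  have hsm : ∀ i j, 1 ≤ i → i ≤ j → j ≤ m → sigb j ≤ sigb i := by
    intro i j h1 h2 h3
    induction j, h2 using Nat.le_induction with
    | base => exact le_rfl
    | succ j hij ih => exact (bdec j (by omega) (by omega)).le.trans (ih (by omega))
  have pos : ∀ j, 1 ≤ j → j ≤ m → 0 < sigb j := fun j h1 h2 => bpos j (Finset.mem_Icc.2 ⟨h1, h2⟩)
  set n := lbeta m sigb β with hn
  have A : 1 ≤ n ∧ n ≤ m + 1 ∧ (∀ j, 1 ≤ j → j < n → j ≤ m → 2 / sigb j < β) ∧ (∀ j, n ≤ j → j ≤ m → β ≤ 2 / sigb j) := by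
    rw [hn]; unfold lbeta
    split_ifs with h
    · have hne : {l : ℕ | 1 ≤ l ∧ β ≤ 2 / sigb l}.Nonempty := ⟨m, hm, h⟩
      have hmem := Nat.sInf_mem hne
      have hle : sInf {l : ℕ | 1 ≤ l ∧ β ≤ 2 / sigb l} ≤ m := Nat.sInf_le ⟨hm, h⟩
      refine ⟨hmem.1, by omega, ?_, ?_⟩
      · intro j h1 h2 _
        have := Nat.notMem_of_lt_sInf h2
        by_contra hc
        exact this ⟨h1, not_lt.1 hc⟩
      · intro j h1 h2
        refine hmem.2.trans ?_
        apply div_le_div_of_nonneg_left (by norm_num) (pos j (hmem.1.trans h1) h2) (hsm _ _ hmem.1 h1 h2)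
    · refine ⟨by omega, le_rfl, ?_, ?_⟩
      · intro j h1 _ h3
        refine lt_of_le_of_lt ?_ (not_le.1 h)
        exact div_le_div_of_nonneg_left (by norm_num) (pos m hm le_rfl) (hsm _ _ h1 h3 le_rfl)
      · intro j h1 h2; omega
  obtain ⟨n1, n2, A1, A2⟩ := A
  unfold fpsiLim
  rw [← hn]
  have split : Finset.Icc 1 m = Finset.Icc 1 (n-1) ∪ Finset.Icc n m := by ext; simp; omega
  rw [split, Finset.sum_union (by
    rw [Finset.disjoint_left]; intro a; simp; omega), mul_add, Finset.mul_sum, Finset.mul_sum]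
  congr 1
  · apply Finset.sum_congr rfl
    intro j hj
    rw [Finset.mem_Icc] at hj
    have p := pos j hj.1 (by omega)
    have h1 := A1 j hj.1 (by omega) (by omega)
    rw [div_lt_iff₀ p] at h1
    rw [max_eq_right (by linarith)]
    field_simp; ring
  · apply Finset.sum_congr rfl
    intro j hj
    rw [Finset.mem_Icc] at hj
    have p := pos j (by omega) (by omega)
    have h1 := A2 j hj.1 (by omega)
    rw [le_div_iff₀ p] at h1
    rw [max_eq_left (by linarith)]
    field_simp; ring

theorem thetaEx {M : ℕ} {sigv lamv : ℕ → ℝ} (hp : ScaleParams M sigv lamv) {m : ℕ} {sigb lamb : ℕ → ℝ} {sigbar : ℝ → ℝ}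
    (he : EffParams M sigv lamv m sigb lamb sigbar) {β : ℝ} (hβ : 0 < β) :
    ∃ θ : ℕ → ℝ, (∀ i ∈ Finset.Icc 1 M, 1 ≤ θ i) ∧ (∀ i, 1 ≤ i → i < M → θ (i+1) ≤ θ i) ∧
      ∑ i ∈ Finset.Icc 1 M, (β^2 * sigv i^2 / θ i / 2 + 2 * θ i) * (lamv i - lamv (i-1)) = 2 * fpsiLim m sigb lamb β := by
  have hk := kinks hp he
  obtain ⟨hM, hσ, l0, l1, hinc⟩ := hp
  obtain ⟨hm1, hmM, b0, b1, binc, bdec, bpos, bz, bval, bhull⟩ := he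
  have hsm : ∀ i j, 1 ≤ i → i ≤ j → j ≤ m → sigb j ≤ sigb i := by
    intro i j h1 h2 h3
    induction j, h2 using Nat.le_induction with
    | base => exact le_rfl
    | succ j hij ih => exact (bdec j (by omega) (by omega)).le.trans (ih (by omega))
  choose! k kM kl ks using hk
  have kinj : ∀ i j, i ≤ M → j ≤ M → lamv i ≤ lamv j → i ≤ j := by
    intro i j hi hj h
    by_contra hc
    have := knot_lt hinc (show j < i by omega) hi
    linarith
  have k0 : k 0 = 0 := by
    have := kinj (k 0) 0 (kM 0 (by omega)) (by omega) (by rw [kl 0 (by omega), b0, l0]); omega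
  have km : k m = M := by
    have := kinj M (k m) le_rfl (kM m le_rfl) (by rw [kl m le_rfl, b1, l1])
    have := kM m le_rfl; omega
  refine ⟨fun i => max 1 (β * sigbar (lamv i) / 2), fun i _ => le_max_left _ _, ?_, ?_⟩
  · intro i h1 h2
    have p1 : 0 < lamv i := by rw [← l0]; exact knot_lt hinc (by omega) h2.le
    have p2 : lamv (i+1) ≤ 1 := by rw [← l1]; exact knot_mono hinc (by omega) le_rfl
    have p3 := hinc i h2
    obtain ⟨j, j1, j2, j3⟩ := knot_find (n := m) (κ := lamb) (s := lamv i) (by rw [b0]; exact p1) (by rw [b1]; linarith)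
    obtain ⟨j', j1', j2', j3'⟩ := knot_find (n := m) (κ := lamb) (s := lamv (i+1)) (by rw [b0]; linarith) (by rw [b1]; linarith)
    have hjj : j ≤ j' := by
      by_contra hc
      have := knot_mono binc (show j' + 1 ≤ j by omega) j1.le
      linarith
    have : sigbar (lamv (i+1)) ≤ sigbar (lamv i) := by
      rw [bval (j+1) (by simp; omega) _ (by simpa using j2) j3, bval (j'+1) (by simp; omega) _ (by simpa using j2') j3']
      exact hsm _ _ (by omega) (by omega) (by omega)
    apply max_le_max le_rfl
    have := mul_le_mul_of_nonneg_left this hβ.le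
    linarith
  · rw [← fpsi_eq hβ hm1 bdec bpos]
    have ind : ∀ l, l ≤ m → ∑ i ∈ Finset.Ioc 0 (k l), (β^2 * sigv i^2 / max 1 (β * sigbar (lamv i) / 2) / 2 + 2 * max 1 (β * sigbar (lamv i) / 2)) * (lamv i - lamv (i-1))
        = ∑ j ∈ Finset.Icc 1 l, (β^2 * sigb j^2 / max 1 (β * sigb j / 2) / 2 + 2 * max 1 (β * sigb j / 2)) * (lamb j - lamb (j-1)) := by
      intro l
      induction l with
      | zero => intro _; simp [k0]
      | succ l ih =>
        intro hl
        have hkk : k l ≤ k (l+1) := kinj _ _ (kM _ (by omega)) (kM _ hl) (by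
          rw [kl _ (by omega), kl _ hl]; exact (binc l (by omega)).le)
        rw [← Finset.sum_Ioc_consecutive _ (Nat.zero_le _) hkk, ih (by omega), Finset.sum_Icc_succ_top (by omega)]
        congr 1
        set Θ := max 1 (β * sigb (l+1) / 2)
        have e1 : ∑ i ∈ Finset.Ioc (k l) (k (l+1)), sigv i ^ 2 * (lamv i - lamv (i-1)) = sigb (l+1)^2 * (lamb (l+1) - lamb l) := by
          have a1 := ks (l+1) hl
          have a2 := ks l (by omega)
          rw [Icc_Ioc, ← Finset.sum_Ioc_consecutive _ (Nat.zero_le _) hkk, ← Icc_Ioc, a2, Finset.sum_Icc_succ_top (by omega)] at a1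
          simpa using a1
        have e2 := tele lamv hkk
        rw [kl _ hl, kl _ (by omega)] at e2
        calc _ = ∑ i ∈ Finset.Ioc (k l) (k (l+1)), (β^2/Θ/2 * (sigv i ^ 2 * (lamv i - lamv (i-1))) + 2 * Θ * (lamv i - lamv (i-1))) := by
              apply Finset.sum_congr rfl
              intro i hi
              rw [Finset.mem_Ioc] at hi
              have : sigbar (lamv i) = sigb (l+1) := by
                apply bval (l+1) (by simp; omega)
                · simp only [Nat.add_sub_cancel]; rw [← kl l (by omega)]
                  exact knot_lt hinc hi.1 (hi.2.trans (kM _ hl))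
                · rw [← kl _ hl]; exact knot_mono hinc hi.2 (kM _ hl)
              rw [this]; ring
          _ = _ := by
              rw [Finset.sum_add_distrib, ← Finset.mul_sum, ← Finset.mul_sum, e1, e2]
              simp only [Nat.add_sub_cancel]; ring
    have := ind m le_rfl
    rw [km, ← Icc_Ioc] at this
    exact this

end GTheta

noncomputable section GPre

open MeasureTheory ProbabilityTheory

theorem abelIneq {M : ℕ} (hM : 1 ≤ M) {θ T B : ℕ → ℝ} (hθ : ∀ i, 1 ≤ i → i < M → θ (i+1) ≤ θ i) (hT : T 0 = 0)
    (hTB : ∀ i, 1 ≤ i → i < M → T i ≤ B i) :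
    ∑ i ∈ Finset.Icc 1 M, θ i * (T i - T (i-1)) ≤
      θ 1 * B 0 + ∑ i ∈ Finset.Icc 1 M, θ i * (B i - B (i-1)) + θ M * (T M - B M) := by
  induction M, hM using Nat.le_induction with
  | base => simp [hT]; apply le_of_eq; ring
  | succ M hM ih =>
    have := ih (fun i h1 h2 => hθ i h1 (by omega)) (fun i h1 h2 => hTB i h1 (by omega))
    rw [Finset.sum_Icc_succ_top (by omega), Finset.sum_Icc_succ_top (by omega)]
    simp only [Nat.add_sub_cancel]
    have h1 := mul_nonneg (sub_nonneg.2 (hθ M hM (by omega))) (sub_nonneg.2 (hTB M hM (by omega)))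
    nlinarith

/-- Coefficients of the tilted partial sums. -/
def cT (N : ℕ) (lamv a : ℕ → ℝ) (i : ℕ) (v : Vtx) (w : Vtx) : ℝ :=
  ∑ j ∈ Finset.Icc 1 i, a j * (pc (SN N (lamv j) v) v w - pc (SN N (lamv (j-1)) v) v w)

theorem Lin_cT (N : ℕ) (lamv a : ℕ → ℝ) (i : ℕ) (v : Vtx) (ω : FieldSp) :
    Lin N (cT N lamv a i v) ω =
      ∑ j ∈ Finset.Icc 1 i, a j * (Lin N (pc (SN N (lamv j) v) v) ω - Lin N (pc (SN N (lamv (j-1)) v) v) ω) := by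
  have : cT N lamv a i v = fun w => ∑ j ∈ Finset.Icc 1 i, (fun w => a j * (pc (SN N (lamv j) v) v w - pc (SN N (lamv (j-1)) v) v w)) w := rfl
  rw [this, Lin_sum N _ (fun j w => a j * (pc (SN N (lamv j) v) v w - pc (SN N (lamv (j-1)) v) v w))]
  apply Finset.sum_congr rfl
  intro j _
  rw [Lin_smul, Lin_sub]

theorem cT_var {M : ℕ} {sigv lamv : ℕ → ℝ} (hp : ScaleParams M sigv lamv) {N : ℕ} (hN : 1 ≤ N) (a : ℕ → ℝ) (ε L : ℝ) {v : Vtx}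
    (hv : v ∈ VN N)
    (hvar : ∀ j ∈ Finset.Icc 1 M, HS (SN N (lamv j) v) (fun z => GS (SN N (lamv (j-1)) v) z v) v ≤ (lamv j - lamv (j-1) + ε) * L) :
    ∀ i, i ≤ M → bil N (cT N lamv a i v) (cT N lamv a i v) ≤ (∑ j ∈ Finset.Icc 1 i, a j^2 * (lamv j - lamv (j-1) + ε)) * L := by
  obtain ⟨hM, hσ, l0, l1, hinc⟩ := hp
  have hanti : ∀ i j, i ≤ j → j ≤ M → SN N (lamv j) v ⊆ SN N (lamv i) v := by
    intro i j hij hj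
    exact SN_anti hN hv (by rw [← l0]; exact knot_mono hinc (by omega) (by omega)) (knot_mono hinc hij hj)
      (by rw [← l1]; exact knot_mono hinc hj le_rfl)
  have hb : ∀ i j, i ≤ j → j ≤ M → bil N (pc (SN N (lamv j) v) v) (pc (SN N (lamv i) v) v) = QN N (SN N (lamv i) v) v v :=
    fun i j h1 h2 => bil_pc_pc N _ _ (hanti i j h1 h2) (SN_sub_intr hv) v v
  have hort : ∀ i k, k ≤ i → i + 1 ≤ M → 1 ≤ k →
      bil N (fun w => a k * (pc (SN N (lamv k) v) v w - pc (SN N (lamv (k-1)) v) v w))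
        (fun w => a (i+1) * (pc (SN N (lamv (i+1)) v) v w - pc (SN N (lamv i) v) v w)) = 0 := by
    intro i k h1 h2 h3
    rw [bil_symm, bil_smul_left, bil_smul_right, bil_sub_left, bil_sub_right, bil_sub_right, hb k (i+1) (by omega) h2,
      hb (k-1) (i+1) (by omega) h2, hb k i (by omega) (by omega), hb (k-1) i (by omega) (by omega)]
    ring
  intro i
  induction i with
  | zero =>
    intro _
    have : cT N lamv a 0 v = fun _ => 0 := by funext w; simp [cT]
    rw [this]; simp [bil]
  | succ i ih =>
    intro hi
    have e : cT N lamv a (i+1) v = fun w => cT N lamv a i v w +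
        a (i+1) * (pc (SN N (lamv (i+1)) v) v w - pc (SN N (lamv i) v) v w) := by
      funext w; unfold cT; rw [Finset.sum_Icc_succ_top (by omega)]; simp
    have cross : bil N (cT N lamv a i v) (fun w => a (i+1) * (pc (SN N (lamv (i+1)) v) v w - pc (SN N (lamv i) v) v w)) = 0 := by
      have : cT N lamv a i v = fun w => ∑ j ∈ Finset.Icc 1 i, (fun w => a j * (pc (SN N (lamv j) v) v w - pc (SN N (lamv (j-1)) v) v w)) w := rfl
      rw [this, bil_sum_left N _ (fun j w => a j * (pc (SN N (lamv j) v) v w - pc (SN N (lamv (j-1)) v) v w))]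
      apply Finset.sum_eq_zero
      intro k hk
      rw [Finset.mem_Icc] at hk
      exact hort i k hk.2 hi hk.1
    have cross' : bil N (fun w => a (i+1) * (pc (SN N (lamv (i+1)) v) v w - pc (SN N (lamv i) v) v w)) (cT N lamv a i v) = 0 := by
      rw [bil_symm]; exact cross
    rw [e, bil_add_left, bil_add_right, bil_add_right, cross, cross',
      bil_smul_left, bil_smul_right, bil_nested N _ _ (hanti i (i+1) (by omega) hi) (SN_sub_intr hv), Finset.sum_Icc_succ_top (by omega)]
    have h1 := ih (by omega)
    have h2 := hvar (i+1) (by simp; omega)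
    simp only [Nat.add_sub_cancel] at h2 ⊢
    have h3 := mul_le_mul_of_nonneg_left h2 (sq_nonneg (a (i+1)))
    nlinarith

theorem mkv {N : ℕ} {P : Measure FieldSp} (h : IsGFF N P) (R : Finset Vtx) (c : Vtx → Vtx → ℝ) (V s : ℝ) (hV : 0 ≤ V)
    (hc : ∀ u ∈ R, bil N (c u) (c u) ≤ V) :
    P {ω | Real.exp s < ∑ u ∈ R, Real.exp (Lin N (c u) ω)} ≤ ENNReal.ofReal (R.card * Real.exp (V / 2 - s)) := by
  have hmeas : ∀ u, Measurable (fun ω => ENNReal.ofReal (Real.exp (Lin N (c u) ω))) := fun u =>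
    ENNReal.measurable_ofReal.comp (Real.measurable_exp.comp (Lin_meas N (c u)))
  have hsum : Measurable (fun ω => ∑ u ∈ R, ENNReal.ofReal (Real.exp (Lin N (c u) ω))) := Finset.measurable_sum _ fun u _ => hmeas u
  have hsub : {ω | Real.exp s < ∑ u ∈ R, Real.exp (Lin N (c u) ω)} ⊆
      {ω | ENNReal.ofReal (Real.exp s) ≤ ∑ u ∈ R, ENNReal.ofReal (Real.exp (Lin N (c u) ω))} := by
    intro ω hω
    have hω' : Real.exp s < ∑ u ∈ R, Real.exp (Lin N (c u) ω) := hω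
    show ENNReal.ofReal (Real.exp s) ≤ ∑ u ∈ R, ENNReal.ofReal (Real.exp (Lin N (c u) ω))
    rw [← ENNReal.ofReal_sum_of_nonneg (fun _ _ => (Real.exp_pos _).le)]
    exact ENNReal.ofReal_le_ofReal hω'.le
  refine (measure_mono hsub).trans ((meas_ge_le_lintegral_div hsum.aemeasurable (by simp [Real.exp_pos]) ENNReal.ofReal_ne_top).trans ?_)
  rw [lintegral_finsetSum _ fun u _ => hmeas u]
  have : ∑ u ∈ R, ∫⁻ ω, ENNReal.ofReal (Real.exp (Lin N (c u) ω)) ∂P ≤ ENNReal.ofReal (R.card * Real.exp (V/2)) := by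
    calc _ ≤ R.card • ENNReal.ofReal (Real.exp (V/2)) := by
          apply Finset.sum_le_card_nsmul
          intro u hu
          rw [Lin_exp h]
          apply ENNReal.ofReal_le_ofReal
          apply Real.exp_le_exp.2
          have : ((bil N (c u) (c u)).toNNReal : ℝ) ≤ V := by
            rw [Real.coe_toNNReal']; exact max_le (hc u hu) hV
          linarith
      _ = _ := by rw [nsmul_eq_mul, ENNReal.ofReal_mul (by positivity), ENNReal.ofReal_natCast]
  calc _ ≤ ENNReal.ofReal (R.card * Real.exp (V/2)) / ENNReal.ofReal (Real.exp s) := ENNReal.div_le_div_right this _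
    _ = _ := by
      rw [← ENNReal.ofReal_div_of_pos (Real.exp_pos _), Real.exp_sub]; congr 1; ring

theorem Lin_zero_ae {N : ℕ} {P : Measure FieldSp} (h : IsGFF N P) (c : Vtx → ℝ) (hc : bil N c c = 0) :
    ∀ᵐ ω ∂P, Lin N c ω = 0 := by
  have h1 := Lin_law h c
  rw [hc, Real.toNNReal_zero, gaussianReal_zero_var] at h1
  have h2 : ∀ᵐ x ∂(P.map (Lin N c)), x = 0 := by rw [h1]; simp [ae_dirac_eq]
  exact ae_of_ae_map (Lin_meas N c).aemeasurable h2

theorem goodAE {M : ℕ} {sigv lamv : ℕ → ℝ} (hp : ScaleParams M sigv lamv) {N : ℕ} {P : Measure FieldSp} (h : IsGFF N P) :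
    ∀ᵐ ω ∂P, ∀ v ∈ VN N, Lin N (pc (SN N (lamv 0) v) v) ω = 0 ∧
      psiFld N M sigv lamv P v ω = ∑ i ∈ Finset.Icc 1 M, sigv i *
        (Lin N (pc (SN N (lamv i) v) v) ω - Lin N (pc (SN N (lamv (i-1)) v) v) ω) := by
  have h1 : ∀ v ∈ VN N, ∀ᵐ ω ∂P, Lin N (pc (SN N (lamv 0) v) v) ω = 0 := by
    intro v hv
    apply Lin_zero_ae h
    rw [bil_pc_pc N _ _ subset_rfl (SN_sub_intr hv), hp.2.2.1, SN_zero, QN_zero]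
  have h2 : ∀ v ∈ VN N, ∀ᵐ ω ∂P, ∀ i : ℕ, phiScale N P v (lamv i) ω = Lin N (pc (SN N (lamv i) v) v) ω := by
    intro v hv
    rw [ae_all_iff]
    exact fun i => phiScale_ae h hv (lamv i)
  have h3 : ∀ᵐ ω ∂P, ∀ v ∈ VN N, Lin N (pc (SN N (lamv 0) v) v) ω = 0 := (ae_ball_iff (VN N).countable_toSet).2 h1
  have h4 : ∀ᵐ ω ∂P, ∀ v ∈ VN N, ∀ i : ℕ, phiScale N P v (lamv i) ω = Lin N (pc (SN N (lamv i) v) v) ω := (ae_ball_iff (VN N).countable_toSet).2 h2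
  filter_upwards [h3, h4] with ω a b v hv
  refine ⟨a v hv, ?_⟩
  unfold psiFld
  simp only [b v hv]

end GPre

noncomputable section GFin

open MeasureTheory ProbabilityTheory

theorem detA {M : ℕ} (hM : 1 ≤ M) {θ a : ℕ → ℝ} {p : ℕ → Vtx → ℝ} {D : Finset Vtx} (hD : D.Nonempty) (r : ℕ → Vtx → Vtx)
    (hr : ∀ v, r M v = v) (E : ℝ) (hE : 0 ≤ E) (ha : ∀ i ∈ Finset.Icc 1 M, 0 ≤ a i) (hθ1 : ∀ i ∈ Finset.Icc 1 M, 1 ≤ θ i)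
    (hθ : ∀ i, 1 ≤ i → i < M → θ (i+1) ≤ θ i)
    (hreg : ∀ i, 1 ≤ i → i < M → ∀ v ∈ D, ∀ j ≤ i, |p j v - p j (r i v)| ≤ E) (b : ℕ → ℝ)
    (hY : ∀ i ∈ Finset.Icc 1 M, ∑ u ∈ D.image (r i), Real.exp (∑ j ∈ Finset.Icc 1 i, a j * (p j u - p (j-1) u)) ≤ Real.exp (b i))
    (K : ℝ) (hK : K = 2 * ∑ i ∈ Finset.Icc 1 M, a i) :
    Real.log (∑ v ∈ D, Real.exp (∑ i ∈ Finset.Icc 1 M, θ i * a i * (p i v - p (i-1) v))) ≤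
      θ 1 * (b 0 + K * E) + ∑ i ∈ Finset.Icc 1 M, θ i * (b i - b (i-1)) := by
  set T : ℕ → Vtx → ℝ := fun i u => ∑ j ∈ Finset.Icc 1 i, a j * (p j u - p (j-1) u) with hTdef
  set Γ := θ 1 * (b 0 + K * E) + ∑ i ∈ Finset.Icc 1 M, θ i * (b i - b (i-1)) with hΓ
  have hK0 : 0 ≤ K := by rw [hK]; exact mul_nonneg (by norm_num) (Finset.sum_nonneg ha)
  have hMm : M ∈ Finset.Icc 1 M := by simp; exact hM
  have hTle : ∀ i ∈ Finset.Icc 1 M, ∀ v ∈ D, T i (r i v) ≤ b i := by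
    intro i hi v hv
    have h1 : Real.exp (T i (r i v)) ≤ ∑ u ∈ D.image (r i), Real.exp (T i u) :=
      Finset.single_le_sum (f := fun u => Real.exp (T i u)) (fun _ _ => (Real.exp_pos _).le) (Finset.mem_image_of_mem _ hv)
    exact Real.exp_le_exp.1 (h1.trans (hY i hi))
  have hTdiff : ∀ i, 1 ≤ i → i < M → ∀ v ∈ D, T i v ≤ T i (r i v) + K * E := by
    intro i h1 h2 v hv
    have h3 : T i v - T i (r i v) ≤ ∑ j ∈ Finset.Icc 1 i, a j * (2 * E) := by
      rw [hTdef]; simp only; rw [← Finset.sum_sub_distrib]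
      apply Finset.sum_le_sum
      intro j hj
      rw [Finset.mem_Icc] at hj
      have e1 := abs_le.1 (hreg i h1 h2 v hv j hj.2)
      have e2 := abs_le.1 (hreg i h1 h2 v hv (j-1) (by omega))
      rw [← mul_sub]
      apply mul_le_mul_of_nonneg_left _ (ha j (by simp; omega))
      linarith
    have h4 : ∑ j ∈ Finset.Icc 1 i, a j * (2 * E) ≤ ∑ j ∈ Finset.Icc 1 M, a j * (2 * E) := by
      apply Finset.sum_le_sum_of_subset_of_nonneg (Finset.Icc_subset_Icc le_rfl h2.le)
      intro j hj _
      exact mul_nonneg (ha j hj) (by linarith)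
    rw [← Finset.sum_mul] at h4 h3
    rw [hK]; rw [← Finset.sum_mul] at h4
    linarith
  have key : ∀ v ∈ D, ∑ i ∈ Finset.Icc 1 M, θ i * a i * (p i v - p (i-1) v) ≤ (Γ - b M) + T M v := by
    intro v hv
    have h1 := abelIneq hM (θ := θ) (T := fun i => T i v) (B := fun i => b i + K * E) hθ (by simp [hTdef])
      (fun i h1 h2 => (hTdiff i h1 h2 v hv).trans (by linarith [hTle i (by simp; omega) v hv]))
    have h2 : ∑ i ∈ Finset.Icc 1 M, θ i * (T i v - T (i-1) v) = ∑ i ∈ Finset.Icc 1 M, θ i * a i * (p i v - p (i-1) v) := by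
      apply Finset.sum_congr rfl
      intro i hi
      obtain ⟨k, rfl⟩ : ∃ k, i = k + 1 := ⟨i - 1, by have := (Finset.mem_Icc.1 hi).1; omega⟩
      simp only [hTdef, Nat.add_sub_cancel]
      rw [Finset.sum_Icc_succ_top (by omega)]
      simp only [Nat.add_sub_cancel]; ring
    have h3 : ∑ i ∈ Finset.Icc 1 M, θ i * ((b i + K * E) - (b (i-1) + K * E)) = ∑ i ∈ Finset.Icc 1 M, θ i * (b i - b (i-1)) :=
      Finset.sum_congr rfl fun i _ => by ring
    rw [h2, h3] at h1
    have h4 := hTle M hMm v hv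
    rw [hr] at h4
    have h5 := mul_nonneg (sub_nonneg.2 (hθ1 M hMm)) (sub_nonneg.2 h4)
    have h6 := mul_nonneg (sub_nonneg.2 (hθ1 M hMm)) (mul_nonneg hK0 hE)
    have h7 := mul_nonneg hK0 hE
    nlinarith
  have hZ : ∑ v ∈ D, Real.exp (∑ i ∈ Finset.Icc 1 M, θ i * a i * (p i v - p (i-1) v)) ≤ Real.exp Γ := by
    have hYM := hY M hMm
    have him : D.image (r M) = D := by
      have : r M = id := funext hr
      rw [this, Finset.image_id]
    rw [him] at hYM
    calc _ ≤ ∑ v ∈ D, Real.exp (Γ - b M) * Real.exp (T M v) := by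
          apply Finset.sum_le_sum
          intro v hv
          rw [← Real.exp_add]
          exact Real.exp_le_exp.2 (key v hv)
      _ ≤ Real.exp (Γ - b M) * Real.exp (b M) := by
          rw [← Finset.mul_sum]
          exact mul_le_mul_of_nonneg_left hYM (Real.exp_pos _).le
      _ = _ := by rw [← Real.exp_add]; congr 1; ring
  rw [Real.log_le_iff_le_exp (Finset.sum_pos (fun _ _ => Real.exp_pos _) hD)]
  exact hZ

/-- The first moment exponent. -/
def bb (lamv a : ℕ → ℝ) (ε ρ : ℝ) (i : ℕ) : ℝ :=
  (∑ j ∈ Finset.Icc 1 i, a j^2 * (lamv j - lamv (j-1) + ε)) / 2 + 2 * lamv i - ρ + 3 * ε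

/-- Representatives of the boundary layer at scale `i`. -/
def RR (N : ℕ) (lamv : ℕ → ℝ) (ε ρ : ℝ) (i : ℕ) : Finset Vtx := (VN N \ AN N ρ).image (rep (qq N (lamv i) ε))

theorem probY {M : ℕ} {sigv lamv : ℕ → ℝ} (hp : ScaleParams M sigv lamv) (a : ℕ → ℝ) (ε ρ : ℝ) (hε : 0 < ε)
    (hρ0 : 0 < ρ) (hρ1 : ρ < lamv 1) {i : ℕ} (hi : i ∈ Finset.Icc 1 M) :
    ∀ᶠ N : ℕ in atTop, ∀ P : Measure FieldSp, IsGFF N P →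
      P {ω | Real.exp (bb lamv a ε ρ i * Real.log N) < ∑ u ∈ RR N lamv ε ρ i, Real.exp (Lin N (cT N lamv a i u) ω)} ≤
        ENNReal.ofReal ((N:ℝ)^(-(ε/2))) := by
  have hp' := hp
  obtain ⟨hM, hσ, l0, l1, hinc⟩ := hp'
  rw [Finset.mem_Icc] at hi
  have hv : ∀ᶠ N : ℕ in atTop, ∀ j ∈ Finset.Icc 1 M, ∀ v ∈ VN N,
      HS (SN N (lamv j) v) (fun z => GS (SN N (lamv (j-1)) v) z v) v ≤ (lamv j - lamv (j-1) + ε) * Real.log N := by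
    rw [Filter.eventually_all_finset]
    intro j hj
    rw [Finset.mem_Icc] at hj
    apply varL _ _ _ _ _ _ _ hε
    · rw [← l0]; exact knot_mono hinc (by omega) (by omega)
    · exact knot_mono hinc (by omega) (by omega)
    · rw [← l1]; exact knot_mono hinc (by omega) (by omega)
    · rw [← l1]; exact knot_lt hinc (by omega) (by omega)
  have hl : ρ < lamv i := hρ1.trans_le (knot_mono hinc hi.1 hi.2)
  have hl1 : lamv i ≤ 1 := by rw [← l1]; exact knot_mono hinc hi.2 le_rfl
  filter_upwards [hv, countLem ρ (lamv i) ε hρ0 hl hl1 hε, eventually_ge_atTop 1, ev_log 1, ev_rpow (ε/2) 24 (by linarith)]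
    with N hvN hc hN hL h24 P hP
  have hN0 : (0:ℝ) < N := by exact_mod_cast hN
  set V := ∑ j ∈ Finset.Icc 1 i, a j^2 * (lamv j - lamv (j-1) + ε) with hVdef
  have hV : 0 ≤ V := by
    apply Finset.sum_nonneg
    intro j hj
    rw [Finset.mem_Icc] at hj
    have := knot_mono hinc (i := j-1) (j := j) (by omega) (by omega)
    exact mul_nonneg (sq_nonneg _) (by linarith)
  refine (mkv hP (RR N lamv ε ρ i) (cT N lamv a i) (V * Real.log N) _ (mul_nonneg hV (by linarith)) ?_).trans ?_
  · intro u hu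
    obtain ⟨v, hv, rfl⟩ := Finset.mem_image.1 hu
    have hu' := rep_mem (qq_ge hN (lamv i) ε) (Finset.mem_sdiff.1 hv).1
    exact cT_var hp hN a ε _ hu' (fun j hj => hvN j hj _ hu') i hi.2
  · apply ENNReal.ofReal_le_ofReal
    have e1 : Real.exp (V * Real.log N / 2 - bb lamv a ε ρ i * Real.log N) = (N:ℝ)^(-(2 * lamv i) + ρ - 3 * ε) := by
      rw [Real.rpow_def_of_pos hN0, bb]; congr 1; ring
    rw [e1]
    calc _ ≤ 24 * (N:ℝ)^(2 * lamv i + 2 * ε - ρ) * (N:ℝ)^(-(2 * lamv i) + ρ - 3 * ε) :=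
          mul_le_mul_of_nonneg_right hc (Real.rpow_nonneg hN0.le _)
      _ = 24 * (N:ℝ)^(-ε) := by rw [mul_assoc, ← Real.rpow_add hN0]; congr 2; ring
      _ ≤ (N:ℝ)^(ε/2) * (N:ℝ)^(-ε) := mul_le_mul_of_nonneg_right h24 (Real.rpow_nonneg hN0.le _)
      _ = _ := by rw [← Real.rpow_add hN0]; congr 1; ring

theorem rep_close {N : ℕ} (hN : 1 ≤ N) {l l' ε : ℝ} (h : l' ≤ l) (v : Vtx) :
    rep (qq N l ε) v ∈ Bx v ⌊(N:ℝ)^(1-l'-ε)⌋ ∧ v ∈ Bx (rep (qq N l ε) v) ⌊(N:ℝ)^(1-l'-ε)⌋ := by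
  have hN1 : (1:ℝ) ≤ N := by exact_mod_cast hN
  have h1 : (N:ℝ)^(1-l-ε) ≤ (N:ℝ)^(1-l'-ε) := Real.rpow_le_rpow_of_exponent_le hN1 (by linarith)
  have h2 : qq N l ε - 1 ≤ ⌊(N:ℝ)^(1-l'-ε)⌋ := by
    rw [Int.le_floor]
    have := Int.ceil_lt_add_one ((N:ℝ)^(1-l-ε))
    push_cast
    unfold qq
    linarith
  have h3 := rep_Bx (qq_ge hN l ε) v h2
  refine ⟨h3, ?_⟩
  rw [mem_Bx] at h3 ⊢
  omega

theorem paramIneq {M : ℕ} {sigv lamv : ℕ → ℝ} (hp : ScaleParams M sigv lamv) {θ a : ℕ → ℝ} {β f ε η ρ K : ℝ}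
    (hθ1 : ∀ i ∈ Finset.Icc 1 M, 1 ≤ θ i)
    (hf : ∑ i ∈ Finset.Icc 1 M, (β^2 * sigv i^2 / θ i / 2 + 2 * θ i) * (lamv i - lamv (i-1)) = 2 * f)
    (ha : ∀ i, a i = β * sigv i / θ i) (hρ : 0 < ρ)
    (hε : ε * ((∑ i ∈ Finset.Icc 1 M, θ i * a i^2 / 2) + θ 1 * (3 + K)) ≤ 2 * η) :
    θ 1 * (bb lamv a ε ρ 0 + K * ε) + ∑ i ∈ Finset.Icc 1 M, θ i * (bb lamv a ε ρ i - bb lamv a ε ρ (i-1)) ≤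
      2 * f - ρ + 2 * η := by
  have hb0 : bb lamv a ε ρ 0 = 3 * ε - ρ := by
    simp [bb, hp.2.2.1]; ring
  have hs : ∑ i ∈ Finset.Icc 1 M, θ i * (bb lamv a ε ρ i - bb lamv a ε ρ (i-1)) =
      ∑ i ∈ Finset.Icc 1 M, ((β^2 * sigv i^2 / θ i / 2 + 2 * θ i) * (lamv i - lamv (i-1)) + ε * (θ i * a i^2 / 2)) := by
    apply Finset.sum_congr rfl
    intro i hi
    have hθ := hθ1 i hi
    obtain ⟨k, rfl⟩ : ∃ k, i = k + 1 := ⟨i - 1, by have := (Finset.mem_Icc.1 hi).1; omega⟩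
    simp only [bb, Nat.add_sub_cancel]
    rw [Finset.sum_Icc_succ_top (by omega), ha]
    have : θ (k+1) ≠ 0 := by linarith
    simp only [Nat.add_sub_cancel]
    field_simp
    ring
  rw [hs, hb0, Finset.sum_add_distrib, hf, ← Finset.mul_sum]
  have h1 := hθ1 1 (by simp; exact hp.1)
  nlinarith

end GFin

/-- **Lemma (Upper bound for the free energy near the boundary).**
Let `η > 0`, `β > 0` and `ρ ∈ (0,λ_1)`, and let
`f̃_{N,ρ}^ψ(β) = (log N²)⁻¹ log Σ_{v∈A_{N,ρ}^c} e^{βψ_v}`. There exists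
`c = c(η,β,ρ,σ,λ) > 0` such that for `N` large enough,
`P(f̃_{N,ρ}^ψ(β) > (f^ψ(β) − ρ/2) + η) ≤ N^{−c}`. -/
theorem boundary_free_energy_upper_bound
    (M : ℕ) (sigv lamv : ℕ → ℝ) (hparams : ScaleParams M sigv lamv)
    (m : ℕ) (sigb lamb : ℕ → ℝ) (sigbar : ℝ → ℝ)
    (heff : EffParams M sigv lamv m sigb lamb sigbar)
    (P : ℕ → MeasureTheory.Measure FieldSp) (hGFF : ∀ N, IsGFF N (P N))
    (η β ρ : ℝ) (hη : 0 < η) (hβ : 0 < β) (hρ0 : 0 < ρ) (hρ1 : ρ < lamv 1) :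
    ∃ c : ℝ, 0 < c ∧ ∃ N₀ : ℕ, ∀ N ≥ N₀,
      P N {ω | (fpsiLim m sigb lamb β - ρ / 2) + η <
          (Real.log ((N : ℝ) ^ 2))⁻¹ * Real.log (∑ v ∈ VN N \ AN N ρ,
            Real.exp (β * psiFld N M sigv lamv (P N) v ω))}
        ≤ ENNReal.ofReal ((N : ℝ) ^ (-c)) := by
  obtain ⟨θ, hθ1, hθ, hf⟩ := thetaEx hparams heff hβ
  have hp' := hparams
  obtain ⟨hM, hσ, l0, l1, hinc⟩ := hp'
  set f := fpsiLim m sigb lamb β with hfdef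
  set a : ℕ → ℝ := fun i => β * sigv i / θ i with hadef
  have ha : ∀ i ∈ Finset.Icc 1 M, 0 ≤ a i := fun i hi =>
    div_nonneg (mul_nonneg hβ.le (hσ i hi).le) (by linarith [hθ1 i hi])
  set K := 2 * ∑ i ∈ Finset.Icc 1 M, a i with hK
  have hK0 : 0 ≤ K := mul_nonneg (by norm_num) (Finset.sum_nonneg ha)
  set A := ∑ i ∈ Finset.Icc 1 M, θ i * a i^2 / 2 with hA
  have hA0 : 0 ≤ A := Finset.sum_nonneg fun i hi =>
    div_nonneg (mul_nonneg (by linarith [hθ1 i hi]) (sq_nonneg _)) (by norm_num)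
  have hθ11 : 1 ≤ θ 1 := hθ1 1 (by simp; exact hM)
  have hW : 0 ≤ A + θ 1 * (3 + K) := add_nonneg hA0 (mul_nonneg (by linarith) (by linarith))
  have hlM : lamv (M-1) < 1 := by rw [← l1]; exact knot_lt hinc (by omega) le_rfl
  obtain ⟨ε, hε0, hε1, hε2, hε3⟩ : ∃ ε : ℝ, 0 < ε ∧ ε ≤ 1/2 ∧ ε < 1 - lamv (M-1) ∧ ε * (A + θ 1 * (3 + K)) ≤ 2 * η := by
    refine ⟨min (min (1/2) ((1 - lamv (M-1))/2)) (2 * η / (A + θ 1 * (3 + K) + 1)), ?_, ?_, ?_, ?_⟩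
    · refine lt_min (lt_min (by norm_num) (by linarith)) (by positivity)
    · exact (min_le_left _ _).trans (min_le_left _ _)
    · refine lt_of_le_of_lt ((min_le_left _ _).trans (min_le_right _ _)) (by linarith)
    · refine (mul_le_mul_of_nonneg_right (min_le_right _ _) hW).trans ?_
      rw [div_mul_eq_mul_div, div_le_iff₀ (by linarith)]
      nlinarith
  have hρ1' : ρ < 1 := hρ1.trans_le (by rw [← l1]; exact knot_mono hinc hM le_rfl)
  have evY : ∀ᶠ N : ℕ in atTop, ∀ i ∈ Finset.Icc 1 M, ∀ P : MeasureTheory.Measure FieldSp, IsGFF N P →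
      P {ω | Real.exp (bb lamv a ε ρ i * Real.log N) < ∑ u ∈ RR N lamv ε ρ i, Real.exp (Lin N (cT N lamv a i u) ω)} ≤
        ENNReal.ofReal ((N:ℝ)^(-(ε/2))) := by
    rw [Filter.eventually_all_finset]
    exact fun i hi => probY hparams a ε ρ hε0 hρ0 hρ1 hi
  have evR : ∀ᶠ N : ℕ in atTop, ∀ j ∈ Finset.Ico 1 M, ∀ P : MeasureTheory.Measure FieldSp, IsGFF N P →
      P {ω | ∃ c ∈ VN N, ∃ u ∈ VN N, u ∈ Bx c ⌊(N:ℝ)^(1-lamv j-ε)⌋ ∧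
        ε * Real.log N < Lin N (pc (SN N (lamv j) c) c) ω - Lin N (pc (SN N (lamv j) u) u) ω} ≤ ENNReal.ofReal ((N:ℝ)^(-1:ℝ)) := by
    rw [Filter.eventually_all_finset]
    intro j hj
    rw [Finset.mem_Ico] at hj
    apply regEv _ _ _ _ hε0 _ hε0
    · rw [← l0]; exact knot_lt hinc (by omega) (by omega)
    · have := knot_mono hinc (i := j) (j := M-1) (by omega) (by omega)
      linarith
  have ev : ∀ᶠ N : ℕ in atTop, P N {ω | (f - ρ / 2) + η <
          (Real.log ((N : ℝ) ^ 2))⁻¹ * Real.log (∑ v ∈ VN N \ AN N ρ,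
            Real.exp (β * psiFld N M sigv lamv (P N) v ω))}
        ≤ ENNReal.ofReal ((N : ℝ) ^ (-(ε/4))) := by
    filter_upwards [evY, evR, eventually_ge_atTop 1, ev_log 1, ev_rpow (1-ρ) 2 (by linarith), ev_rpow (ε/4) (2*M) (by linarith)]
      with N hY hR hN hL hNρ hNM
    have hN1 : (1:ℝ) ≤ N := by exact_mod_cast hN
    have hN0 : (0:ℝ) < N := by linarith
    set L := Real.log N with hLdef
    set Ys : ℕ → Set FieldSp := fun i => {ω | Real.exp (bb lamv a ε ρ i * L) <
      ∑ u ∈ RR N lamv ε ρ i, Real.exp (Lin N (cT N lamv a i u) ω)} with hYs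
    set Rs : ℕ → Set FieldSp := fun j => {ω | ∃ c ∈ VN N, ∃ u ∈ VN N, u ∈ Bx c ⌊(N:ℝ)^(1-lamv j-ε)⌋ ∧
        ε * L < Lin N (pc (SN N (lamv j) c) c) ω - Lin N (pc (SN N (lamv j) u) u) ω} with hRs
    have hgood := goodAE hparams (hGFF N)
    set G : Set FieldSp := {ω | ¬ ∀ v ∈ VN N, Lin N (pc (SN N (lamv 0) v) v) ω = 0 ∧
      psiFld N M sigv lamv (P N) v ω = ∑ i ∈ Finset.Icc 1 M, sigv i *
        (Lin N (pc (SN N (lamv i) v) v) ω - Lin N (pc (SN N (lamv (i-1)) v) v) ω)} with hG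
    have hG0 : P N G = 0 := hgood
    have hsub : {ω | (f - ρ / 2) + η < (Real.log ((N : ℝ) ^ 2))⁻¹ * Real.log (∑ v ∈ VN N \ AN N ρ,
            Real.exp (β * psiFld N M sigv lamv (P N) v ω))} ⊆
        (G ∪ ⋃ i ∈ Finset.Icc 1 M, Ys i) ∪ ⋃ j ∈ Finset.Ico 1 M, Rs j := by
      intro ω hω
      by_contra hcon
      rw [Set.mem_union, Set.mem_union, not_or, not_or] at hcon
      obtain ⟨⟨hg, hy⟩, hr⟩ := hcon
      have hg' : ∀ v ∈ VN N, Lin N (pc (SN N (lamv 0) v) v) ω = 0 ∧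
        psiFld N M sigv lamv (P N) v ω = ∑ i ∈ Finset.Icc 1 M, sigv i *
        (Lin N (pc (SN N (lamv i) v) v) ω - Lin N (pc (SN N (lamv (i-1)) v) v) ω) := by
        by_contra h; exact hg h
      have hy' : ∀ i ∈ Finset.Icc 1 M, ∑ u ∈ RR N lamv ε ρ i, Real.exp (Lin N (cT N lamv a i u) ω) ≤
          Real.exp (bb lamv a ε ρ i * L) := by
        intro i hi
        by_contra h
        exact hy (Set.mem_biUnion hi (not_le.1 h))
      have hr' : ∀ j ∈ Finset.Ico 1 M, ∀ c ∈ VN N, ∀ u ∈ VN N, u ∈ Bx c ⌊(N:ℝ)^(1-lamv j-ε)⌋ →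
          Lin N (pc (SN N (lamv j) c) c) ω - Lin N (pc (SN N (lamv j) u) u) ω ≤ ε * L := by
        intro j hj c hc u hu hcu
        by_contra h
        exact hr (Set.mem_biUnion hj ⟨c, hc, u, hu, hcu, not_le.1 h⟩)
      have hE0 : 0 ≤ ε * L := mul_nonneg hε0.le (by linarith)
      have main := detA hM (θ := θ) (a := a) (p := fun j v => Lin N (pc (SN N (lamv j) v) v) ω)
        (D := VN N \ AN N ρ) ⟨_, zero_bd (by linarith)⟩ (fun i => rep (qq N (lamv i) ε))
        (by intro v; simp only [l1]; rw [qq_one hN hε0.le, rep_one]) (ε * L) hE0 ha hθ1 hθ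
        (by
          intro i h1 h2 v hv j hj
          have hv' := (Finset.mem_sdiff.1 hv).1
          have hu' := rep_mem (qq_ge hN (lamv i) ε) hv'
          rcases Nat.eq_zero_or_pos j with rfl | hj0
          · simp only [(hg' v hv').1, (hg' _ hu').1]
            simpa using hE0
          · have hc := rep_close hN (ε := ε) (knot_mono hinc hj h2.le) v
            have hjm : j ∈ Finset.Ico 1 M := by rw [Finset.mem_Ico]; omega
            have e1 := hr' j hjm v hv' _ hu' hc.1
            have e2 := hr' j hjm _ hu' v hv' hc.2
            rw [abs_le]
            constructor <;> linarith)
        (fun i => bb lamv a ε ρ i * L)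
        (by
          intro i hi
          have := hy' i hi
          simp only [Lin_cT] at this
          exact this) K hK
      have hsum : ∑ v ∈ VN N \ AN N ρ, Real.exp (∑ i ∈ Finset.Icc 1 M, θ i * a i *
          (Lin N (pc (SN N (lamv i) v) v) ω - Lin N (pc (SN N (lamv (i-1)) v) v) ω)) =
          ∑ v ∈ VN N \ AN N ρ, Real.exp (β * psiFld N M sigv lamv (P N) v ω) := by
        apply Finset.sum_congr rfl
        intro v hv
        rw [(hg' v (Finset.mem_sdiff.1 hv).1).2, Finset.mul_sum]
        congr 1
        apply Finset.sum_congr rfl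
        intro i hi
        have : θ i ≠ 0 := by linarith [hθ1 i hi]
        have : θ i * a i = β * sigv i := by rw [hadef]; field_simp
        rw [this]; ring
      rw [hsum] at main
      have hpar := paramIneq (β := β) (f := f) (a := a) (ρ := ρ) hparams hθ1 hf (fun i => rfl) hρ0 hε3
      have hpar2 := mul_le_mul_of_nonneg_right hpar (by linarith : 0 ≤ L)
      have heq : θ 1 * (bb lamv a ε ρ 0 * L + K * (ε * L)) +
          ∑ i ∈ Finset.Icc 1 M, θ i * (bb lamv a ε ρ i * L - bb lamv a ε ρ (i-1) * L) =
          (θ 1 * (bb lamv a ε ρ 0 + K * ε) + ∑ i ∈ Finset.Icc 1 M, θ i * (bb lamv a ε ρ i - bb lamv a ε ρ (i-1))) * L := by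
        rw [add_mul, Finset.sum_mul]
        congr 1
        · ring
        · exact Finset.sum_congr rfl fun i _ => by ring
      rw [heq] at main
      have hfin := main.trans hpar2
      have hω' : (f - ρ / 2) + η < (Real.log ((N : ℝ) ^ 2))⁻¹ * Real.log (∑ v ∈ VN N \ AN N ρ,
            Real.exp (β * psiFld N M sigv lamv (P N) v ω)) := hω
      rw [Real.log_pow, inv_mul_eq_div, lt_div_iff₀ (by push_cast; linarith)] at hω'
      push_cast at hω'
      linarith
    have hs1 : P N (⋃ i ∈ Finset.Icc 1 M, Ys i) ≤ ENNReal.ofReal (M * (N:ℝ)^(-(ε/2))) := by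
      refine (MeasureTheory.measure_biUnion_finset_le _ _).trans ((Finset.sum_le_card_nsmul _ _ _ fun i hi => hY i hi _ (hGFF N)).trans ?_)
      rw [Nat.card_Icc, nsmul_eq_mul, ENNReal.ofReal_mul (by positivity), ENNReal.ofReal_natCast, Nat.add_sub_cancel]
    have hs2 : P N (⋃ j ∈ Finset.Ico 1 M, Rs j) ≤ ENNReal.ofReal (M * (N:ℝ)^(-(ε/2))) := by
      refine (MeasureTheory.measure_biUnion_finset_le _ _).trans ((Finset.sum_le_card_nsmul _ _ _ fun i hi => hR i hi _ (hGFF N)).trans ?_)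
      rw [Nat.card_Ico, nsmul_eq_mul, ENNReal.ofReal_mul (by positivity), ENNReal.ofReal_natCast]
      gcongr
      · omega
      · linarith
    calc _ ≤ P N ((G ∪ ⋃ i ∈ Finset.Icc 1 M, Ys i) ∪ ⋃ j ∈ Finset.Ico 1 M, Rs j) := MeasureTheory.measure_mono hsub
      _ ≤ (P N G + P N (⋃ i ∈ Finset.Icc 1 M, Ys i)) + P N (⋃ j ∈ Finset.Ico 1 M, Rs j) :=
          (MeasureTheory.measure_union_le _ _).trans (add_le_add (MeasureTheory.measure_union_le _ _) le_rfl)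
      _ ≤ ENNReal.ofReal (M * (N:ℝ)^(-(ε/2))) + ENNReal.ofReal (M * (N:ℝ)^(-(ε/2))) := by
          rw [hG0, zero_add]; exact add_le_add hs1 hs2
      _ = ENNReal.ofReal ((2 * M) * (N:ℝ)^(-(ε/2))) := by
          rw [← ENNReal.ofReal_add (by positivity) (by positivity)]; congr 1; ring
      _ ≤ _ := by
          apply ENNReal.ofReal_le_ofReal
          calc _ ≤ (N:ℝ)^(ε/4) * (N:ℝ)^(-(ε/2)) := mul_le_mul_of_nonneg_right hNM (Real.rpow_nonneg hN0.le _)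
            _ = _ := by rw [← Real.rpow_add hN0]; congr 1; ring
  obtain ⟨N₀, h⟩ := eventually_atTop.1 ev
  exact ⟨ε/4, by linarith, N₀, h⟩
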